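/- Fix an integer r ≥ 2 and an r-partite r-pattern P, and let M_n be a uniformly random ordered r-matching of size n. Then there exists a constant b > 1/Γ((r+1)/r) such that L_P(M_n)/n^{1/r} converges in probability to b as n → ∞, where Γ denotes the Gamma function. -/

import Mathlib

/-- An ordered `r`-matching of size `n`: a partition of `{1,…,r*n}` into `n`
edges, each of size `r`. -/
def IsOrderedMatching (r n : ℕ) (M : Finset (Finset ℕ)) : Prop :=
  M.card = n ∧ (∀ e ∈ M, e.card = r) ∧
    (∀ e ∈ M, ∀ f ∈ M, e ≠ f → Disjoint e f) ∧
    M.biUnion id = Finset.Icc 1 (r * n)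

/-- Two edges `e, f` form the pattern `P`: there is a strictly increasing map
on `e ∪ f` sending the pair `{e, f}` to the pair of edges of `P`. -/
def FormsPattern (e f : Finset ℕ) (P : Finset (Finset ℕ)) : Prop :=
  ∃ φ : ℕ → ℕ, StrictMonoOn φ (↑(e ∪ f) : Set ℕ) ∧
    ({e.image φ, f.image φ} : Finset (Finset ℕ)) = P

/-- An `r`-pattern: an ordered `r`-matching of size `2` (on `{1,…,2r}`). -/
def IsPattern (r : ℕ) (P : Finset (Finset ℕ)) : Prop :=
  IsOrderedMatching r 2 P

/-- A collection of edges in which every pair of distinct edges forms `P`. -/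
def IsPatternClique (P S : Finset (Finset ℕ)) : Prop :=
  ∀ e ∈ S, ∀ f ∈ S, e ≠ f → FormsPattern e f P

/-- `L_P(M)`: the maximum size of a sub-matching of `M` which is a `P`-clique. -/
noncomputable def cliqueSize (P M : Finset (Finset ℕ)) : ℕ :=
  sSup {k | ∃ S ⊆ M, IsPatternClique P S ∧ S.card = k}

/-- `L(M) = max_P L_P(M)`, the maximum over all `r`-patterns `P`. -/
noncomputable def Lmax (r : ℕ) (M : Finset (Finset ℕ)) : ℕ :=
  sSup {k | ∃ P, IsPattern r P ∧ cliqueSize P M = k}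

/-- An ordered `r`-matching on `{1,…,r*n}` is `r`-partite if, dividing the
vertex set into `r` contiguous intervals of length `n`, every edge has exactly
one vertex in each interval. -/
def IsPartite (r n : ℕ) (M : Finset (Finset ℕ)) : Prop :=
  ∀ e ∈ M, ∀ i : ℕ, 1 ≤ i → i ≤ r →
    (e ∩ Finset.Icc ((i - 1) * n + 1) (i * n)).card = 1

/-- The number of ordered `r`-matchings of size `n` (on `{1,…,r*n}`). -/
noncomputable def totalMatchings (r n : ℕ) : ℕ :=
  Nat.card {M : Finset (Finset ℕ) // IsOrderedMatching r n M}

/-- The number of ordered `r`-matchings `M` of size `n` for which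
`L_P(M)/n^(1/r)` deviates from `b` by at least `ε`. -/
noncomputable def deviantMatchings (r : ℕ) (P : Finset (Finset ℕ)) (b ε : ℝ) (n : ℕ) : ℕ :=
  Nat.card {M : Finset (Finset ℕ) // IsOrderedMatching r n M ∧
    ε ≤ |(cliqueSize P M : ℝ) / (n : ℝ) ^ ((1 : ℝ) / (r : ℝ)) - b|}

/-- For a uniformly random ordered `r`-matching `M_n` of size `n`, the random
variable `L_P(M_n)/n^(1/r)` converges in probability to `b` as `n → ∞`: for
every `ε > 0`, the proportion of ordered `r`-matchings of size `n` with
`|L_P(M)/n^(1/r) - b| ≥ ε` tends to `0`. -/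
def CliqueSizeConvergesTo (r : ℕ) (P : Finset (Finset ℕ)) (b : ℝ) : Prop :=
  ∀ ε : ℝ, 0 < ε →
    Filter.Tendsto (fun n => (deviantMatchings r P b ε n : ℝ) / (totalMatchings r n : ℝ))
      Filter.atTop (nhds 0)

namespace PartiteClique

open MeasureTheory Finset ProbabilityTheory Filter Topology

section CliqueNumber

variable {ι κ α β : Type*}

/-- The index set `S` is a clique of the configuration `X` inside `A`, for the relation `R`. -/
def IsIndexClique (A : Set α) (R : α → α → Prop) (X : ι → α) (S : Finset ι) : Prop :=
  (∀ i ∈ S, X i ∈ A) ∧ ∀ i ∈ S, ∀ j ∈ S, i ≠ j → R (X i) (X j)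

open Classical in
/-- The largest size of a clique of the configuration `X` inside `A`. -/
noncomputable def cliqueNum [Fintype ι] (A : Set α) (R : α → α → Prop) (X : ι → α) : ℕ :=
  (univ.filter (IsIndexClique A R X)).sup card

theorem IsIndexClique.subset {A : Set α} {R : α → α → Prop} {X : ι → α} {S T : Finset ι}
    (h : IsIndexClique A R X S) (hT : T ⊆ S) : IsIndexClique A R X T :=
  ⟨fun i hi => h.1 i (hT hi), fun i hi j hj => h.2 i (hT hi) j (hT hj)⟩

theorem isIndexClique_map {A : Set α} {R : α → α → Prop} {X : ι → α} (f : κ ↪ ι)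
    (S : Finset κ) : IsIndexClique A R X (S.map f) ↔ IsIndexClique A R (X ∘ f) S := by
  simp [IsIndexClique]

theorem IsIndexClique.card_le [Fintype ι] {A : Set α} {R : α → α → Prop} {X : ι → α}
    {S : Finset ι} (h : IsIndexClique A R X S) : S.card ≤ cliqueNum A R X := by
  classical
  exact Finset.le_sup (f := card) (mem_filter.2 ⟨mem_univ _, h⟩)

theorem exists_isIndexClique [Fintype ι] (A : Set α) (R : α → α → Prop) (X : ι → α) :
    ∃ S, IsIndexClique A R X S ∧ S.card = cliqueNum A R X := by
  classical
  have hne : (univ.filter (IsIndexClique A R X)).Nonempty :=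
    ⟨∅, by simp [IsIndexClique]⟩
  obtain ⟨S, hS, h⟩ := Finset.exists_mem_eq_sup _ hne card
  exact ⟨S, (mem_filter.1 hS).2, h.symm⟩

theorem cliqueNum_le_iff [Fintype ι] {A : Set α} {R : α → α → Prop} {X : ι → α} {k : ℕ} :
    cliqueNum A R X ≤ k ↔ ∀ S, IsIndexClique A R X S → S.card ≤ k := by
  refine ⟨fun h S hS => hS.card_le.trans h, fun h => ?_⟩
  obtain ⟨S, hS, e⟩ := exists_isIndexClique A R X
  exact e ▸ h S hS

theorem cliqueNum_le_card [Fintype ι] (A : Set α) (R : α → α → Prop) (X : ι → α) :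
    cliqueNum A R X ≤ Fintype.card ι :=
  cliqueNum_le_iff.2 fun S _ => S.card_le_univ

theorem cliqueNum_comp_le [Fintype ι] [Fintype κ] (A : Set α) (R : α → α → Prop) (X : ι → α)
    (f : κ ↪ ι) : cliqueNum A R (X ∘ f) ≤ cliqueNum A R X :=
  cliqueNum_le_iff.2 fun S hS => by
    simpa using ((isIndexClique_map f S).2 hS).card_le

theorem cliqueNum_comp_equiv [Fintype ι] [Fintype κ] (A : Set α) (R : α → α → Prop) (X : ι → α)
    (e : κ ≃ ι) : cliqueNum A R (X ∘ e) = cliqueNum A R X := by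
  refine le_antisymm (cliqueNum_comp_le A R X e.toEmbedding) ?_
  have := cliqueNum_comp_le A R (X ∘ e) e.symm.toEmbedding
  simpa [Function.comp_assoc] using this

/-- The clique number inside `A` is the clique number of the subfamily of points in `A`. -/
theorem cliqueNum_eq_subtype [Fintype ι] {A : Set α} {R : α → α → Prop} {X : ι → α}
    (S : Finset ι) (hS : ∀ i, X i ∈ A ↔ i ∈ S) :
    cliqueNum A R X = cliqueNum Set.univ R (fun i : S => X i) := by
  classical
  apply le_antisymm
  · refine cliqueNum_le_iff.2 fun T hT => ?_
    have hTS : T ⊆ S := fun i hi => (hS i).1 (hT.1 i hi)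
    have : IsIndexClique Set.univ R (fun i : S => X i) (T.subtype (· ∈ S)) :=
      ⟨fun _ _ => trivial, fun i hi j hj n => hT.2 i (by simpa using hi) j (by simpa using hj)
        (fun h => n (Subtype.ext h))⟩
    have h2 := this.card_le
    rwa [card_subtype, filter_true_of_mem hTS] at h2
  · refine cliqueNum_le_iff.2 fun T hT => ?_
    have : IsIndexClique A R X (T.map (Function.Embedding.subtype _)) :=
      ⟨fun i hi => by
        obtain ⟨a, -, rfl⟩ := mem_map.1 hi
        exact (hS _).2 a.2, ((isIndexClique_map _ T).2 hT).2⟩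
    simpa using this.card_le

section Measurability

variable [MeasurableSpace α]

theorem measurableSet_isIndexClique {A : Set α} (hA : MeasurableSet A) {R : α → α → Prop}
    (hR : MeasurableSet {p : α × α | R p.1 p.2}) (S : Finset ι) :
    MeasurableSet {X : ι → α | IsIndexClique A R X S} := by
  have : {X : ι → α | IsIndexClique A R X S} =
      (⋂ i ∈ S, (fun X : ι → α => X i) ⁻¹' A) ∩
      ⋂ i ∈ S, ⋂ j ∈ S, ⋂ _ : i ≠ j,
        (fun X : ι → α => (X i, X j)) ⁻¹' {p : α × α | R p.1 p.2} := by
    ext X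
    simp [IsIndexClique]
  rw [this]
  refine (Finset.measurableSet_biInter _ fun i _ => measurable_pi_apply i hA).inter
    (Finset.measurableSet_biInter _ fun i _ => Finset.measurableSet_biInter _ fun j _ =>
      MeasurableSet.iInter fun _ => ?_)
  exact ((measurable_pi_apply i).prodMk (measurable_pi_apply j)) hR

theorem measurable_cliqueNum [Fintype ι] {A : Set α} (hA : MeasurableSet A) {R : α → α → Prop}
    (hR : MeasurableSet {p : α × α | R p.1 p.2}) :
    Measurable fun X : ι → α => cliqueNum A R X := by
  refine measurable_to_nat fun X₀ => ?_
  have : ∀ k, MeasurableSet {X : ι → α | k ≤ cliqueNum A R X} := by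
    intro k
    have : {X : ι → α | k ≤ cliqueNum A R X} =
        ⋃ S : Finset ι, ⋃ _ : k ≤ S.card, {X | IsIndexClique A R X S} := by
      ext X
      simp only [Set.mem_ofPred_eq, Set.mem_iUnion, exists_prop]
      constructor
      · intro h
        obtain ⟨S, hS, e⟩ := exists_isIndexClique A R X
        exact ⟨S, e ▸ h, hS⟩
      · rintro ⟨S, hk, hS⟩
        exact hk.trans hS.card_le
    rw [this]
    exact MeasurableSet.iUnion fun S => MeasurableSet.iUnion fun _ =>
      measurableSet_isIndexClique hA hR S
  have e : (fun X : ι → α => cliqueNum A R X) ⁻¹' {cliqueNum A R X₀} =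
      {X | cliqueNum A R X₀ ≤ cliqueNum A R X} \ {X | cliqueNum A R X₀ + 1 ≤ cliqueNum A R X} := by
    ext X
    simp only [Set.mem_preimage, Set.mem_singleton_iff, Set.mem_sdiff, Set.mem_ofPred_eq]
    omega
  rw [e]
  exact (this _).diff (this _)

theorem measurable_cliqueNum_real [Fintype ι] {A : Set α} (hA : MeasurableSet A)
    {R : α → α → Prop} (hR : MeasurableSet {p : α × α | R p.1 p.2}) :
    Measurable fun X : ι → α => (cliqueNum A R X : ℝ) :=
  measurable_from_top.comp (measurable_cliqueNum hA hR)

theorem integrable_of_bounded {Ω : Type*} [MeasurableSpace Ω] {P : Measure Ω} [IsFiniteMeasure P]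
    {f : Ω → ℝ} (hf : Measurable f) (C : ℝ) (h : ∀ x, |f x| ≤ C) : Integrable f P :=
  Integrable.of_bound hf.aestronglyMeasurable C (Filter.Eventually.of_forall h)

theorem integrable_cliqueNum [Fintype ι] {A : Set α} (hA : MeasurableSet A) {R : α → α → Prop}
    (hR : MeasurableSet {p : α × α | R p.1 p.2}) (P : Measure (ι → α)) [IsFiniteMeasure P] :
    Integrable (fun X : ι → α => (cliqueNum A R X : ℝ)) P :=
  integrable_of_bounded (measurable_cliqueNum_real hA hR) (Fintype.card ι) fun X => by
    rw [abs_of_nonneg (Nat.cast_nonneg _)]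
    exact_mod_cast cliqueNum_le_card A R X

end Measurability

end CliqueNumber

section Marginals

variable {ι κ : Type*} [Fintype ι] [Fintype κ] {α : Type*} [MeasurableSpace α]

/-- The marginal of a product probability measure along an injective reindexing. -/
theorem pi_map_comp_injective (ν : κ → Measure α) [∀ k, IsProbabilityMeasure (ν k)] (f : ι → κ)
    (hf : Function.Injective f) :
    (Measure.pi ν).map (fun X : κ → α => X ∘ f) = Measure.pi (fun i => ν (f i)) := by
  classical
  symm
  refine Measure.pi_eq fun s hs => ?_
  have hm : Measurable (fun X : κ → α => X ∘ f) :=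
    measurable_pi_lambda _ fun i => measurable_pi_apply _
  rw [Measure.map_apply hm (MeasurableSet.univ_pi hs)]
  have : (fun X : κ → α => X ∘ f) ⁻¹' Set.univ.pi s =
      Set.univ.pi fun k => {x | ∀ i, f i = k → x ∈ s i} := by
    ext X
    simp only [Set.mem_preimage, Set.mem_univ_pi, Function.comp, Set.mem_ofPred_eq]
    exact ⟨fun h k i e => e ▸ h i, fun h i => h _ i rfl⟩
  rw [this, Measure.pi_pi]
  have h1 : ∀ k ∉ univ.image f, ν k {x | ∀ i, f i = k → x ∈ s i} = 1 := by
    intro k hk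
    have : {x | ∀ i, f i = k → x ∈ s i} = Set.univ := by
      ext x
      simp only [Set.mem_ofPred_eq, Set.mem_univ, iff_true]
      intro i e
      exact absurd (mem_image.2 ⟨i, mem_univ _, e⟩) hk
    rw [this, measure_univ]
  rw [← Finset.prod_subset (subset_univ (univ.image f)) fun k _ hk => h1 k hk,
    Finset.prod_image fun a _ b _ h => hf h]
  refine Finset.prod_congr rfl fun i _ => ?_
  congr 1
  ext x
  simp only [Set.mem_ofPred_eq]
  exact ⟨fun h => h i rfl, fun h j e => hf e ▸ h⟩

theorem integral_comp_injective (ν : κ → Measure α) [∀ k, IsProbabilityMeasure (ν k)] (f : ι → κ)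
    (hf : Function.Injective f) {F : (ι → α) → ℝ} (hF : Measurable F) :
    ∫ X, F (X ∘ f) ∂Measure.pi ν = ∫ Y, F Y ∂Measure.pi (fun i => ν (f i)) := by
  rw [← pi_map_comp_injective ν f hf, integral_map]
  · exact (measurable_pi_lambda _ fun i => measurable_pi_apply _).aemeasurable
  · exact hF.aestronglyMeasurable

/-- The expected clique number of `n` independent points with law `ν`. -/
noncomputable def meanClique (ν : Measure α) (A : Set α) (R : α → α → Prop) (n : ℕ) : ℝ :=
  ∫ X, (cliqueNum A R X : ℝ) ∂Measure.pi (fun _ : Fin n => ν)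

theorem integral_cliqueNum_eq_meanClique (ν : Measure α) [IsProbabilityMeasure ν] {A : Set α}
    (hA : MeasurableSet A) {R : α → α → Prop} (hR : MeasurableSet {p : α × α | R p.1 p.2}) :
    ∫ X, (cliqueNum A R X : ℝ) ∂Measure.pi (fun _ : ι => ν) =
      meanClique ν A R (Fintype.card ι) := by
  have e := Fintype.equivFin ι
  rw [meanClique, ← integral_comp_injective (fun _ : Fin (Fintype.card ι) => ν) e e.injective
    (measurable_cliqueNum_real hA hR)]
  simp_rw [cliqueNum_comp_equiv]

theorem meanClique_nonneg (ν : Measure α) (A : Set α) (R : α → α → Prop) (n : ℕ) :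
    0 ≤ meanClique ν A R n :=
  integral_nonneg fun _ => Nat.cast_nonneg _

theorem meanClique_le (ν : Measure α) [IsProbabilityMeasure ν] (A : Set α) (R : α → α → Prop)
    (n : ℕ) : meanClique ν A R n ≤ n := by
  calc meanClique ν A R n ≤ ∫ _, (n : ℝ) ∂Measure.pi (fun _ : Fin n => ν) := by
        refine integral_mono_of_nonneg (Filter.Eventually.of_forall fun _ => Nat.cast_nonneg _)
          (integrable_const _) (Filter.Eventually.of_forall fun X => ?_)
        have := cliqueNum_le_card A R X
        rw [Fintype.card_fin] at this
        exact Nat.cast_le.2 this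
    _ = n := by simp

theorem meanClique_mono (ν : Measure α) [IsProbabilityMeasure ν] {A : Set α}
    (hA : MeasurableSet A) {R : α → α → Prop} (hR : MeasurableSet {p : α × α | R p.1 p.2}) :
    Monotone (meanClique ν A R) := by
  intro m n h
  have e : meanClique ν A R m = ∫ X, (cliqueNum A R (X ∘ Fin.castLE h) : ℝ)
      ∂Measure.pi (fun _ : Fin n => ν) :=
    (integral_comp_injective (fun _ : Fin n => ν) (Fin.castLE h) (Fin.castLE_injective h)
      (measurable_cliqueNum_real hA hR)).symm
  rw [e]
  refine integral_mono ?_ (integrable_cliqueNum hA hR _) fun X => ?_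
  · exact integrable_of_bounded ((measurable_cliqueNum_real hA hR).comp
      (measurable_pi_lambda _ fun i => measurable_pi_apply _)) m fun X => by
        rw [abs_of_nonneg (Nat.cast_nonneg _)]
        have := cliqueNum_le_card A R (X ∘ Fin.castLE h)
        rw [Fintype.card_fin] at this
        exact_mod_cast this
  · exact Nat.cast_le.2 (cliqueNum_comp_le A R X (Fin.castLEEmb h))

end Marginals

section Deletion

variable {α : Type*}

theorem IsIndexClique.card_le_comp_ne {ι : Type*} [Fintype ι] [DecidableEq ι] {A : Set α}
    {R : α → α → Prop} {X : ι → α} {S : Finset ι} (h : IsIndexClique A R X S) {j : ι}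
    (hj : j ∉ S) : S.card ≤ cliqueNum A R fun i : {i // i ≠ j} => X i.1 := by
  have h' : (S.subtype (· ≠ j)).map (Function.Embedding.subtype _) = S :=
    Finset.subtype_map_of_mem fun i hi e => hj (e ▸ hi)
  rw [← h', card_map]
  refine IsIndexClique.card_le ?_
  exact (isIndexClique_map (X := X) (Function.Embedding.subtype (· ≠ j)) _).1 (h'.symm ▸ h)

theorem sum_sq_cliqueNum_sub_le {ι : Type*} [Fintype ι] [DecidableEq ι] (A : Set α)
    (R : α → α → Prop) (X : ι → α) :
    ∑ j, ((cliqueNum A R X : ℝ) - cliqueNum A R fun i : {i // i ≠ j} => X i.1) ^ 2 ≤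
      cliqueNum A R X := by
  obtain ⟨S, hS, e⟩ := exists_isIndexClique A R X
  have hle : ∀ j, cliqueNum A R (fun i : {i // i ≠ j} => X i.1) ≤ cliqueNum A R X := fun j =>
    cliqueNum_comp_le A R X (Function.Embedding.subtype (· ≠ j))
  have hge : ∀ j, cliqueNum A R X ≤ cliqueNum A R (fun i : {i // i ≠ j} => X i.1) +
      if j ∈ S then 1 else 0 := by
    intro j
    have := (hS.subset (S.erase_subset j)).card_le_comp_ne (S.notMem_erase j)
    by_cases hj : j ∈ S
    · rw [card_erase_of_mem hj] at this
      simp only [hj, if_true]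
      omega
    · rw [erase_eq_of_notMem hj] at this
      simp only [hj, if_false]
      omega
  calc _ ≤ ∑ j, (if j ∈ S then (1 : ℝ) else 0) := by
        refine sum_le_sum fun j _ => ?_
        have h1 : (cliqueNum A R (fun i : {i // i ≠ j} => X i.1) : ℝ) ≤ cliqueNum A R X := by
          exact_mod_cast hle j
        have h2 : (cliqueNum A R X : ℝ) ≤ cliqueNum A R (fun i : {i // i ≠ j} => X i.1) +
            if j ∈ S then 1 else 0 := by exact_mod_cast hge j
        split_ifs at h2 ⊢ <;> nlinarith
    _ = cliqueNum A R X := by simp [e]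

/-- The number of points of the configuration `X` in the set `B`. -/
noncomputable def countIn {ι : Type*} [Fintype ι] (B : Set α) (X : ι → α) : ℕ :=
  cliqueNum B (fun _ _ => True) X

open Classical in
theorem countIn_eq {ι : Type*} [Fintype ι] (B : Set α) (X : ι → α) :
    countIn B X = (univ.filter fun i => X i ∈ B).card := by
  refine le_antisymm (cliqueNum_le_iff.2 fun S hS => card_le_card fun i hi => ?_) ?_
  · exact mem_filter.2 ⟨mem_univ _, hS.1 i hi⟩
  · exact IsIndexClique.card_le ⟨fun i hi => (mem_filter.1 hi).2, fun _ _ _ _ _ => trivial⟩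

theorem countIn_le {ι : Type*} [Fintype ι] (B : Set α) (X : ι → α) :
    countIn B X ≤ Fintype.card ι := cliqueNum_le_card _ _ _

end Deletion

section Variance

variable {α : Type*} [MeasurableSpace α]

theorem measurable_insertNth_uncurry {n : ℕ} (j : Fin (n + 1)) :
    Measurable fun p : α × (Fin n → α) => (Fin.insertNth j p.1 p.2 : Fin (n + 1) → α) :=
  (MeasurableEquiv.piFinSuccAbove (fun _ : Fin (n + 1) => α) j).symm.measurable

/-- Fubini for `n + 1` independent points, singling out the point with index `j`. -/
theorem integral_pi_insertNth (ν : Measure α) [IsProbabilityMeasure ν] {n : ℕ} (j : Fin (n + 1))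
    {f : (Fin (n + 1) → α) → ℝ} (hf : Measurable f) (C : ℝ) (hC : ∀ X, |f X| ≤ C) :
    ∫ X, f X ∂Measure.pi (fun _ : Fin (n + 1) => ν) =
      ∫ x, ∫ Y, f (Fin.insertNth j x Y) ∂Measure.pi (fun _ : Fin n => ν) ∂ν := by
  have h := (measurePreserving_piFinSuccAbove (fun _ : Fin (n + 1) => ν) j).symm
  rw [← h.integral_comp']
  exact integral_prod _ (integrable_of_bounded (hf.comp (measurable_insertNth_uncurry j)) C
    fun p => hC _)

theorem integral_sub_sq {Ω : Type*} [MeasurableSpace Ω] (P : Measure Ω) [IsProbabilityMeasure P]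
    {f : Ω → ℝ} (hf : Measurable f) (C : ℝ) (hC : ∀ x, |f x| ≤ C) (c : ℝ) :
    ∫ x, (f x - c) ^ 2 ∂P = ∫ x, f x ^ 2 ∂P - 2 * c * ∫ x, f x ∂P + c ^ 2 := by
  have h1 : Integrable f P := integrable_of_bounded hf C hC
  have h2 : Integrable (fun x => f x ^ 2) P :=
    integrable_of_bounded (hf.pow_const 2) (C ^ 2) fun x => by
      rw [abs_pow]; exact pow_le_pow_left₀ (abs_nonneg _) (hC x) 2
  have : ∀ x, (f x - c) ^ 2 = f x ^ 2 - 2 * c * f x + c ^ 2 := fun x => by ring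
  simp_rw [this]
  have h3 := h1.const_mul (2 * c)
  rw [integral_add (f := fun x => f x ^ 2 - 2 * c * f x) (h2.sub h3) (integrable_const _),
    integral_sub h2 h3, integral_const_mul]
  simp

theorem sq_integral_le {Ω : Type*} [MeasurableSpace Ω] (P : Measure Ω) [IsProbabilityMeasure P]
    {f : Ω → ℝ} (hf : Measurable f) (C : ℝ) (hC : ∀ x, |f x| ≤ C) (c : ℝ) :
    ∫ x, f x ^ 2 ∂P - (∫ x, f x ∂P) ^ 2 ≤ ∫ x, (f x - c) ^ 2 ∂P := by
  rw [integral_sub_sq P hf C hC]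
  nlinarith [sq_nonneg (∫ x, f x ∂P - c)]

theorem integral_sq_ge {Ω : Type*} [MeasurableSpace Ω] (P : Measure Ω) [IsProbabilityMeasure P]
    {f : Ω → ℝ} (hf : Measurable f) (C : ℝ) (hC : ∀ x, |f x| ≤ C) :
    (∫ x, f x ∂P) ^ 2 ≤ ∫ x, f x ^ 2 ∂P := by
  have h : 0 ≤ ∫ x, (f x - ∫ y, f y ∂P) ^ 2 ∂P := integral_nonneg fun _ => sq_nonneg _
  rw [integral_sub_sq P hf C hC] at h
  nlinarith

/-- The Efron–Stein inequality for bounded functions. -/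
theorem efron_stein (ν : Measure α) [IsProbabilityMeasure ν] (C : ℝ) : ∀ (n : ℕ)
    {f : (Fin n → α) → ℝ} (_ : Measurable f) (_ : ∀ X, |f X| ≤ C)
    {c : Fin n → (Fin n → α) → ℝ} (_ : ∀ j, Measurable (c j)) (_ : ∀ j X, |c j X| ≤ C)
    (_ : ∀ j X a, c j (Function.update X j a) = c j X),
    ∫ X, f X ^ 2 ∂Measure.pi (fun _ : Fin n => ν) - (∫ X, f X ∂Measure.pi (fun _ : Fin n => ν)) ^ 2
      ≤ ∑ j, ∫ X, (f X - c j X) ^ 2 ∂Measure.pi (fun _ : Fin n => ν) := by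
  intro n
  induction n with
  | zero =>
    intro f hf hC c _ _ _
    have := Measure.pi_of_empty (fun _ : Fin 0 => ν)
    simp [this]
  | succ n ih =>
    intro f hf hC c hc hcC hcu
    set Q := Measure.pi (fun _ : Fin n => ν) with hQ
    have key : ∀ {g : (Fin (n + 1) → α) → ℝ} (_ : Measurable g) (D : ℝ) (_ : ∀ X, |g X| ≤ D),
        ∫ X, g X ∂Measure.pi (fun _ : Fin (n + 1) => ν) = ∫ x, ∫ Y, g (Fin.cons x Y) ∂Q ∂ν ∧
        (Measurable fun x => ∫ Y, g (Fin.cons x Y) ∂Q) ∧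
        (∀ x, |∫ Y, g (Fin.cons x Y) ∂Q| ≤ D) ∧
        (∀ x, Measurable fun Y : Fin n → α => g (Fin.cons x Y)) := by
      intro g hg D hD
      have hm : Measurable fun p : α × (Fin n → α) => g (Fin.cons p.1 p.2) := by
        simpa [Function.comp_def] using hg.comp (measurable_insertNth_uncurry 0)
      refine ⟨by simpa using integral_pi_insertNth ν 0 hg D hD,
        hm.stronglyMeasurable.integral_prod_right'.measurable, fun x => ?_,
        fun x => hm.comp measurable_prodMk_left⟩
      refine (abs_integral_le_integral_abs).trans ?_
      calc ∫ Y, |g (Fin.cons x Y)| ∂Q ≤ ∫ _, D ∂Q :=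
            integral_mono_of_nonneg (Filter.Eventually.of_forall fun _ => abs_nonneg _)
              (integrable_const _) (Filter.Eventually.of_forall fun Y => hD _)
        _ = D := by simp
    have hsq : ∀ X, |f X ^ 2| ≤ C ^ 2 := fun X => by
      rw [abs_pow]; exact pow_le_pow_left₀ (abs_nonneg _) (hC X) 2
    have hd : ∀ j X, |(f X - c j X) ^ 2| ≤ (2 * C) ^ 2 := fun j X => by
      rw [abs_pow]
      refine pow_le_pow_left₀ (abs_nonneg _) ?_ 2
      have := abs_sub (f X) (c j X)
      linarith [hC X, hcC j X]
    obtain ⟨f1, f2, f3, f4⟩ := key hf C hC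
    obtain ⟨q1, q2, q3, -⟩ := key (hf.pow_const 2) (C ^ 2) hsq
    have hdm : ∀ j, Measurable fun X => (f X - c j X) ^ 2 := fun j => (hf.sub (hc j)).pow_const 2
    have d := fun j => key (hdm j) _ (hd j)
    rw [f1, q1, Fin.sum_univ_succ]
    simp_rw [fun j => (d j).1]
    set m : α → ℝ := fun x => ∫ Y, f (Fin.cons x Y) ∂Q with hm
    have hmm : Integrable (fun x => m x ^ 2) ν :=
      integrable_of_bounded (f2.pow_const 2) (C ^ 2) fun x => by
        rw [abs_pow]; exact pow_le_pow_left₀ (abs_nonneg _) (f3 x) 2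
    have hqi : Integrable (fun x => ∫ Y, f (Fin.cons x Y) ^ 2 ∂Q) ν :=
      integrable_of_bounded q2 _ q3
    have hdi := fun j => integrable_of_bounded (P := ν) (d j).2.1 _ (d j).2.2.1
    have e1 : ∫ x, ∫ Y, f (Fin.cons x Y) ^ 2 ∂Q ∂ν - ∫ x, m x ^ 2 ∂ν ≤
        ∑ j : Fin n, ∫ x, ∫ Y, (f (Fin.cons x Y) - c j.succ (Fin.cons x Y)) ^ 2 ∂Q ∂ν := by
      rw [← integral_sub hqi hmm, ← integral_finsetSum _ fun j _ => hdi j.succ]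
      refine integral_mono (hqi.sub hmm) (integrable_finsetSum _ fun j _ => hdi j.succ)
        fun x => ?_
      refine ih (f4 x) (fun Y => hC _) (c := fun j Y => c j.succ (Fin.cons x Y))
        (fun j => (key (hc j.succ) C (hcC _)).2.2.2 x) (fun j Y => hcC _ _) fun j Y a => ?_
      rw [Fin.cons_update, hcu]
    have e2 : ∫ x, m x ^ 2 ∂ν - (∫ x, m x ∂ν) ^ 2 ≤
        ∫ x, ∫ Y, (f (Fin.cons x Y) - c 0 (Fin.cons x Y)) ^ 2 ∂Q ∂ν := by
      obtain ⟨c1, c2, c3, c4⟩ := key (hc 0) C (hcC 0)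
      obtain ⟨x₀⟩ : Nonempty α := nonempty_of_isProbabilityMeasure ν
      refine (sq_integral_le ν f2 C f3 (∫ Y, c 0 (Fin.cons x₀ Y) ∂Q)).trans ?_
      have hb : Integrable (fun x => (m x - ∫ Y, c 0 (Fin.cons x₀ Y) ∂Q) ^ 2) ν :=
        integrable_of_bounded ((f2.sub_const _).pow_const 2) ((2 * C) ^ 2) fun x => by
          rw [abs_pow]
          refine pow_le_pow_left₀ (abs_nonneg _) ?_ 2
          have := abs_sub (m x) (∫ Y, c 0 (Fin.cons x₀ Y) ∂Q)
          linarith [f3 x, c3 x₀]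
      refine integral_mono hb (hdi 0) fun x => ?_
      have hx : ∀ Y, c 0 (Fin.cons x₀ Y) = c 0 (Fin.cons x Y) := fun Y => by
        have := hcu 0 (Fin.cons x Y) x₀
        rwa [Fin.update_cons_zero] at this
      simp_rw [hx]
      have i1 : Integrable (fun Y => f (Fin.cons x Y)) Q :=
        integrable_of_bounded (f4 x) C fun _ => hC _
      have i2 : Integrable (fun Y => c 0 (Fin.cons x Y)) Q :=
        integrable_of_bounded (c4 x) C fun _ => hcC _ _
      have hs := integral_sub i1 i2
      simp only [hm]
      rw [← hs]
      exact integral_sq_ge Q (f := fun Y => f (Fin.cons x Y) - c 0 (Fin.cons x Y))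
        ((f4 x).sub (c4 x)) (2 * C) fun Y => by
          have := abs_sub (f (Fin.cons x Y)) (c 0 (Fin.cons x Y))
          linarith [hC (Fin.cons x Y), hcC 0 (Fin.cons x Y)]
    linarith

/-- The variance of a clique number of independent points is at most its mean. -/
theorem variance_cliqueNum_le (ν : Measure α) [IsProbabilityMeasure ν] {A : Set α}
    (hA : MeasurableSet A) {R : α → α → Prop} (hR : MeasurableSet {p : α × α | R p.1 p.2})
    (n : ℕ) :
    ∫ X, ((cliqueNum A R X : ℝ) - meanClique ν A R n) ^ 2 ∂Measure.pi (fun _ : Fin n => ν) ≤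
      meanClique ν A R n := by
  have hm := measurable_cliqueNum_real (ι := Fin n) hA hR
  have hb : ∀ X : Fin n → α, |(cliqueNum A R X : ℝ)| ≤ n := fun X => by
    rw [abs_of_nonneg (Nat.cast_nonneg _)]
    simpa using (Nat.cast_le (α := ℝ)).2 (cliqueNum_le_card A R X)
  have hr : ∀ j, Measurable fun X : Fin n → α => fun i : {i // i ≠ j} => X i.1 := fun j =>
    measurable_pi_lambda _ fun i => measurable_pi_apply i.1
  have hcm : ∀ j, Measurable fun X : Fin n → α =>
      (cliqueNum A R (fun i : {i // i ≠ j} => X i.1) : ℝ) := fun j =>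
    (measurable_cliqueNum_real hA hR).comp (hr j)
  have hcb : ∀ j, ∀ X : Fin n → α,
      |(cliqueNum A R (fun i : {i // i ≠ j} => X i.1) : ℝ)| ≤ n := fun j X => by
    rw [abs_of_nonneg (Nat.cast_nonneg _)]
    refine (Nat.cast_le.2 ?_).trans ((le_abs_self _).trans (hb X))
    exact cliqueNum_comp_le A R X (Function.Embedding.subtype (· ≠ j))
  have es := efron_stein ν n n hm hb hcm hcb fun j X a => by
    congr 2
    funext i
    exact Function.update_of_ne i.2 _ _
  have h1 := integral_sub_sq (Measure.pi fun _ : Fin n => ν) hm n hb (meanClique ν A R n)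
  rw [← meanClique] at h1 es
  have hi : ∀ j, Integrable (fun X : Fin n → α => ((cliqueNum A R X : ℝ) -
      cliqueNum A R fun i : {i // i ≠ j} => X i.1) ^ 2) (Measure.pi fun _ : Fin n => ν) := fun j =>
    integrable_of_bounded ((hm.sub (hcm j)).pow_const 2) ((2 * n) ^ 2) fun X => by
      rw [abs_pow]
      refine pow_le_pow_left₀ (abs_nonneg _) ?_ 2
      have := abs_sub (cliqueNum A R X : ℝ) (cliqueNum A R fun i : {i // i ≠ j} => X i.1)
      linarith [hb X, hcb j X]
  rw [← integral_finsetSum _ fun j _ => hi j] at es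
  have h2 : ∫ X, ∑ j, ((cliqueNum A R X : ℝ) - cliqueNum A R fun i : {i // i ≠ j} => X i.1) ^ 2
      ∂Measure.pi (fun _ : Fin n => ν) ≤ meanClique ν A R n :=
    integral_mono (integrable_finsetSum _ fun j _ => hi j) (integrable_cliqueNum hA hR _)
      fun X => sum_sq_cliqueNum_sub_le A R X
  rw [h1]
  nlinarith

theorem measurable_countIn {ι : Type*} [Fintype ι] {B : Set α} (hB : MeasurableSet B) :
    Measurable fun X : ι → α => countIn B X :=
  measurable_cliqueNum hB MeasurableSet.univ

theorem integral_countIn (ν : Measure α) [IsProbabilityMeasure ν] {B : Set α}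
    (hB : MeasurableSet B) (n : ℕ) :
    ∫ X, (countIn B X : ℝ) ∂Measure.pi (fun _ : Fin n => ν) = n * ν.real B := by
  classical
  have h : ∀ X : Fin n → α, (countIn B X : ℝ) = ∑ i, B.indicator (fun _ => (1 : ℝ)) (X i) := by
    intro X
    rw [countIn_eq]
    simp [Set.indicator_apply]
  simp_rw [h]
  have hi : Measurable (B.indicator fun _ => (1 : ℝ)) := measurable_const.indicator hB
  rw [integral_finsetSum]
  · have : ∀ i : Fin n, ∫ X, B.indicator (fun _ => (1 : ℝ)) (X i)
        ∂Measure.pi (fun _ : Fin n => ν) = ν.real B := fun i => by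
      rw [integral_comp_eval (μ := fun _ : Fin n => ν) (i := i) hi.aestronglyMeasurable]
      simp [integral_indicator hB, Measure.real]
    simp [this]
  · intro i _
    refine integrable_of_bounded (hi.comp (measurable_pi_apply i)) 1 fun X => ?_
    by_cases hx : X i ∈ B <;> simp [hx]

theorem variance_countIn_le (ν : Measure α) [IsProbabilityMeasure ν] {B : Set α}
    (hB : MeasurableSet B) (n : ℕ) :
    ∫ X, ((countIn B X : ℝ) - n * ν.real B) ^ 2 ∂Measure.pi (fun _ : Fin n => ν) ≤
      n * ν.real B := by
  have := variance_cliqueNum_le ν hB (R := fun _ _ => True) MeasurableSet.univ n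
  have e : meanClique ν B (fun _ _ => True) n = n * ν.real B := integral_countIn ν hB n
  rwa [e] at this

end Variance

section Thinning

variable {α : Type*} [MeasurableSpace α]

theorem setIntegral_eq_mul_cond {P : Measure α} [IsFiniteMeasure P] {E : Set α} (hE : P E ≠ 0)
    (F : α → ℝ) : ∫ x in E, F x ∂P = P.real E * ∫ x, F x ∂P[|E] := by
  rw [ProbabilityTheory.cond, integral_smul_measure, ENNReal.toReal_inv, smul_eq_mul,
    ← Measure.real, ← mul_assoc,
    mul_inv_cancel₀, one_mul]
  rw [Measure.real, ENNReal.toReal_ne_zero]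
  exact ⟨hE, measure_ne_top _ _⟩

theorem cond_pi {ι : Type*} [Fintype ι] {β : ι → Type*} [∀ i, MeasurableSpace (β i)]
    (ν : ∀ i, Measure (β i)) [∀ i, IsProbabilityMeasure (ν i)] {s : ∀ i, Set (β i)}
    (hs : ∀ i, MeasurableSet (s i)) (h0 : ∀ i, ν i (s i) ≠ 0) :
    (Measure.pi ν)[|Set.univ.pi s] = Measure.pi fun i => (ν i)[|s i] := by
  have : ∀ i, IsProbabilityMeasure ((ν i)[|s i]) := fun i => cond_isProbabilityMeasure (h0 i)
  symm
  refine Measure.pi_eq fun t ht => ?_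
  rw [cond_apply (MeasurableSet.univ_pi hs), ← Set.pi_inter_distrib, Measure.pi_pi, Measure.pi_pi,
    ENNReal.prod_inv_distrib, ← prod_mul_distrib]
  · exact prod_congr rfl fun i _ => (cond_apply (hs i) _ _).symm
  · intro i _ j _ _
    exact Or.inr (measure_ne_top _ _)

/-- Conditionally on their number, the points falling in `B` are independent with the
conditioned law. -/
theorem integral_cliqueNum_eq_integral_meanClique (ν : Measure α) [IsProbabilityMeasure ν]
    {B : Set α} (hB : MeasurableSet B) (hB0 : ν B ≠ 0) {R : α → α → Prop}
    (hR : MeasurableSet {p : α × α | R p.1 p.2}) (n : ℕ) :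
    meanClique ν B R n =
      ∫ X, meanClique (ν[|B]) Set.univ R (countIn B X) ∂Measure.pi (fun _ : Fin n => ν) := by
  classical
  have hpB : IsProbabilityMeasure (ν[|B]) := cond_isProbabilityMeasure hB0
  set s : Finset (Fin n) → Fin n → Set α := fun S i => if i ∈ S then B else Bᶜ with hs
  have hsm : ∀ S i, MeasurableSet (s S i) := fun S i => by
    simp only [hs]; split_ifs
    exacts [hB, hB.compl]
  set E : Finset (Fin n) → Set (Fin n → α) := fun S => Set.univ.pi (s S) with hE
  have hEm : ∀ S, MeasurableSet (E S) := fun S => MeasurableSet.univ_pi (hsm S)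
  have hmem : ∀ S X, X ∈ E S ↔ ∀ i, X i ∈ B ↔ i ∈ S := fun S X => by
    simp only [hE, hs, Set.mem_univ_pi]
    refine forall_congr' fun i => ?_
    by_cases h : i ∈ S <;> simp [h]
  have hcover : ⋃ S ∈ (univ : Finset (Finset (Fin n))), E S = Set.univ := by
    refine Set.eq_univ_of_forall fun X => Set.mem_iUnion₂.2
      ⟨univ.filter fun i => X i ∈ B, mem_univ _, (hmem _ _).2 fun i => by simp⟩
  have hdisj : Set.Pairwise (univ : Finset (Finset (Fin n))) (Function.onFun Disjoint E) := by
    intro S _ T _ hST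
    refine Set.disjoint_left.2 fun X h1 h2 => hST ?_
    ext i
    rw [← (hmem _ _).1 h1 i, ← (hmem _ _).1 h2 i]
  have hsplit : ∀ {F : (Fin n → α) → ℝ}, Integrable F (Measure.pi fun _ : Fin n => ν) →
      ∫ X, F X ∂Measure.pi (fun _ : Fin n => ν) =
        ∑ S, ∫ X in E S, F X ∂Measure.pi (fun _ : Fin n => ν) := by
    intro F hF
    rw [← setIntegral_univ, ← hcover, integral_biUnion_finset _ (fun S _ => hEm S) hdisj
      fun S _ => hF.integrableOn]
  have hmc : Measurable fun X : Fin n → α => meanClique (ν[|B]) Set.univ R (countIn B X) :=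
    (measurable_from_top (f := meanClique (ν[|B]) Set.univ R)).comp (measurable_countIn hB)
  rw [meanClique, hsplit (integrable_cliqueNum hB hR _), hsplit]
  · refine sum_congr rfl fun S _ => ?_
    have e1 : ∫ X in E S, (cliqueNum B R X : ℝ) ∂Measure.pi (fun _ : Fin n => ν) =
        ∫ X in E S, (cliqueNum Set.univ R (X ∘ ((↑) : S → Fin n)) : ℝ)
          ∂Measure.pi (fun _ : Fin n => ν) :=
      setIntegral_congr_fun (hEm S) fun X hX => by
        rw [cliqueNum_eq_subtype S ((hmem S X).1 hX)]
        rfl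
    have e2 : ∫ X in E S, meanClique (ν[|B]) Set.univ R (countIn B X)
        ∂Measure.pi (fun _ : Fin n => ν) = ∫ X in E S, meanClique (ν[|B]) Set.univ R S.card
          ∂Measure.pi (fun _ : Fin n => ν) :=
      setIntegral_congr_fun (hEm S) fun X hX => by
        congr 1
        rw [countIn_eq]
        congr 1
        ext i
        simp [(hmem S X).1 hX i]
    rw [e1, e2]
    by_cases h0 : Measure.pi (fun _ : Fin n => ν) (E S) = 0
    · rw [setIntegral_measure_zero _ h0, setIntegral_measure_zero _ h0]
    have h0' : ∀ i, ν (s S i) ≠ 0 := by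
      rw [hE, Measure.pi_pi] at h0
      exact fun i => (Finset.prod_ne_zero_iff.1 h0) i (mem_univ i)
    have hp : ∀ i, IsProbabilityMeasure (ν[|s S i]) := fun i => cond_isProbabilityMeasure (h0' i)
    rw [setIntegral_eq_mul_cond h0, setIntegral_eq_mul_cond h0]
    congr 1
    rw [hE, cond_pi (fun _ : Fin n => ν) (hsm S) h0', integral_comp_injective
      (fun i => ν[|s S i]) ((↑) : S → Fin n) Subtype.val_injective
      (F := fun X => (cliqueNum Set.univ R X : ℝ)) (measurable_cliqueNum_real .univ hR)]
    have e3 : (fun i : S => ν[|s S i]) = fun _ => ν[|B] := by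
      funext i
      simp [hs]
    rw [e3, integral_cliqueNum_eq_meanClique _ .univ hR]
    simp
  · refine integrable_of_bounded hmc n fun X => ?_
    rw [abs_of_nonneg (meanClique_nonneg _ _ _ _)]
    refine (meanClique_le _ _ _ _).trans ?_
    simpa using (Nat.cast_le (α := ℝ)).2 (countIn_le B X)

end Thinning

/-- The uniform distribution on the open unit interval. -/
noncomputable def unitMeasure : Measure ℝ := volume.restrict (Set.Ioo 0 1)

instance : IsProbabilityMeasure unitMeasure := ⟨by simp [unitMeasure]⟩

instance : NullSingletonClass unitMeasure := by unfold unitMeasure; infer_instance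

/-- The uniform distribution on the open unit cube of dimension `r`. -/
noncomputable def cubeMeasure (r : ℕ) : Measure (Fin r → ℝ) := Measure.pi fun _ => unitMeasure

instance (r : ℕ) : IsProbabilityMeasure (cubeMeasure r) := by
  unfold cubeMeasure; infer_instance

/-- The coordinatewise strict order, reversed in the coordinates where `ε` is `false`. -/
def SignLT {r : ℕ} (ε : Fin r → Bool) (x y : Fin r → ℝ) : Prop :=
  ∀ i, if ε i then x i < y i else y i < x i

/-- Comparability for the order `SignLT ε`. -/
def SignComparable {r : ℕ} (ε : Fin r → Bool) (x y : Fin r → ℝ) : Prop :=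
  SignLT ε x y ∨ SignLT ε y x

theorem measurableSet_signLT {r : ℕ} (ε : Fin r → Bool) :
    MeasurableSet {p : (Fin r → ℝ) × (Fin r → ℝ) | SignLT ε p.1 p.2} := by
  simp only [SignLT, Set.ofPred_forall]
  refine MeasurableSet.iInter fun i => ?_
  have h1 : Measurable fun p : (Fin r → ℝ) × (Fin r → ℝ) => p.1 i :=
    (measurable_pi_apply i).comp measurable_fst
  have h2 : Measurable fun p : (Fin r → ℝ) × (Fin r → ℝ) => p.2 i :=
    (measurable_pi_apply i).comp measurable_snd
  cases ε i
  · simpa using measurableSet_lt h2 h1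
  · simpa using measurableSet_lt h1 h2

theorem measurableSet_signComparable {r : ℕ} (ε : Fin r → Bool) :
    MeasurableSet {p : (Fin r → ℝ) × (Fin r → ℝ) | SignComparable ε p.1 p.2} :=
  (measurableSet_signLT ε).union
    ((measurableSet_signLT ε).preimage (measurable_snd.prodMk measurable_fst))

section FirstMoment

/-- Transposing a matrix of independent identically distributed entries. -/
theorem pi_map_curry (ι κ : Type) [Fintype ι] [Fintype κ] (U : Measure ℝ)
    [IsProbabilityMeasure U] :
    (Measure.pi fun _ : ι × κ => U).map (MeasurableEquiv.curry ι κ ℝ) =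
      Measure.pi fun _ : ι => Measure.pi fun _ : κ => U := by
  have := Measure.infinitePi_map_curry (ι := ι) (κ := κ) (X := ℝ) (μ := fun _ _ => U)
  simpa only [Measure.infinitePi_eq_pi] using this

theorem map_flip_pi {ι κ : Type} [Fintype ι] [Fintype κ] (U : Measure ℝ)
    [IsProbabilityMeasure U] :
    (Measure.pi fun _ : ι => Measure.pi fun _ : κ => U).map (fun X j i => X i j) =
      Measure.pi fun _ : κ => Measure.pi fun _ : ι => U := by
  have hs := pi_map_comp_injective (fun _ : ι × κ => U) (Prod.swap : κ × ι → ι × κ)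
    Prod.swap_injective
  rw [← pi_map_curry ι κ, ← pi_map_curry κ ι, ← hs, Measure.map_map, Measure.map_map]
  · rfl
  · exact (MeasurableEquiv.curry κ ι ℝ).measurable
  · exact measurable_pi_lambda _ fun i => measurable_pi_apply _
  · exact measurable_pi_lambda _ fun j => measurable_pi_lambda _ fun i =>
      (measurable_pi_apply j).comp (measurable_pi_apply i)
  · exact (MeasurableEquiv.curry ι κ ℝ).measurable

theorem measurableSet_strictMono {k : ℕ} : MeasurableSet {x : Fin k → ℝ | StrictMono x} := by
  simp only [StrictMono, Set.ofPred_forall]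
  refine MeasurableSet.iInter fun a => MeasurableSet.iInter fun b => MeasurableSet.iInter fun _ =>
    measurableSet_lt (measurable_pi_apply a) (measurable_pi_apply b)

theorem pi_strictMono_comp_le (U : Measure ℝ) [IsProbabilityMeasure U] {D : Set ℝ}
    (hD : MeasurableSet D) {k : ℕ} (σ : Equiv.Perm (Fin k)) :
    (Measure.pi fun _ : Fin k => U) {x | StrictMono (x ∘ σ) ∧ ∀ j, x j ∈ D} ≤
      U D ^ k / k.factorial := by
  set Q := Measure.pi fun _ : Fin k => U
  set E : Equiv.Perm (Fin k) → Set (Fin k → ℝ) := fun σ => {x | StrictMono (x ∘ σ) ∧ ∀ j, x j ∈ D}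
    with hE
  have hcm : ∀ σ : Equiv.Perm (Fin k), Measurable fun x : Fin k → ℝ => x ∘ σ := fun σ =>
    measurable_pi_lambda _ fun i => measurable_pi_apply _
  have hDm : MeasurableSet {x : Fin k → ℝ | ∀ j, x j ∈ D} := by
    simp only [Set.ofPred_forall]
    exact MeasurableSet.iInter fun j => measurable_pi_apply j hD
  have hEm : ∀ σ, MeasurableSet (E σ) := fun σ =>
    (measurableSet_strictMono.preimage (hcm σ)).inter hDm
  have heq : ∀ σ, Q (E σ) = Q (E 1) := by
    intro σ
    have := pi_map_comp_injective (fun _ : Fin k => U) σ σ.injective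
    have h : E σ = (fun x : Fin k → ℝ => x ∘ σ) ⁻¹' E 1 := by
      ext x
      simp only [hE, Set.mem_preimage, Set.mem_ofPred_eq, Equiv.Perm.coe_one, Function.comp_id,
        Function.comp_apply]
      refine and_congr Iff.rfl ⟨fun h j => h _, fun h j => ?_⟩
      simpa using h (σ.symm j)
    rw [h, ← Measure.map_apply (hcm σ) (hEm 1), this]
  have hdisj : Pairwise (Function.onFun Disjoint E) := by
    intro σ τ hne
    refine Set.disjoint_left.2 fun x h1 h2 => hne ?_
    have hinj : Function.Injective x := by
      have := h1.1.injective
      rwa [Function.Injective.of_comp_iff' _ σ.bijective] at this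
    have : x ∘ σ = x ∘ τ := Tuple.unique_monotone h1.1.monotone h2.1.monotone
    ext i
    exact congrArg Fin.val (hinj (congrFun this i))
  have hsum : (k.factorial : ENNReal) * Q (E 1) ≤ U D ^ k := by
    have h1 : Q (⋃ σ, E σ) = ∑ σ, Q (E σ) := by
      rw [measure_iUnion hdisj hEm, tsum_fintype]
    simp only [heq, sum_const, card_univ, Fintype.card_perm, Fintype.card_fin, nsmul_eq_mul] at h1
    rw [← h1]
    calc Q (⋃ σ, E σ) ≤ Q (Set.univ.pi fun _ => D) :=
          measure_mono (Set.iUnion_subset fun σ x hx j _ => hx.2 j)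
      _ = U D ^ k := by simp [Q, Measure.pi_pi]
  change Q (E σ) ≤ _
  rw [heq, ENNReal.le_div_iff_mul_le (Or.inl (by exact_mod_cast k.factorial_ne_zero))
    (Or.inl (ENNReal.natCast_ne_top _)), mul_comm]
  exact hsum

theorem pi_signLT_le {r k : ℕ} (ε : Fin r → Bool) {D : Fin r → Set ℝ}
    (hD : ∀ i, MeasurableSet (D i)) (σ : Equiv.Perm (Fin k)) :
    (Measure.pi fun _ : Fin k => cubeMeasure r)
        {X | (∀ a b, a < b → SignLT ε (X (σ a)) (X (σ b))) ∧ ∀ j i, X j i ∈ D i} ≤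
      ∏ i, (unitMeasure (D i) ^ k / k.factorial) := by
  set E : Fin r → Set (Fin k → ℝ) := fun i =>
    {x | StrictMono (x ∘ (if ε i then σ else Fin.revPerm.trans σ : Equiv.Perm (Fin k))) ∧
      ∀ j, x j ∈ D i} with hE
  have hm : Measurable fun (X : Fin k → Fin r → ℝ) (i : Fin r) (j : Fin k) => X j i :=
    measurable_pi_lambda _ fun j => measurable_pi_lambda _ fun i =>
      (measurable_pi_apply j).comp (measurable_pi_apply i)
  have hEm : ∀ i, MeasurableSet (E i) := fun i => by
    have hDm : MeasurableSet {x : Fin k → ℝ | ∀ j, x j ∈ D i} := by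
      simp only [Set.ofPred_forall]
      exact MeasurableSet.iInter fun j => measurable_pi_apply j (hD i)
    exact MeasurableSet.inter (measurableSet_strictMono.preimage
      (measurable_pi_lambda _ fun i => measurable_pi_apply _)) hDm
  calc _ ≤ (Measure.pi fun _ : Fin k => cubeMeasure r)
        ((fun (X : Fin k → Fin r → ℝ) (i : Fin r) (j : Fin k) => X j i) ⁻¹' Set.univ.pi E) := by
        refine measure_mono fun X hX i _ => ⟨?_, fun j => hX.2 j i⟩
        intro a b hab
        by_cases h : ε i
        · simpa [h] using hX.1 a b hab i
        · have := hX.1 b.rev a.rev (Fin.rev_lt_rev.2 hab) i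
          simpa [h] using this
    _ = ∏ i, (Measure.pi fun _ : Fin k => unitMeasure) (E i) := by
        rw [← Measure.map_apply hm (MeasurableSet.univ_pi hEm), cubeMeasure, map_flip_pi,
          Measure.pi_pi]
    _ ≤ _ := prod_le_prod' fun i _ => pi_strictMono_comp_le unitMeasure (hD i) _

theorem exists_perm_signLT {r k : ℕ} (hr : 0 < r) (ε : Fin r → Bool) {X : Fin k → Fin r → ℝ}
    (hX : ∀ a b, a ≠ b → SignComparable ε (X a) (X b)) :
    ∃ σ : Equiv.Perm (Fin k), ∀ a b, a < b → SignLT ε (X (σ a)) (X (σ b)) := by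
  set z : Fin r := ⟨0, hr⟩
  set x : Fin k → ℝ := fun a => X a z
  have hinj : Function.Injective x := by
    intro a b hab
    by_contra hne
    rcases hX a b hne with h | h <;>
    · have := h z
      change X a z = X b z at hab
      split_ifs at this <;> linarith
  have hsort : StrictMono (x ∘ Tuple.sort x) :=
    (Tuple.monotone_sort x).strictMono_of_injective (hinj.comp (Tuple.sort x).injective)
  by_cases hz : ε z
  · refine ⟨Tuple.sort x, fun a b hab => ?_⟩
    refine (hX _ _ fun h => hab.ne ((Tuple.sort x).injective h)).resolve_right fun h => ?_
    have h1 := h z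
    have h2 := hsort hab
    simp only [hz, if_true] at h1
    exact lt_asymm h1 h2
  · refine ⟨Fin.revPerm.trans (Tuple.sort x), fun a b hab => ?_⟩
    refine (hX _ _ fun h => hab.ne ((Fin.revPerm.trans (Tuple.sort x)).injective h)).resolve_right
      fun h => ?_
    have h1 := h z
    have h2 := hsort (Fin.rev_lt_rev.2 hab)
    simp only [hz] at h1
    exact lt_asymm h1 h2

theorem pi_clique_le {r k : ℕ} (hr : 0 < r) (ε : Fin r → Bool) {D : Fin r → Set ℝ}
    (hD : ∀ i, MeasurableSet (D i)) :
    (Measure.pi fun _ : Fin k => cubeMeasure r)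
        {X | (∀ a b, a ≠ b → SignComparable ε (X a) (X b)) ∧ ∀ j i, X j i ∈ D i} ≤
      k.factorial * ∏ i, (unitMeasure (D i) ^ k / k.factorial) := by
  calc _ ≤ (Measure.pi fun _ : Fin k => cubeMeasure r) (⋃ σ ∈ (univ : Finset (Equiv.Perm (Fin k))),
          {X | (∀ a b, a < b → SignLT ε (X (σ a)) (X (σ b))) ∧ ∀ j i, X j i ∈ D i}) := by
        refine measure_mono fun X hX => ?_
        obtain ⟨σ, h⟩ := exists_perm_signLT hr ε hX.1
        exact Set.mem_iUnion₂.2 ⟨σ, mem_univ _, h, hX.2⟩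
    _ ≤ ∑ σ : Equiv.Perm (Fin k), ∏ i, (unitMeasure (D i) ^ k / k.factorial) :=
        (measure_biUnion_finset_le _ _).trans (sum_le_sum fun σ _ => pi_signLT_le ε hD σ)
    _ = _ := by simp [Fintype.card_perm]

theorem two_pow_cliqueNum_le {α ι : Type*} [Fintype ι] (A : Set α) (R : α → α → Prop)
    (X : ι → α) : (2 : ℝ) ^ cliqueNum A R X ≤
      ∑ S : Finset ι, {X : ι → α | IsIndexClique A R X S}.indicator (fun _ => (1 : ℝ)) X := by
  classical
  obtain ⟨S, hS, e⟩ := exists_isIndexClique A R X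
  rw [← e]
  have h1 : ((2 : ℝ) ^ S.card) = ∑ T ∈ S.powerset, (1 : ℝ) := by simp
  rw [h1]
  calc ∑ T ∈ S.powerset, (1 : ℝ) ≤ ∑ T ∈ S.powerset,
        {X : ι → α | IsIndexClique A R X T}.indicator (fun _ => (1 : ℝ)) X := by
        refine sum_le_sum fun T hT => ?_
        rw [Set.indicator_of_mem]
        exact hS.subset (mem_powerset.1 hT)
    _ ≤ _ := sum_le_sum_of_subset_of_nonneg (subset_univ _) fun T _ _ =>
        Set.indicator_nonneg (fun _ _ => zero_le_one) _

/-- A bound for the mean clique number through the expected number of cliques. -/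
theorem meanClique_mul_log_two_le {α : Type*} [MeasurableSpace α] (ν : Measure α)
    [IsProbabilityMeasure ν] {A : Set α} (hA : MeasurableSet A) {R : α → α → Prop}
    (hR : MeasurableSet {p : α × α | R p.1 p.2}) (n : ℕ) {t : ℝ}
    (ht : ∑ S : Finset (Fin n), (Measure.pi fun _ : Fin n => ν).real
      {X | IsIndexClique A R X S} ≤ Real.exp t) :
    meanClique ν A R n * Real.log 2 ≤ t := by
  set Q := Measure.pi fun _ : Fin n => ν
  have hm := fun S : Finset (Fin n) => measurableSet_isIndexClique hA hR S
  have hi : ∀ S : Finset (Fin n), Integrable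
      ({X : Fin n → α | IsIndexClique A R X S}.indicator fun _ => (1 : ℝ)) Q := fun S =>
    (integrable_const (1 : ℝ)).indicator (hm S)
  have hpt : ∀ X : Fin n → α, (cliqueNum A R X : ℝ) * Real.log 2 ≤ t - 1 + Real.exp (-t) *
      ∑ S : Finset (Fin n), {X : Fin n → α | IsIndexClique A R X S}.indicator
        (fun _ => (1 : ℝ)) X := by
    intro X
    have h1 := Real.add_one_le_exp ((cliqueNum A R X : ℝ) * Real.log 2 - t)
    have h2 : Real.exp ((cliqueNum A R X : ℝ) * Real.log 2 - t) =
        Real.exp (-t) * 2 ^ cliqueNum A R X := by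
      rw [sub_eq_neg_add, Real.exp_add, mul_comm (cliqueNum A R X : ℝ), Real.exp_mul,
        Real.exp_log two_pos, Real.rpow_natCast]
    have h3 := mul_le_mul_of_nonneg_left (two_pow_cliqueNum_le A R X) (Real.exp_pos (-t)).le
    linarith
  calc meanClique ν A R n * Real.log 2
      = ∫ X, (cliqueNum A R X : ℝ) * Real.log 2 ∂Q := (integral_mul_const _ _).symm
    _ ≤ ∫ X, (t - 1 + Real.exp (-t) *
      ∑ S : Finset (Fin n), {X : Fin n → α | IsIndexClique A R X S}.indicator
        (fun _ => (1 : ℝ)) X) ∂Q :=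
        integral_mono ((integrable_cliqueNum hA hR _).mul_const _) ((integrable_const _).add
          ((integrable_finsetSum _ fun S _ => hi S).const_mul _)) hpt
    _ = t - 1 + Real.exp (-t) * ∑ S : Finset (Fin n), Q.real {X | IsIndexClique A R X S} := by
        rw [integral_add (integrable_const _)
            ((integrable_finsetSum _ fun S _ => hi S).const_mul _),
          integral_const_mul, integral_finsetSum _ fun S _ => hi S]
        simp [integral_indicator_const, hm]
    _ ≤ t - 1 + Real.exp (-t) * Real.exp t := by gcongr
    _ = t := by rw [← Real.exp_add]; simp

theorem sum_pow_div_factorial_pow_le {r : ℕ} (hr : 0 < r) {w : ℝ} (hw : 0 ≤ w) (n : ℕ) :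
    ∑ k ∈ range n, w ^ k / (k.factorial : ℝ) ^ r ≤ Real.exp (r * w ^ (1 / (r : ℝ))) := by
  set y := w ^ (1 / (r : ℝ)) with hy
  have hy0 : 0 ≤ y := by positivity
  have hyr : y ^ r = w := by
    rw [hy, ← Real.rpow_natCast, ← Real.rpow_mul hw]
    field_simp
    simp
  calc ∑ k ∈ range n, w ^ k / (k.factorial : ℝ) ^ r
      = ∑ k ∈ range n, (y ^ k / k.factorial) ^ r := by
        refine sum_congr rfl fun k _ => ?_
        rw [div_pow, ← pow_mul, mul_comm, pow_mul, hyr]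
    _ ≤ (∑ k ∈ range n, y ^ k / k.factorial) ^ r := by
        obtain ⟨r, rfl⟩ := Nat.exists_eq_succ_of_ne_zero hr.ne'
        set f : ℕ → ℝ := fun k => y ^ k / k.factorial
        have hf : ∀ k, 0 ≤ f k := fun k => by positivity
        calc ∑ k ∈ range n, f k ^ (r + 1) ≤ ∑ k ∈ range n, f k * (∑ k ∈ range n, f k) ^ r := by
              refine sum_le_sum fun k hk => ?_
              rw [pow_succ']
              have := single_le_sum (fun k _ => hf k) hk
              gcongr
          _ = _ := by rw [← sum_mul, pow_succ']
    _ ≤ Real.exp y ^ r := pow_le_pow_left₀ (sum_nonneg fun k _ => by positivity)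
        (Real.sum_le_exp_of_nonneg hy0 n) r
    _ = _ := by rw [← Real.exp_nat_mul]

theorem pi_real_isIndexClique_le {r n : ℕ} (hr : 0 < r) (ε : Fin r → Bool) {H : Set (Fin r → ℝ)}
    (hH : MeasurableSet H) (hH0 : cubeMeasure r H ≠ 0) {D : Fin r → Set ℝ}
    (hD : ∀ i, MeasurableSet (D i)) (S : Finset (Fin n)) :
    (Measure.pi fun _ : Fin n => (cubeMeasure r)[|H]).real
        {X | IsIndexClique (Set.univ.pi D) (SignComparable ε) X S} ≤
      (S.card.factorial : ℝ) * (((cubeMeasure r).real H)⁻¹ * ∏ i, unitMeasure.real (D i)) ^ S.card /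
        (S.card.factorial : ℝ) ^ r := by
  have hp : IsProbabilityMeasure ((cubeMeasure r)[|H]) := cond_isProbabilityMeasure hH0
  set k := S.card with hk
  set C : Set (Fin k → Fin r → ℝ) :=
    {X | (∀ a b, a ≠ b → SignComparable ε (X a) (X b)) ∧ ∀ j i, X j i ∈ D i} with hC
  set e := S.orderEmbOfFin hk.symm
  have hmap : S = univ.map e.toEmbedding := by
    simp [e]
  have hset : {X : Fin n → Fin r → ℝ | IsIndexClique (Set.univ.pi D) (SignComparable ε) X S} =
      (fun X => X ∘ e) ⁻¹' C := by
    ext X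
    simp only [Set.mem_ofPred_eq, Set.mem_preimage, hC]
    rw [hmap, isIndexClique_map]
    simp only [IsIndexClique, mem_univ, true_imp_iff, Set.mem_univ_pi]
    rw [and_comm]
    rfl
  have hCm : MeasurableSet C := by
    have := measurableSet_isIndexClique (ι := Fin k) (MeasurableSet.univ_pi hD)
      (measurableSet_signComparable ε) univ
    convert this using 1
    ext X
    simp only [hC, IsIndexClique, Set.mem_ofPred_eq, mem_univ, true_imp_iff, Set.mem_univ_pi]
    rw [and_comm]
  have hm : Measurable fun X : Fin n → Fin r → ℝ => X ∘ e :=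
    measurable_pi_lambda _ fun i => measurable_pi_apply _
  have key : (Measure.pi fun _ : Fin n => (cubeMeasure r)[|H])
      {X | IsIndexClique (Set.univ.pi D) (SignComparable ε) X S} ≤
      (cubeMeasure r H ^ k)⁻¹ * (k.factorial * ∏ i, (unitMeasure (D i) ^ k / k.factorial)) := by
    rw [hset, ← Measure.map_apply hm hCm, pi_map_comp_injective _ e e.injective,
      ← cond_pi (fun _ => cubeMeasure r) (fun _ => hH) (fun _ => hH0),
      cond_apply (MeasurableSet.univ_pi fun _ => hH), Measure.pi_pi]
    simp only [prod_const, card_univ, Fintype.card_fin]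
    gcongr
    exact (measure_mono Set.inter_subset_right).trans (pi_clique_le hr ε hD)
  refine (ENNReal.toReal_mono ?_ key).trans (le_of_eq ?_)
  · refine ENNReal.mul_ne_top (ENNReal.inv_ne_top.2 (pow_ne_zero _ hH0))
      (ENNReal.mul_ne_top (ENNReal.natCast_ne_top _) (ENNReal.prod_ne_top fun i _ => ?_))
    exact ENNReal.div_ne_top (ENNReal.pow_ne_top (measure_ne_top _ _))
      (by exact_mod_cast k.factorial_ne_zero)
  · simp only [ENNReal.toReal_mul, ENNReal.toReal_inv, ENNReal.toReal_pow, ENNReal.toReal_prod,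
      ENNReal.toReal_div, ENNReal.toReal_natCast, Measure.real]
    rw [prod_div_distrib, prod_pow, prod_const, mul_pow, inv_pow]
    simp only [card_univ, Fintype.card_fin]
    ring

/-- First moment bound for the mean clique number of conditioned points in a box. -/
theorem meanClique_cond_le {r : ℕ} (hr : 0 < r) (ε : Fin r → Bool) {H : Set (Fin r → ℝ)}
    (hH : MeasurableSet H) (hH0 : cubeMeasure r H ≠ 0) {D : Fin r → Set ℝ}
    (hD : ∀ i, MeasurableSet (D i)) (n : ℕ) :
    meanClique ((cubeMeasure r)[|H]) (Set.univ.pi D) (SignComparable ε) n ≤ r / Real.log 2 *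
      (n * (((cubeMeasure r).real H)⁻¹ * ∏ i, unitMeasure.real (D i))) ^ (1 / (r : ℝ)) := by
  have hp : IsProbabilityMeasure ((cubeMeasure r)[|H]) := cond_isProbabilityMeasure hH0
  set a := ((cubeMeasure r).real H)⁻¹ * ∏ i, unitMeasure.real (D i) with ha
  have ha0 : 0 ≤ a := mul_nonneg (inv_nonneg.2 measureReal_nonneg)
    (prod_nonneg fun i _ => measureReal_nonneg)
  rw [div_mul_eq_mul_div, le_div_iff₀ (Real.log_pos one_lt_two)]
  refine meanClique_mul_log_two_le _ (MeasurableSet.univ_pi hD)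
    (measurableSet_signComparable ε) n ?_
  refine le_trans ?_ (sum_pow_div_factorial_pow_le hr (mul_nonneg n.cast_nonneg ha0) (n + 1))
  calc _ ≤ ∑ S : Finset (Fin n), (S.card.factorial : ℝ) * a ^ S.card /
        (S.card.factorial : ℝ) ^ r :=
        sum_le_sum fun S _ => pi_real_isIndexClique_le hr ε hH hH0 hD S
    _ = ∑ k ∈ range (n + 1), (n.choose k : ℝ) * ((k.factorial : ℝ) * a ^ k /
        (k.factorial : ℝ) ^ r) := by
        have := sum_powerset_apply_card (x := univ (α := Fin n))
          (fun k => (k.factorial : ℝ) * a ^ k /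
          (k.factorial : ℝ) ^ r)
        simpa using this
    _ ≤ _ := by
        refine sum_le_sum fun k _ => ?_
        have h : ((n.choose k : ℝ) * k.factorial) ≤ (n : ℝ) ^ k := by
          rw [mul_comm]
          exact_mod_cast (Nat.descFactorial_eq_factorial_mul_choose n k) ▸
            Nat.descFactorial_le_pow n k
        rw [mul_pow (n : ℝ) a, ← mul_div_assoc, ← mul_assoc]
        gcongr

end FirstMoment

theorem meanClique_map {α β : Type*} [MeasurableSpace α] [MeasurableSpace β] (ν : Measure α)
    [IsProbabilityMeasure ν] {T : α → β} (hT : Measurable T) {R : β → β → Prop}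
    (hR : MeasurableSet {p : β × β | R p.1 p.2}) (n : ℕ) :
    meanClique (ν.map T) Set.univ R n = meanClique ν Set.univ (fun x y => R (T x) (T y)) n := by
  have : IsProbabilityMeasure (ν.map T) := Measure.isProbabilityMeasure_map hT.aemeasurable
  rw [meanClique, ← Measure.pi_map_pi (fun _ => hT.aemeasurable), integral_map]
  · rw [meanClique]
    refine integral_congr_ae (Filter.Eventually.of_forall fun X => ?_)
    simp only
    congr 1
  · exact (measurable_pi_lambda _ fun i => hT.comp (measurable_pi_apply i)).aemeasurable
  · exact (measurable_cliqueNum_real .univ hR).aestronglyMeasurable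

theorem unitMeasure_map_affine {a b d c : ℝ} (hab : a < b) (ha : 0 ≤ a) (hb : b ≤ 1)
    (hc : |c| = b - a) (hT : (fun x => d + c * x) ⁻¹' Set.Ioo a b = Set.Ioo 0 1) :
    unitMeasure.map (fun x => d + c * x) = unitMeasure[|Set.Ioo a b] := by
  have hc0 : c ≠ 0 := by
    rintro rfl
    simp at hc
    linarith
  have hTe : MeasurableEmbedding fun x : ℝ => d + c * x :=
    (MeasurableEquiv.addLeft d).measurableEmbedding.comp
      (MeasurableEquiv.mulLeft₀ c hc0).measurableEmbedding
  have hvol : (volume : Measure ℝ).map (fun x => d + c * x) = ENNReal.ofReal |c⁻¹| • volume := by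
    have h1 := Real.map_volume_mul_left hc0
    have h2 : (fun x => d + c * x) = (fun x => d + x) ∘ (fun x => c * x) := rfl
    rw [h2, ← Measure.map_map (measurable_const_add d) (measurable_const_mul c), h1,
      Measure.map_smul, map_add_left_eq_self]
  rw [unitMeasure, ← hT, ← hTe.restrict_map, hvol, ProbabilityTheory.cond, hT,
    Measure.restrict_restrict measurableSet_Ioo, Measure.restrict_apply measurableSet_Ioo,
    Set.inter_eq_left.2 (Set.Ioo_subset_Ioo ha hb), Measure.restrict_smul, Real.volume_Ioo, abs_inv,
    hc, ENNReal.ofReal_inv_of_pos (by linarith)]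

theorem exists_map_eq_cond_Ioo (s : Bool) {a b : ℝ} (hab : a < b) (ha : 0 ≤ a) (hb : b ≤ 1) :
    ∃ T : ℝ → ℝ, Measurable T ∧ unitMeasure.map T = unitMeasure[|Set.Ioo a b] ∧
      ∀ x y, (if s then T x < T y else T y < T x) ↔ x < y := by
  have h0 : 0 < b - a := sub_pos.2 hab
  cases s
  · refine ⟨fun x => b + -(b - a) * x, by fun_prop, unitMeasure_map_affine hab ha hb
      (by rw [abs_neg, abs_of_pos h0]) ?_, fun x y => ?_⟩
    · ext x
      simp only [Set.mem_preimage, Set.mem_Ioo]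
      constructor
      · rintro ⟨h1, h2⟩; constructor <;> nlinarith
      · rintro ⟨h1, h2⟩; constructor <;> nlinarith
    · simp only [Bool.false_eq_true, if_false]
      constructor <;> intro h <;> nlinarith
  · refine ⟨fun x => a + (b - a) * x, by fun_prop, unitMeasure_map_affine hab ha hb
      (abs_of_pos h0) ?_, fun x y => ?_⟩
    · ext x
      simp only [Set.mem_preimage, Set.mem_Ioo]
      constructor
      · rintro ⟨h1, h2⟩; constructor <;> nlinarith
      · rintro ⟨h1, h2⟩; constructor <;> nlinarith
    · simp only [if_true]
      constructor <;> intro h <;> nlinarith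

/-- The mean length of a longest chain among `n` uniform points of the cube. -/
noncomputable def meanChain (r n : ℕ) : ℝ :=
  meanClique (cubeMeasure r) Set.univ (SignComparable fun _ => true) n

theorem unitMeasure_Ioo {a b : ℝ} (ha : 0 ≤ a) (hb : b ≤ 1) :
    unitMeasure (Set.Ioo a b) = ENNReal.ofReal (b - a) := by
  rw [unitMeasure, Measure.restrict_apply measurableSet_Ioo,
    Set.inter_eq_left.2 (Set.Ioo_subset_Ioo ha hb), Real.volume_Ioo]

theorem cubeMeasure_box {r : ℕ} {a b : Fin r → ℝ} (ha : ∀ i, 0 ≤ a i) (hb : ∀ i, b i ≤ 1) :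
    cubeMeasure r (Set.univ.pi fun i => Set.Ioo (a i) (b i)) =
      ∏ i, ENNReal.ofReal (b i - a i) := by
  rw [cubeMeasure, Measure.pi_pi]
  exact prod_congr rfl fun i _ => unitMeasure_Ioo (ha i) (hb i)

theorem measurableSet_box {r : ℕ} (a b : Fin r → ℝ) :
    MeasurableSet (Set.univ.pi fun i => Set.Ioo (a i) (b i)) :=
  MeasurableSet.univ_pi fun _ => measurableSet_Ioo

theorem cubeMeasure_box_ne_zero {r : ℕ} {a b : Fin r → ℝ} (hab : ∀ i, a i < b i)
    (ha : ∀ i, 0 ≤ a i) (hb : ∀ i, b i ≤ 1) :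
    cubeMeasure r (Set.univ.pi fun i => Set.Ioo (a i) (b i)) ≠ 0 := by
  rw [cubeMeasure_box ha hb]
  refine prod_ne_zero_iff.2 fun i _ => ?_
  simpa using hab i

theorem meanClique_box_eq_meanChain {r : ℕ} (ε : Fin r → Bool) {a b : Fin r → ℝ}
    (hab : ∀ i, a i < b i) (ha : ∀ i, 0 ≤ a i) (hb : ∀ i, b i ≤ 1) (n : ℕ) :
    meanClique ((cubeMeasure r)[|Set.univ.pi fun i => Set.Ioo (a i) (b i)]) Set.univ
      (SignComparable ε) n = meanChain r n := by
  choose T hTm hT hlt using fun i => exists_map_eq_cond_Ioo (ε i) (hab i) (ha i) (hb i)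
  have h0 : ∀ i, unitMeasure (Set.Ioo (a i) (b i)) ≠ 0 := fun i => by
    rw [unitMeasure_Ioo (ha i) (hb i)]
    simpa using hab i
  have hp : ∀ i, IsProbabilityMeasure (unitMeasure.map (T i)) := fun i =>
    Measure.isProbabilityMeasure_map (hTm i).aemeasurable
  have : (cubeMeasure r)[|Set.univ.pi fun i => Set.Ioo (a i) (b i)] =
      (cubeMeasure r).map fun x i => T i (x i) := by
    rw [cubeMeasure, cond_pi _ (fun _ => measurableSet_Ioo) h0,
      Measure.pi_map_pi fun i => (hTm i).aemeasurable]
    simp_rw [hT]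
  have hm : Measurable fun (x : Fin r → ℝ) i => T i (x i) :=
    measurable_pi_lambda _ fun i => (hTm i).comp (measurable_pi_apply i)
  rw [this, meanClique_map _ hm (measurableSet_signComparable ε), meanChain]
  congr 1
  funext x y
  simp [SignComparable, SignLT, hlt]

/-- Thinning to a box contained in the conditioning set. -/
theorem meanClique_cond_box {r : ℕ} (ε : Fin r → Bool) {H : Set (Fin r → ℝ)}
    (hH : MeasurableSet H) {a b : Fin r → ℝ} (hab : ∀ i, a i < b i) (ha : ∀ i, 0 ≤ a i)
    (hb : ∀ i, b i ≤ 1) (hHb : (Set.univ.pi fun i => Set.Ioo (a i) (b i)) ⊆ H) (n : ℕ) :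
    meanClique ((cubeMeasure r)[|H]) (Set.univ.pi fun i => Set.Ioo (a i) (b i))
      (SignComparable ε) n = ∫ X, meanChain r (countIn (Set.univ.pi fun i => Set.Ioo (a i) (b i)) X)
        ∂Measure.pi (fun _ : Fin n => (cubeMeasure r)[|H]) := by
  set B := Set.univ.pi fun i => Set.Ioo (a i) (b i)
  have hB : MeasurableSet B := measurableSet_box a b
  have hB0 : cubeMeasure r B ≠ 0 := cubeMeasure_box_ne_zero hab ha hb
  have hH0 : cubeMeasure r H ≠ 0 := fun h => hB0 (measure_mono_null hHb h)
  have hp : IsProbabilityMeasure ((cubeMeasure r)[|H]) := cond_isProbabilityMeasure hH0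
  have hB0' : (cubeMeasure r)[|H] B ≠ 0 := by
    rw [cond_apply hH, Set.inter_eq_right.2 hHb]
    exact mul_ne_zero (ENNReal.inv_ne_zero.2 (measure_ne_top _ _)) hB0
  rw [integral_cliqueNum_eq_integral_meanClique _ hB hB0' (measurableSet_signComparable ε),
    cond_cond_eq_cond_inter hH hB, Set.inter_eq_right.2 hHb]
  simp_rw [B, meanClique_box_eq_meanChain ε hab ha hb]

theorem meanChain_nonneg (r n : ℕ) : 0 ≤ meanChain r n := meanClique_nonneg _ _ _ _

theorem meanChain_le_self (r n : ℕ) : meanChain r n ≤ n := meanClique_le _ _ _ _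

theorem meanChain_mono (r : ℕ) : Monotone (meanChain r) :=
  meanClique_mono _ .univ (measurableSet_signComparable _)

theorem meanChain_le {r : ℕ} (hr : 0 < r) (n : ℕ) :
    meanChain r n ≤ r / Real.log 2 * (n : ℝ) ^ (1 / (r : ℝ)) := by
  have := meanClique_cond_le hr (fun _ => true) (H := Set.univ) .univ (by simp)
    (D := fun _ => Set.univ) (fun _ => .univ) n
  simpa [cond_univ, meanChain] using this

theorem sum_cliqueNum_le {α ι κ : Type*} [Fintype ι] [Fintype κ] {A : Set α} {B : κ → Set α}
    {R : α → α → Prop} (hBA : ∀ k, B k ⊆ A) (hB : ∀ k l, k ≠ l → Disjoint (B k) (B l))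
    (hR : ∀ k l, k ≠ l → ∀ x ∈ B k, ∀ y ∈ B l, R x y) (X : ι → α) :
    ∑ k, cliqueNum (B k) R X ≤ cliqueNum A R X := by
  classical
  choose S hS e using fun k => exists_isIndexClique (B k) R X
  rw [← sum_congr rfl fun k _ => e k, ← card_biUnion]
  · refine IsIndexClique.card_le ⟨fun i hi => ?_, fun i hi j hj hij => ?_⟩
    · obtain ⟨k, -, hk⟩ := mem_biUnion.1 hi
      exact hBA k ((hS k).1 i hk)
    · obtain ⟨k, -, hk⟩ := mem_biUnion.1 hi
      obtain ⟨l, -, hl⟩ := mem_biUnion.1 hj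
      by_cases h : k = l
      · subst h
        exact (hS k).2 i hk j hl hij
      · exact hR k l h _ ((hS k).1 i hk) _ ((hS l).1 j hl)
  · intro k _ l _ hkl
    refine disjoint_left.2 fun i hi hj => ?_
    exact Set.disjoint_left.1 (hB k l hkl) ((hS k).1 i hi) ((hS l).1 i hj)

theorem integrable_comp_countIn {α : Type*} [MeasurableSpace α] {ι : Type*} [Fintype ι]
    {B : Set α} (hB : MeasurableSet B) (P : Measure (ι → α)) [IsFiniteMeasure P] (F : ℕ → ℝ) :
    Integrable (fun X : ι → α => F (countIn B X)) P := by
  refine integrable_of_bounded ((measurable_from_top (f := F)).comp (measurable_countIn hB))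
    (∑ k ∈ range (Fintype.card ι + 1), |F k|) fun X => ?_
  exact single_le_sum (f := fun k => |F k|) (fun k _ => abs_nonneg _)
    (mem_range.2 (Nat.lt_succ_of_le (countIn_le B X)))

/-- Chebyshev's inequality for a nonnegative monotone function of a number of points. -/
theorem le_integral_countIn {α : Type*} [MeasurableSpace α] (ν : Measure α)
    [IsProbabilityMeasure ν] {B : Set α} (hB : MeasurableSet B) (n m : ℕ) {F : ℕ → ℝ}
    (hF : Monotone F) (hF0 : ∀ k, 0 ≤ F k) (hm : (m : ℝ) < n * ν.real B) :
    F m * (1 - n * ν.real B / (n * ν.real B - m) ^ 2) ≤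
      ∫ X, F (countIn B X) ∂Measure.pi (fun _ : Fin n => ν) := by
  set M := n * ν.real B with hM
  have hd : 0 < M - m := sub_pos.2 hm
  have hv := variance_countIn_le ν hB n
  rw [← hM] at hv
  have hi := integrable_comp_countIn hB (Measure.pi fun _ : Fin n => ν)
    (fun k => ((k : ℝ) - M) ^ 2)
  have hpt : ∀ k : ℕ, F m * (1 - ((k : ℝ) - M) ^ 2 / (M - m) ^ 2) ≤ F k := by
    intro k
    rcases le_or_gt m k with h | h
    · have : 1 - ((k : ℝ) - M) ^ 2 / (M - m) ^ 2 ≤ 1 := by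
        have : 0 ≤ ((k : ℝ) - M) ^ 2 / (M - m) ^ 2 := by positivity
        linarith
      calc _ ≤ F m * 1 := mul_le_mul_of_nonneg_left this (hF0 m)
        _ ≤ F k := by rw [mul_one]; exact hF h
    · have : 1 - ((k : ℝ) - M) ^ 2 / (M - m) ^ 2 ≤ 0 := by
        rw [sub_nonpos, one_le_div (by positivity)]
        have : (k : ℝ) < m := by exact_mod_cast h
        nlinarith
      exact (mul_nonpos_of_nonneg_of_nonpos (hF0 m) this).trans (hF0 k)
  calc _ ≤ F m * (1 - (∫ X, ((countIn B X : ℝ) - M) ^ 2 ∂Measure.pi (fun _ : Fin n => ν)) /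
        (M - m) ^ 2) := by
        refine mul_le_mul_of_nonneg_left ?_ (hF0 m)
        gcongr
    _ = ∫ X, F m * (1 - ((countIn B X : ℝ) - M) ^ 2 / (M - m) ^ 2)
        ∂Measure.pi (fun _ : Fin n => ν) := by
        rw [integral_const_mul, integral_sub (integrable_const _) (hi.div_const _),
          integral_div]
        simp
    _ ≤ _ := by
        refine integral_mono (integrable_comp_countIn hB _
          (fun k => F m * (1 - ((k : ℝ) - M) ^ 2 / (M - m) ^ 2)))
          (integrable_comp_countIn hB _ F) fun X => hpt _

theorem meanChain_ge_of_blocks {r : ℕ} (hr : 0 < r) {n m N : ℕ} (hN : 0 < N)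
    (hm : (m : ℝ) < n / (N : ℝ) ^ r) :
    N * (meanChain r m * (1 - (n / (N : ℝ) ^ r) / (n / (N : ℝ) ^ r - m) ^ 2)) ≤ meanChain r n := by
  have hN' : (0 : ℝ) < N := Nat.cast_pos.2 hN
  set a : Fin N → Fin r → ℝ := fun k _ => (k : ℝ) / N with ha
  set b : Fin N → Fin r → ℝ := fun k _ => ((k : ℝ) + 1) / N with hb
  have hab : ∀ k i, a k i < b k i := fun k i => by
    simp only [ha, hb]; gcongr; linarith
  have ha0 : ∀ k i, 0 ≤ a k i := fun k i => by simp only [ha]; positivity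
  have hb1 : ∀ k i, b k i ≤ 1 := fun k i => by
    simp only [hb]
    rw [div_le_one hN']
    exact_mod_cast k.2
  set B : Fin N → Set (Fin r → ℝ) := fun k => Set.univ.pi fun i => Set.Ioo (a k i) (b k i) with hB
  have hlt : ∀ k l, k < l → ∀ x ∈ B k, ∀ y ∈ B l, ∀ i, x i < y i := by
    intro k l hkl x hx y hy i
    have h1 := (hx i trivial).2
    have h2 := (hy i trivial).1
    refine h1.trans (lt_of_le_of_lt ?_ h2)
    simp only [ha, hb]
    gcongr
    exact_mod_cast hkl
  have hR : ∀ k l, k ≠ l → ∀ x ∈ B k, ∀ y ∈ B l, SignComparable (fun _ => true) x y := by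
    intro k l hkl x hx y hy
    rcases lt_or_gt_of_ne hkl with h | h
    · exact Or.inl fun i => by simpa using hlt k l h x hx y hy i
    · exact Or.inr fun i => by simpa using hlt l k h y hy x hx i
  have hdis : ∀ k l, k ≠ l → Disjoint (B k) (B l) := by
    intro k l hkl
    refine Set.disjoint_left.2 fun x hx hy => ?_
    rcases hR k l hkl x hx x hy with h | h <;> simpa using h ⟨0, hr⟩
  have hBm : ∀ k, MeasurableSet (B k) := fun k => measurableSet_box _ _
  have hvol : ∀ k, n * (cubeMeasure r).real (B k) = n / (N : ℝ) ^ r := by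
    intro k
    rw [Measure.real, hB, cubeMeasure_box (ha0 k) (hb1 k), ENNReal.toReal_prod]
    have : ∀ i, (ENNReal.ofReal (b k i - a k i)).toReal = (N : ℝ)⁻¹ := fun i => by
      rw [ENNReal.toReal_ofReal (sub_pos.2 (hab k i)).le]
      simp only [ha, hb]
      field_simp
      ring
    simp [this, div_eq_mul_inv]
  have hmean : ∀ k, meanChain r m * (1 - (n / (N : ℝ) ^ r) / (n / (N : ℝ) ^ r - m) ^ 2) ≤
      ∫ X, (cliqueNum (B k) (SignComparable fun _ => true) X : ℝ)
        ∂Measure.pi (fun _ : Fin n => cubeMeasure r) := by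
    intro k
    have h1 := meanClique_cond_box (fun _ => true) (H := Set.univ) .univ (hab k) (ha0 k) (hb1 k)
      (Set.subset_univ _) n
    rw [cond_univ] at h1
    rw [← meanClique, hB, h1]
    have h2 := le_integral_countIn (cubeMeasure r) (hBm k) n m (meanChain_mono r)
      (meanChain_nonneg r) (by rw [hvol]; exact hm)
    rwa [hvol] at h2
  calc _ = ∑ k : Fin N, meanChain r m *
        (1 - (n / (N : ℝ) ^ r) / (n / (N : ℝ) ^ r - m) ^ 2) := by simp
    _ ≤ ∑ k : Fin N, ∫ X, (cliqueNum (B k) (SignComparable fun _ => true) X : ℝ)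
        ∂Measure.pi (fun _ : Fin n => cubeMeasure r) := sum_le_sum fun k _ => hmean k
    _ = ∫ X, ∑ k : Fin N, (cliqueNum (B k) (SignComparable fun _ => true) X : ℝ)
        ∂Measure.pi (fun _ : Fin n => cubeMeasure r) :=
        (integral_finsetSum _ fun k _ =>
          integrable_cliqueNum (hBm k) (measurableSet_signComparable _) _).symm
    _ ≤ _ := by
        refine integral_mono (integrable_finsetSum _ fun k _ =>
          integrable_cliqueNum (hBm k) (measurableSet_signComparable _) _)
          (integrable_cliqueNum .univ (measurableSet_signComparable _) _) fun X => ?_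
        have := sum_cliqueNum_le (A := Set.univ) (fun _ => Set.subset_univ _) hdis hR X
        exact_mod_cast this

theorem meanChain_ge_floor {r : ℕ} (hr : 0 < r) {n m : ℕ} {δ : ℝ} (hδ : 0 < δ) (hm : 0 < m)
    (hη : (1 + δ) / (δ ^ 2 * m) ≤ δ) (hδ1 : δ < 1) (hn : (1 + δ) * m ≤ n) :
    ((n : ℝ) ^ (1 / (r : ℝ)) / ((1 + δ) * m) ^ (1 / (r : ℝ)) - 1) *
      (meanChain r m * (1 - δ)) ≤ meanChain r n := by
  have hm' : (0 : ℝ) < m := Nat.cast_pos.2 hm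
  have hr' : (0 : ℝ) < r := Nat.cast_pos.2 hr
  have hp : 0 < (1 + δ) * m := by positivity
  have hn0 : (0 : ℝ) < n := hp.trans_le hn
  set t : ℝ := n / ((1 + δ) * m) with ht
  have ht1 : 1 ≤ t := (one_le_div hp).2 hn
  rw [← Real.div_rpow hn0.le hp.le, ← ht]
  set N := ⌊t ^ (1 / (r : ℝ))⌋₊ with hNdef
  have hN : 0 < N := Nat.floor_pos.2 (Real.one_le_rpow ht1 (by positivity))
  have hN' : (0 : ℝ) < N := Nat.cast_pos.2 hN
  have hNt : (N : ℝ) ^ r ≤ t := by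
    have h1 : (N : ℝ) ≤ t ^ (1 / (r : ℝ)) := Nat.floor_le (by positivity)
    calc (N : ℝ) ^ r ≤ (t ^ (1 / (r : ℝ))) ^ r := by gcongr
      _ = t := by
        rw [← Real.rpow_natCast, ← Real.rpow_mul (by linarith)]
        field_simp
        simp
  set M : ℝ := n / (N : ℝ) ^ r with hM
  have hMm : (1 + δ) * m ≤ M := by
    rw [hM, le_div_iff₀ (by positivity)]
    rw [ht, le_div_iff₀ hp] at hNt
    linarith
  have hMm' : (m : ℝ) < M := by nlinarith
  have hbound : M / (M - m) ^ 2 ≤ δ := by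
    refine le_trans ?_ hη
    rw [div_le_div_iff₀ (by nlinarith) (by positivity)]
    have h1 : M * δ ≤ (M - m) * (1 + δ) := by nlinarith
    have h2 : m * δ ≤ M - m := by nlinarith
    have h3 : (M * δ) * (m * δ) ≤ ((M - m) * (1 + δ)) * (M - m) := by
      have : 0 < M - m := by linarith
      gcongr
    nlinarith
  have hblock := meanChain_ge_of_blocks hr hN hMm'
  refine le_trans ?_ hblock
  have hlt := (Nat.lt_floor_add_one (t ^ (1 / (r : ℝ)))).le
  have h0 := meanChain_nonneg r m
  have h1 : 0 ≤ meanChain r m * (1 - δ) := mul_nonneg h0 (by linarith)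
  calc _ ≤ N * (meanChain r m * (1 - δ)) := by
        refine mul_le_mul_of_nonneg_right ?_ h1
        linarith
    _ ≤ _ := by gcongr

theorem exists_tendsto_meanChain {r : ℕ} (hr : 0 < r) :
    ∃ c : ℝ, Tendsto (fun n : ℕ => meanChain r n / (n : ℝ) ^ (1 / (r : ℝ))) atTop (𝓝 c) := by
  have hr' : (0 : ℝ) < r := Nat.cast_pos.2 hr
  set f : ℕ → ℝ := fun n => meanChain r n / (n : ℝ) ^ (1 / (r : ℝ)) with hf
  have hlog : 0 ≤ (r : ℝ) / Real.log 2 := div_nonneg hr'.le (Real.log_nonneg one_le_two)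
  have hf0 : ∀ n, 0 ≤ f n := fun n => div_nonneg (meanChain_nonneg r n) (by positivity)
  have hfb : ∀ n, f n ≤ r / Real.log 2 := fun n =>
    div_le_of_le_mul₀ (by positivity) hlog (meanChain_le hr n)
  have hbdd : IsBoundedUnder (· ≤ ·) atTop f := isBoundedUnder_of ⟨_, hfb⟩
  have hcob : IsCoboundedUnder (· ≤ ·) atTop f :=
    IsBoundedUnder.isCoboundedUnder_le (isBoundedUnder_of ⟨0, hf0⟩)
  have hpow : Tendsto (fun n : ℕ => (n : ℝ) ^ (1 / (r : ℝ))) atTop atTop :=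
    (tendsto_rpow_atTop (by positivity)).comp tendsto_natCast_atTop_atTop
  refine ⟨limsup f atTop, tendsto_order.2 ⟨fun a ha => ?_, fun a ha =>
    eventually_lt_of_limsup_lt ha hbdd⟩⟩
  rcases lt_or_ge a 0 with h | ha0
  · exact Eventually.of_forall fun n => h.trans_le (hf0 n)
  obtain ⟨a', haa', ha'⟩ := exists_between ha
  have hcont : ContinuousAt (fun δ : ℝ => a' * (1 - δ) / (1 + δ) ^ (1 / (r : ℝ))) 0 := by
    refine ContinuousAt.div (by fun_prop) ?_ (by simp)
    exact ContinuousAt.rpow_const (by fun_prop) (Or.inl (by simp))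
  have hev : ∀ᶠ δ in 𝓝[>] (0 : ℝ), a < a' * (1 - δ) / (1 + δ) ^ (1 / (r : ℝ)) ∧ 0 < δ ∧ δ < 1 := by
    have h1 : ∀ᶠ δ in 𝓝 (0 : ℝ), a < a' * (1 - δ) / (1 + δ) ^ (1 / (r : ℝ)) :=
      hcont.eventually (lt_mem_nhds (by simpa using haa'))
    have h2 : ∀ᶠ δ in 𝓝 (0 : ℝ), δ < 1 := gt_mem_nhds one_pos
    filter_upwards [h1.filter_mono nhdsWithin_le_nhds, h2.filter_mono nhdsWithin_le_nhds,
      self_mem_nhdsWithin] with δ h1 h2 h3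
    exact ⟨h1, h3, h2⟩
  obtain ⟨δ, hδ, hδ0, hδ1⟩ := hev.exists
  have hη : ∀ᶠ m : ℕ in atTop, 0 < m ∧ (1 + δ) / (δ ^ 2 * m) ≤ δ := by
    refine (eventually_gt_atTop 0).and ?_
    have : Tendsto (fun m : ℕ => (1 + δ) / (δ ^ 2 * m)) atTop (𝓝 0) :=
      Tendsto.const_div_atTop (tendsto_natCast_atTop_atTop.const_mul_atTop (by positivity)) _
    exact (this.eventually (gt_mem_nhds hδ0)).mono fun m h => h.le
  obtain ⟨m, hfm, hm0, hmη⟩ :=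
    ((frequently_lt_of_lt_limsup hcob ha').and_eventually hη).exists
  have hm' : (0 : ℝ) < m := Nat.cast_pos.2 hm0
  set w : ℝ := ((1 + δ) * m) ^ (1 / (r : ℝ)) with hw
  have hw0 : 0 < w := by positivity
  set Q := meanChain r m * (1 - δ) with hQ
  have hlim : Tendsto (fun n : ℕ => Q / w - Q / (n : ℝ) ^ (1 / (r : ℝ))) atTop
      (𝓝 (Q / w - 0)) := tendsto_const_nhds.sub (hpow.const_div_atTop Q)
  have hQw : a < Q / w - 0 := by
    rw [sub_zero]
    refine hδ.trans_le ?_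
    have e : Q / w = f m * ((1 - δ) / (1 + δ) ^ (1 / (r : ℝ))) := by
      simp only [hQ, hw, hf]
      rw [Real.mul_rpow (by linarith) hm'.le]
      ring
    rw [e, mul_div_assoc]
    refine mul_le_mul_of_nonneg_right hfm.le (div_nonneg (by linarith) (by positivity))
  filter_upwards [hlim.eventually (lt_mem_nhds hQw), eventually_gt_atTop 0,
    tendsto_natCast_atTop_atTop.eventually_ge_atTop ((1 + δ) * m)] with n h1 h2 h3
  refine h1.trans_le ?_
  have hn0 : (0 : ℝ) < (n : ℝ) ^ (1 / (r : ℝ)) := by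
    have : (0 : ℝ) < n := Nat.cast_pos.2 h2
    positivity
  have := meanChain_ge_floor hr hδ0 hm0 hmη hδ1 h3
  simp only [hf]
  rw [← hw, ← hQ] at this
  rw [le_div_iff₀ hn0]
  refine le_trans (le_of_eq ?_) this
  field_simp

/-- The limit of the normalized mean length of a longest chain of uniform points. -/
noncomputable def chainConstant (r : ℕ) : ℝ :=
  limUnder atTop fun n : ℕ => meanChain r n / (n : ℝ) ^ (1 / (r : ℝ))

theorem tendsto_meanChain {r : ℕ} (hr : 0 < r) :
    Tendsto (fun n : ℕ => meanChain r n / (n : ℝ) ^ (1 / (r : ℝ))) atTop (𝓝 (chainConstant r)) :=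
  tendsto_nhds_limUnder (exists_tendsto_meanChain hr)

theorem one_add_sub_sq_le_rpow {p y : ℝ} (hp : 0 < p) (hp1 : p ≤ 1) (hy : 0 ≤ y) :
    1 + p * (y - 1) - 2 * (y - 1) ^ 2 ≤ y ^ p := by
  rcases hy.eq_or_lt with rfl | hy
  · rw [Real.zero_rpow hp.ne']
    nlinarith
  have h1 : (y⁻¹) ^ p ≤ 1 + p * (y⁻¹ - 1) := by
    have := rpow_one_add_le_one_add_mul_self (s := y⁻¹ - 1)
      (by linarith [inv_pos.2 hy]) hp.le hp1
    simpa using this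
  rw [Real.inv_rpow hy.le] at h1
  have hq : 0 < y ^ p := Real.rpow_pos_of_pos hy p
  have hd : 0 < p + y * (1 - p) := by nlinarith
  have h2 : y ≤ y ^ p * (p + y * (1 - p)) := by
    have h3 := mul_le_mul_of_nonneg_left h1 (mul_pos hy hq).le
    have e1 : y * y ^ p * (y ^ p)⁻¹ = y := by field_simp
    have e2 : y * y ^ p * (1 + p * (y⁻¹ - 1)) = y ^ p * (p + y * (1 - p)) := by
      field_simp
      ring
    linarith
  have h4 : (1 + p * (y - 1) - 2 * (y - 1) ^ 2) * (p + y * (1 - p)) ≤ y := by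
    have e : y - (1 + p * (y - 1) - 2 * (y - 1) ^ 2) * (p + y * (1 - p)) =
        (y - 1) ^ 2 * (p + p ^ 2 + 2 * (y * (1 - p))) := by ring
    have : 0 ≤ (y - 1) ^ 2 * (p + p ^ 2 + 2 * (y * (1 - p))) := by
      have : 0 ≤ y * (1 - p) := mul_nonneg hy.le (by linarith)
      positivity
    linarith
  exact le_of_mul_le_mul_right (h4.trans h2) hd

/-- The volume of the corner simplex in the unit cube. -/
theorem pow_div_factorial_le_cubeMeasure (r : ℕ) {t : ℝ} (ht : 0 ≤ t) (ht1 : t ≤ 1) :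
    t ^ r / r.factorial ≤ (cubeMeasure r).real {x | ∑ i, x i ≤ t} := by
  induction r generalizing t with
  | zero => simp [ht]
  | succ r ih =>
    have hm : MeasurableSet {x : Fin (r + 1) → ℝ | ∑ i, x i ≤ t} :=
      measurableSet_le (by fun_prop) measurable_const
    have h1 : (cubeMeasure (r + 1)).real {x | ∑ i, x i ≤ t} =
        ∫ x, {x : Fin (r + 1) → ℝ | ∑ i, x i ≤ t}.indicator (fun _ => (1 : ℝ)) x
          ∂cubeMeasure (r + 1) := by
      rw [integral_indicator_const _ hm]
      simp
    rw [h1, cubeMeasure, integral_pi_insertNth unitMeasure 0 (measurable_const.indicator hm) 1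
      (fun x => by by_cases h : x ∈ {x : Fin (r + 1) → ℝ | ∑ i, x i ≤ t} <;> simp [h])]
    have h2 : ∀ x : ℝ, ∫ Y, {x : Fin (r + 1) → ℝ | ∑ i, x i ≤ t}.indicator (fun _ => (1 : ℝ))
        (Fin.insertNth 0 x Y) ∂Measure.pi (fun _ : Fin r => unitMeasure) =
        (cubeMeasure r).real {y | ∑ i, y i ≤ t - x} := by
      intro x
      have hm' : MeasurableSet {y : Fin r → ℝ | ∑ i, y i ≤ t - x} :=
        measurableSet_le (by fun_prop) measurable_const
      have : (fun Y : Fin r → ℝ => {x : Fin (r + 1) → ℝ | ∑ i, x i ≤ t}.indicator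
          (fun _ => (1 : ℝ)) (Fin.insertNth 0 x Y)) =
          {y : Fin r → ℝ | ∑ i, y i ≤ t - x}.indicator (fun _ => (1 : ℝ)) := by
        ext Y
        simp only [Set.indicator_apply, Set.mem_ofPred_eq, Fin.sum_univ_succ, Fin.insertNth_zero,
          Fin.cons_zero, Fin.cons_succ, le_sub_iff_add_le']
        rfl
      rw [this, integral_indicator_const _ hm', cubeMeasure]
      simp
    simp_rw [h2]
    have h3 : t ^ (r + 1) / (r + 1).factorial =
        ∫ x in Set.Ioc 0 t, (t - x) ^ r / r.factorial := by
      rw [← intervalIntegral.integral_of_le ht, intervalIntegral.integral_div,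
        intervalIntegral.integral_comp_sub_left (fun x => x ^ r) t]
      simp [Nat.factorial_succ]
      field_simp
    rw [h3, integral_Ioc_eq_integral_Ioo]
    have hint : Integrable (fun x => (cubeMeasure r).real {y | ∑ i, y i ≤ t - x}) unitMeasure := by
      refine integrable_of_bounded (Antitone.measurable fun a b hab => ?_) 1 fun x => ?_
      · exact measureReal_mono fun y (hy : ∑ i, y i ≤ t - b) => hy.trans (by linarith)
      · rw [abs_of_nonneg measureReal_nonneg]
        exact measureReal_le_one
    calc ∫ x in Set.Ioo 0 t, (t - x) ^ r / r.factorial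
        ≤ ∫ x in Set.Ioo 0 t, (cubeMeasure r).real {y | ∑ i, y i ≤ t - x} := by
          refine setIntegral_mono_on ?_ ?_ measurableSet_Ioo fun x hx => ?_
          · exact (Continuous.integrableOn_Icc (by fun_prop)).mono_set Set.Ioo_subset_Icc_self
          · exact IntegrableOn.mono_set (t := Set.Ioo 0 1) hint (Set.Ioo_subset_Ioo le_rfl ht1)
          · exact ih (by linarith [hx.2]) (by linarith [hx.1])
      _ ≤ ∫ x in Set.Ioo 0 1, (cubeMeasure r).real {y | ∑ i, y i ≤ t - x} := by
          refine setIntegral_mono_set hint ?_ ?_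
          · exact Eventually.of_forall fun x => measureReal_nonneg
          · exact (Set.Ioo_subset_Ioo le_rfl ht1).eventuallyLE

theorem integral_le_of_tail {Ω : Type*} [MeasurableSpace Ω] {P : Measure Ω}
    [IsProbabilityMeasure P] {f : Ω → ℝ} (hf : Integrable f P) (hf0 : ∀ x, 0 ≤ f x) {b p : ℝ}
    (hp : 0 < p) (hb : 0 < b)
    (h : ∀ t, 0 < t → P.real {x | t < f x} ≤ Real.exp (-b * t ^ p)) :
    ∫ x, f x ∂P ≤ b ^ (-1 / p) * Real.Gamma (1 / p + 1) := by
  rw [hf.integral_eq_integral_meas_lt (Eventually.of_forall hf0), ← integral_exp_neg_mul_rpow hp hb]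
  refine integral_mono_of_nonneg (Eventually.of_forall fun t => measureReal_nonneg) ?_ ?_
  · have := integrableOn_rpow_mul_exp_neg_mul_rpow (s := 0) (by norm_num) hp hb
    simpa [IntegrableOn] using this
  · filter_upwards [ae_restrict_mem measurableSet_Ioi] with t ht using h t ht

/-- The sum of the coordinates, clipped to the unit interval. -/
noncomputable def clipSum {r : ℕ} (x : Fin r → ℝ) : ℝ := max 0 (min (∑ i, x i) 1)

theorem clipSum_nonneg {r : ℕ} (x : Fin r → ℝ) : 0 ≤ clipSum x := le_max_left _ _

theorem clipSum_le_one {r : ℕ} (x : Fin r → ℝ) : clipSum x ≤ 1 :=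
  max_le zero_le_one (min_le_right _ _)

theorem measurable_clipSum {r : ℕ} : Measurable (clipSum : (Fin r → ℝ) → ℝ) := by
  unfold clipSum
  fun_prop

theorem clipSum_mono {r : ℕ} {x y : Fin r → ℝ} (h : ∑ i, x i ≤ ∑ i, y i) :
    clipSum x ≤ clipSum y :=
  max_le_max le_rfl (min_le_min h le_rfl)

/-- The least clipped coordinate sum of a configuration. -/
noncomputable def minClipSum {r n : ℕ} (X : Fin (n + 1) → Fin r → ℝ) : ℝ :=
  univ.inf' univ_nonempty fun j => clipSum (X j)

theorem minClipSum_le_one {r n : ℕ} (X : Fin (n + 1) → Fin r → ℝ) : minClipSum X ≤ 1 :=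
  (inf'_le _ (mem_univ 0)).trans (clipSum_le_one _)

theorem minClipSum_nonneg {r n : ℕ} (X : Fin (n + 1) → Fin r → ℝ) : 0 ≤ minClipSum X :=
  le_inf' _ _ fun _ _ => clipSum_nonneg _

theorem measurable_minClipSum {r n : ℕ} :
    Measurable (minClipSum : (Fin (n + 1) → Fin r → ℝ) → ℝ) := by
  have : (minClipSum : (Fin (n + 1) → Fin r → ℝ) → ℝ) =
      univ.inf' univ_nonempty fun j X => clipSum (X j) := by
    ext X
    simp [minClipSum, Finset.inf'_apply]
  rw [this]
  exact Finset.inf'_induction _ _ (fun _ h _ h' => h.inf h') fun j _ =>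
    measurable_clipSum.comp (measurable_pi_apply j)

theorem minClipSum_tail {r n : ℕ} {t : ℝ} (ht : 0 < t) :
    (Measure.pi fun _ : Fin (n + 1) => cubeMeasure r).real {X | t < minClipSum X} ≤
      Real.exp (-(((n : ℝ) + 1) / r.factorial) * t ^ (r : ℝ)) := by
  rcases le_or_gt 1 t with h | h
  · have : {X : Fin (n + 1) → Fin r → ℝ | t < minClipSum X} = ∅ := by
      ext X
      simpa using (minClipSum_le_one X).trans h
    rw [this, measureReal_empty]
    exact (Real.exp_pos _).le
  have hsub : {X : Fin (n + 1) → Fin r → ℝ | t < minClipSum X} ⊆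
      Set.univ.pi fun _ => {x : Fin r → ℝ | ∑ i, x i ≤ t}ᶜ := by
    intro X hX j _ hj
    have h1 : t < clipSum (X j) := lt_of_lt_of_le hX (inf'_le _ (mem_univ j))
    have h2 : clipSum (X j) ≤ t := max_le ht.le ((min_le_left _ _).trans hj)
    exact h1.not_ge h2
  have hm : MeasurableSet {x : Fin r → ℝ | ∑ i, x i ≤ t} :=
    measurableSet_le (by fun_prop) measurable_const
  have hv := pow_div_factorial_le_cubeMeasure r ht.le h.le
  calc _ ≤ (Measure.pi fun _ : Fin (n + 1) => cubeMeasure r).real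
        (Set.univ.pi fun _ => {x : Fin r → ℝ | ∑ i, x i ≤ t}ᶜ) := measureReal_mono hsub
    _ = ((cubeMeasure r).real {x : Fin r → ℝ | ∑ i, x i ≤ t}ᶜ) ^ (n + 1) := by
        simp [measureReal_def, Measure.pi_pi, ENNReal.toReal_pow]
    _ ≤ (Real.exp (-(t ^ r / r.factorial))) ^ (n + 1) := by
        refine pow_le_pow_left₀ measureReal_nonneg ?_ _
        rw [probReal_compl_eq_one_sub hm]
        linarith [Real.add_one_le_exp (-(t ^ r / (r.factorial : ℝ)))]
    _ = _ := by
        rw [← Real.exp_nat_mul, Real.rpow_natCast]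
        push_cast
        ring_nf

theorem integrable_minClipSum_pow {r n : ℕ} (P : Measure (Fin (n + 1) → Fin r → ℝ))
    [IsFiniteMeasure P] (k : ℕ) : Integrable (fun X => minClipSum X ^ k) P := by
  refine integrable_of_bounded (measurable_minClipSum.pow_const k) 1 fun X => ?_
  rw [abs_of_nonneg (pow_nonneg (minClipSum_nonneg X) k)]
  exact pow_le_one₀ (minClipSum_nonneg X) (minClipSum_le_one X)

theorem integral_minClipSum_le {r n : ℕ} (hr : 0 < r) :
    ∫ X, minClipSum X ∂(Measure.pi fun _ : Fin (n + 1) => cubeMeasure r) ≤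
      (((n : ℝ) + 1) / r.factorial) ^ (-1 / (r : ℝ)) * Real.Gamma (1 / (r : ℝ) + 1) := by
  refine integral_le_of_tail ?_ minClipSum_nonneg (Nat.cast_pos.2 hr) (by positivity)
    fun t ht => minClipSum_tail ht
  simpa using integrable_minClipSum_pow (Measure.pi fun _ : Fin (n + 1) => cubeMeasure r) 1

theorem integral_minClipSum_sq_le {r n : ℕ} (hr : 0 < r) :
    ∫ X, minClipSum X ^ 2 ∂(Measure.pi fun _ : Fin (n + 1) => cubeMeasure r) ≤
      (((n : ℝ) + 1) / r.factorial) ^ (-1 / ((r : ℝ) / 2)) *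
        Real.Gamma (1 / ((r : ℝ) / 2) + 1) := by
  have hr' : (0 : ℝ) < r := Nat.cast_pos.2 hr
  refine integral_le_of_tail (integrable_minClipSum_pow _ 2) (fun X => sq_nonneg _)
    (by positivity) (by positivity) fun t ht => ?_
  have h := minClipSum_tail (r := r) (n := n) (Real.sqrt_pos.2 ht)
  have e : {X : Fin (n + 1) → Fin r → ℝ | t < minClipSum X ^ 2} =
      {X | √t < minClipSum X} := by
    ext X
    simp only [Set.mem_ofPred_eq]
    rw [Real.sqrt_lt ht.le (minClipSum_nonneg X)]
  rw [e]
  refine h.trans (le_of_eq ?_)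
  rw [Real.sqrt_eq_rpow, ← Real.rpow_mul ht.le]
  ring_nf

/-- The part of the unit cube above the point `x`. -/
def boxAbove {r : ℕ} (x : Fin r → ℝ) : Set (Fin r → ℝ) :=
  Set.univ.pi fun i => Set.Ioo (x i) 1

theorem one_sub_sum_le_prod_one_sub {ι : Type*} (s : Finset ι) {f : ι → ℝ} (h0 : ∀ i, 0 ≤ f i)
    (h1 : ∀ i, f i ≤ 1) : 1 - ∑ i ∈ s, f i ≤ ∏ i ∈ s, (1 - f i) := by
  classical
  induction s using Finset.induction_on with
  | empty => simp
  | insert i s hi ih =>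
    rw [sum_insert hi, prod_insert hi]
    have h2 : ∏ i ∈ s, (1 - f i) ≤ 1 :=
      prod_le_one (fun i _ => sub_nonneg.2 (h1 i)) fun i _ => by linarith [h0 i]
    nlinarith [mul_le_mul_of_nonneg_left h2 (h0 i)]

theorem one_sub_clipSum_le {r : ℕ} {x : Fin r → ℝ} (hx : ∀ i, x i ∈ Set.Ioo (0 : ℝ) 1) :
    1 - clipSum x ≤ (cubeMeasure r).real (boxAbove x) := by
  rw [boxAbove, measureReal_def, cubeMeasure_box (fun i => (hx i).1.le) (fun _ => le_rfl),
    ENNReal.toReal_prod]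
  simp_rw [fun i => ENNReal.toReal_ofReal (sub_nonneg.2 (hx i).2.le)]
  have h1 : 1 - ∑ i, x i ≤ ∏ i, (1 - x i) :=
    one_sub_sum_le_prod_one_sub univ (fun i => (hx i).1.le) (fun i => (hx i).2.le)
  have h2 : 0 ≤ ∏ i, (1 - x i) := prod_nonneg fun i _ => sub_nonneg.2 (hx i).2.le
  rcases le_total (∑ i, x i) 1 with h | h
  · rw [clipSum, min_eq_left h]
    linarith [le_max_right 0 (∑ i, x i)]
  · rw [clipSum, min_eq_right h]
    linarith [le_max_right (0 : ℝ) 1]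

theorem integral_rpow_countIn_ge {α : Type*} [MeasurableSpace α] (ν : Measure α)
    [IsProbabilityMeasure ν] {B : Set α} (hB : MeasurableSet B) {n : ℕ} (hn : 0 < n) {p s : ℝ}
    (hp : 0 < p) (hp1 : p ≤ 1) (hs : 1 - s ≤ ν.real B) :
    (n : ℝ) ^ p * (1 - p * s - 4 * s ^ 2 - 4 / n) ≤
      ∫ X, (countIn B X : ℝ) ^ p ∂Measure.pi (fun _ : Fin n => ν) := by
  have hn' : (0 : ℝ) < n := Nat.cast_pos.2 hn
  set q := ν.real B with hq
  have hq1 : q ≤ 1 := measureReal_le_one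
  set P := Measure.pi (fun _ : Fin n => ν) with hP
  have hpt : ∀ k : ℕ, (n : ℝ) ^ p * (1 + p * ((k : ℝ) / n - 1) -
      4 * (((k : ℝ) - n * q) ^ 2 / n ^ 2 + (1 - q) ^ 2)) ≤ (k : ℝ) ^ p := by
    intro k
    have h := one_add_sub_sq_le_rpow hp hp1 (y := (k : ℝ) / n) (by positivity)
    rw [Real.div_rpow (by positivity) hn'.le, le_div_iff₀ (by positivity), mul_comm] at h
    refine le_trans (mul_le_mul_of_nonneg_left ?_ (by positivity)) h
    have e : ((k : ℝ) - n * q) ^ 2 / n ^ 2 = ((k : ℝ) / n - q) ^ 2 := by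
      field_simp
    rw [e]
    nlinarith [sq_nonneg ((k : ℝ) / n - q - (q - 1))]
  have hv := variance_countIn_le ν hB n
  have hm := integral_countIn ν hB n
  rw [← hP, ← hq] at hv hm
  have i1 : Integrable (fun X => (countIn B X : ℝ)) P := integrable_comp_countIn hB P _
  have i2 : Integrable (fun X => ((countIn B X : ℝ) - n * q) ^ 2) P :=
    integrable_comp_countIn hB P fun k => ((k : ℝ) - n * q) ^ 2
  refine le_trans ?_ (integral_mono (integrable_comp_countIn hB P fun k : ℕ => (n : ℝ) ^ p *
    (1 + p * ((k : ℝ) / n - 1) - 4 * (((k : ℝ) - n * q) ^ 2 / n ^ 2 + (1 - q) ^ 2)))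
    (integrable_comp_countIn hB P fun k : ℕ => (k : ℝ) ^ p) fun X => hpt _)
  rw [integral_const_mul]
  refine mul_le_mul_of_nonneg_left ?_ (by positivity)
  have e : ∀ X : Fin n → α, 1 + p * ((countIn B X : ℝ) / n - 1) -
      4 * (((countIn B X : ℝ) - n * q) ^ 2 / n ^ 2 + (1 - q) ^ 2) =
      (1 - p - 4 * (1 - q) ^ 2) + (p / n * (countIn B X : ℝ) -
        4 / n ^ 2 * ((countIn B X : ℝ) - n * q) ^ 2) := fun X => by ring
  simp_rw [e]
  have i3 : Integrable (fun X => p / n * (countIn B X : ℝ) -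
      4 / n ^ 2 * ((countIn B X : ℝ) - n * q) ^ 2) P := (i1.const_mul _).sub (i2.const_mul _)
  rw [integral_add (integrable_const _) i3,
    integral_sub (i1.const_mul _) (i2.const_mul _), integral_const_mul, integral_const_mul, hm]
  have h1 : 4 / (n : ℝ) ^ 2 * ∫ X, ((countIn B X : ℝ) - n * q) ^ 2 ∂P ≤ 4 / n := by
    calc _ ≤ 4 / (n : ℝ) ^ 2 * (n * 1) := by
          refine mul_le_mul_of_nonneg_left (hv.trans ?_) (by positivity)
          gcongr
      _ = 4 / n := by field_simp
  have h2 : p / n * (n * q) = p * q := by field_simp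
  have h3 : (1 - q) ^ 2 ≤ s ^ 2 := by nlinarith
  have h4 : p * (1 - q) ≤ p * s := by
    refine mul_le_mul_of_nonneg_left ?_ hp.le
    linarith
  rw [h2]
  simp only [integral_const, probReal_univ, smul_eq_mul, one_mul]
  nlinarith

theorem cubeMeasure_ae_mem (r : ℕ) : ∀ᵐ x ∂cubeMeasure r, ∀ i, x i ∈ Set.Ioo (0 : ℝ) 1 := by
  rw [ae_all_iff]
  intro i
  have h : ∀ᵐ y ∂unitMeasure, y ∈ Set.Ioo (0 : ℝ) 1 := ae_restrict_mem measurableSet_Ioo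
  exact (measurePreserving_eval (fun _ : Fin r => unitMeasure) i).quasiMeasurePreserving.ae h

/-- The lower bound used as an induction hypothesis in the greedy argument. -/
theorem integral_indicator_boxAbove_nonneg {r : ℕ} (hr : 0 < r) {n : ℕ} (hn : 0 < n) {a C : ℝ}
    (ha : 0 ≤ a) (hg : ∀ k ≤ n, a * (k : ℝ) ^ (1 / (r : ℝ)) - C ≤ meanChain r k)
    {x : Fin r → ℝ} (hx : ∀ i, x i ∈ Set.Ioo (0 : ℝ) 1) :
    0 ≤ ∫ Y, (Set.univ.pi fun _ : Fin n => {y : Fin r → ℝ | ∑ i, x i < ∑ i, y i}).indicator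
      (fun Y => (cliqueNum (boxAbove x) (SignComparable fun _ => true) Y : ℝ) -
        (a * ((n : ℝ) ^ (1 / (r : ℝ)) * (1 - 1 / (r : ℝ) * clipSum x -
          4 * clipSum x ^ 2 - 4 / n)) - C)) Y
      ∂Measure.pi (fun _ : Fin n => cubeMeasure r) := by
  set H := {y : Fin r → ℝ | ∑ i, x i < ∑ i, y i} with hH
  have hHm : MeasurableSet H := measurableSet_lt measurable_const (by fun_prop)
  have hr' : (0 : ℝ) < r := Nat.cast_pos.2 hr
  have hBH : boxAbove x ⊆ H := fun y hy =>
    Finset.sum_lt_sum_of_nonempty ⟨⟨0, hr⟩, mem_univ _⟩ fun i _ => (hy i trivial).1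
  have hB : MeasurableSet (boxAbove x) := measurableSet_box _ _
  have hB0 : cubeMeasure r (boxAbove x) ≠ 0 :=
    cubeMeasure_box_ne_zero (fun i => (hx i).2) (fun i => (hx i).1.le) fun _ => le_rfl
  have hH0 : cubeMeasure r H ≠ 0 := fun h => hB0 (measure_mono_null hBH h)
  have hp : IsProbabilityMeasure ((cubeMeasure r)[|H]) := cond_isProbabilityMeasure hH0
  have hHpi : (Measure.pi fun _ : Fin n => cubeMeasure r) (Set.univ.pi fun _ => H) ≠ 0 := by
    rw [Measure.pi_pi]
    exact prod_ne_zero_iff.2 fun _ _ => hH0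
  rw [integral_indicator (MeasurableSet.univ_pi fun _ => hHm), setIntegral_eq_mul_cond hHpi,
    cond_pi _ (fun _ => hHm) fun _ => hH0]
  refine mul_nonneg measureReal_nonneg ?_
  have i1 := integrable_cliqueNum hB (measurableSet_signComparable fun _ : Fin r => true)
    (Measure.pi fun _ : Fin n => (cubeMeasure r)[|H])
  rw [integral_sub i1 (integrable_const _), sub_nonneg]
  have h1 := meanClique_cond_box (fun _ : Fin r => true) hHm (fun i => (hx i).2)
    (fun i => (hx i).1.le) (fun _ => le_rfl) hBH n
  rw [meanClique] at h1
  rw [boxAbove, h1]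
  have hs : 1 - clipSum x ≤ ((cubeMeasure r)[|H]).real (boxAbove x) := by
    refine (one_sub_clipSum_le hx).trans ?_
    rw [measureReal_def, measureReal_def, cond_apply hHm, Set.inter_eq_right.2 hBH]
    refine ENNReal.toReal_mono
      (ENNReal.mul_ne_top (ENNReal.inv_ne_top.2 hH0) (measure_ne_top _ _)) ?_
    exact le_mul_of_one_le_left zero_le (ENNReal.one_le_inv.2 prob_le_one)
  have h2 := integral_rpow_countIn_ge ((cubeMeasure r)[|H]) hB hn (p := 1 / (r : ℝ))
    (by positivity) (by rw [div_le_one hr']; exact_mod_cast hr) hs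
  have i2 := integrable_comp_countIn hB (Measure.pi fun _ : Fin n => (cubeMeasure r)[|H])
    (fun k : ℕ => (k : ℝ) ^ (1 / (r : ℝ)))
  have h3 := integral_mono ((i2.const_mul a).sub (integrable_const C))
    (integrable_comp_countIn hB (Measure.pi fun _ : Fin n => (cubeMeasure r)[|H]) (meanChain r))
    fun X => hg _ ((countIn_le _ _).trans (by simp))
  simp only [Pi.sub_apply] at h3
  rw [integral_sub (i2.const_mul a) (integrable_const _), integral_const_mul] at h3
  simp only [integral_const, probReal_univ, smul_eq_mul, one_mul] at h3 ⊢
  refine le_trans ?_ h3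
  gcongr

theorem cubeMeasure_sum_eq {r : ℕ} (hr : 0 < r) (c : ℝ) :
    (cubeMeasure r).real {x | ∑ i, x i = c} = 0 := by
  induction r, Nat.succ_le_of_lt hr using Nat.le_induction generalizing c with
  | base =>
    have e : {x : Fin 1 → ℝ | ∑ i, x i = c} =
        (Function.eval 0 : (Fin 1 → ℝ) → ℝ) ⁻¹' ({c} : Set ℝ) := by
      ext x
      simp
    have h := (measurePreserving_eval (fun _ : Fin 1 => unitMeasure) 0).measure_preimage
      (measurableSet_singleton c).nullMeasurableSet
    rw [measureReal_def, e]
    change (Measure.pi (fun _ : Fin 1 => unitMeasure) _).toReal = 0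
    rw [h]
    simp
  | succ r hr' ih =>
    have hm : MeasurableSet {x : Fin (r + 1) → ℝ | ∑ i, x i = c} :=
      measurableSet_eq_fun (by fun_prop) measurable_const
    have h1 : (cubeMeasure (r + 1)).real {x | ∑ i, x i = c} =
        ∫ x, {x : Fin (r + 1) → ℝ | ∑ i, x i = c}.indicator (fun _ => (1 : ℝ)) x
          ∂cubeMeasure (r + 1) := by
      rw [integral_indicator_const _ hm]
      simp
    rw [h1, cubeMeasure, integral_pi_insertNth unitMeasure 0 (measurable_const.indicator hm) 1
      (fun x => by by_cases h : x ∈ {x : Fin (r + 1) → ℝ | ∑ i, x i = c} <;> simp [h])]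
    have h2 : ∀ x : ℝ, ∫ Y, {x : Fin (r + 1) → ℝ | ∑ i, x i = c}.indicator (fun _ => (1 : ℝ))
        (Fin.insertNth 0 x Y) ∂Measure.pi (fun _ : Fin r => unitMeasure) = 0 := by
      intro x
      have hm' : MeasurableSet {y : Fin r → ℝ | ∑ i, y i = c - x} :=
        measurableSet_eq_fun (by fun_prop) measurable_const
      have : (fun Y : Fin r → ℝ => {x : Fin (r + 1) → ℝ | ∑ i, x i = c}.indicator
          (fun _ => (1 : ℝ)) (Fin.insertNth 0 x Y)) =
          {y : Fin r → ℝ | ∑ i, y i = c - x}.indicator (fun _ => (1 : ℝ)) := by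
        ext Y
        simp only [Set.indicator_apply, Set.mem_ofPred_eq, Fin.sum_univ_succ, Fin.insertNth_zero,
          Fin.cons_zero, Fin.cons_succ, eq_sub_iff_add_eq']
        rfl
      rw [this, integral_indicator_const _ hm', ← cubeMeasure, ih hr']
      simp
    simp_rw [h2, integral_zero]

/-- The point with index `j` has the strictly smallest coordinate sum. -/
def IsSumMin {r n : ℕ} (j : Fin (n + 1)) (X : Fin (n + 1) → Fin r → ℝ) : Prop :=
  ∀ k : Fin n, ∑ i, X j i < ∑ i, X (j.succAbove k) i

theorem measurableSet_isSumMin {r n : ℕ} (j : Fin (n + 1)) :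
    MeasurableSet {X : Fin (n + 1) → Fin r → ℝ | IsSumMin j X} := by
  simp only [IsSumMin, Set.ofPred_forall]
  exact MeasurableSet.iInter fun k => measurableSet_lt (by fun_prop) (by fun_prop)

theorem IsSumMin.lt {r n : ℕ} {j : Fin (n + 1)} {X : Fin (n + 1) → Fin r → ℝ}
    (h : IsSumMin j X) {k : Fin (n + 1)} (hk : k ≠ j) : ∑ i, X j i < ∑ i, X k i := by
  obtain ⟨l, rfl⟩ := Fin.exists_succAbove_eq hk
  exact h l

theorem ae_exists_isSumMin {r n : ℕ} (hr : 0 < r) :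
    ∀ᵐ X ∂Measure.pi (fun _ : Fin (n + 1) => cubeMeasure r), ∃ j, IsSumMin j X := by
  have h : ∀ j : Fin (n + 1), ∀ k : Fin n,
      ∀ᵐ X ∂Measure.pi (fun _ : Fin (n + 1) => cubeMeasure r),
        ∑ i, X j i ≠ ∑ i, X (j.succAbove k) i := by
    intro j k
    have hm : MeasurableSet {p : (Fin r → ℝ) × (Fin n → Fin r → ℝ) |
        ∑ i, p.1 i ≠ ∑ i, p.2 k i} :=
      (measurableSet_eq_fun (by fun_prop) (by fun_prop)).compl
    have h1 : ∀ᵐ p ∂(cubeMeasure r).prod (Measure.pi fun _ : Fin n => cubeMeasure r),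
        ∑ i, p.1 i ≠ ∑ i, p.2 k i := by
      rw [Measure.ae_prod_iff_ae_ae hm]
      refine Eventually.of_forall fun x => ?_
      have h2 : ∀ᵐ y ∂cubeMeasure r, ∑ i, x i ≠ ∑ i, y i := by
        have := cubeMeasure_sum_eq hr (∑ i, x i)
        rw [measureReal_eq_zero_iff] at this
        rw [ae_iff]
        simpa [eq_comm] using this
      exact (measurePreserving_eval (fun _ : Fin n => cubeMeasure r) k).quasiMeasurePreserving.ae h2
    exact (measurePreserving_piFinSuccAbove (fun _ : Fin (n + 1) => cubeMeasure r)
      j).quasiMeasurePreserving.ae h1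
  have h' := ae_all_iff.2 fun j => ae_all_iff.2 (h j)
  filter_upwards [h'] with X hX
  obtain ⟨j, -, hj⟩ := exists_min_image univ (fun j => ∑ i, X j i) univ_nonempty
  exact ⟨j, fun k => lt_of_le_of_ne (hj _ (mem_univ _)) (hX j k)⟩

theorem measurable_cliqueNum_boxAbove {r n : ℕ} (j : Fin (n + 1)) :
    Measurable fun X : Fin (n + 1) → Fin r → ℝ =>
      (cliqueNum (boxAbove (X j)) (SignComparable fun _ => true)
        (fun k => X (j.succAbove k)) : ℝ) := by
  have hA : MeasurableSet {p : (Fin r → ℝ) × (Fin r → ℝ) | p.2 ∈ boxAbove p.1} := by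
    simp only [boxAbove, Set.mem_univ_pi, Set.ofPred_forall, Set.mem_Ioo]
    exact MeasurableSet.iInter fun i => MeasurableSet.inter
      (s₁ := {p : (Fin r → ℝ) × (Fin r → ℝ) | p.1 i < p.2 i}) (s₂ := {p | p.2 i < 1})
      (measurableSet_lt (by fun_prop) (by fun_prop))
      (measurableSet_lt (by fun_prop) measurable_const)
  have hR : MeasurableSet {q : ((Fin r → ℝ) × (Fin r → ℝ)) × ((Fin r → ℝ) × (Fin r → ℝ)) |
      SignComparable (fun _ => true) q.1.2 q.2.2} :=
    (measurableSet_signComparable fun _ : Fin r => true).preimage (by fun_prop :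
      Measurable fun q : ((Fin r → ℝ) × (Fin r → ℝ)) × ((Fin r → ℝ) × (Fin r → ℝ)) =>
        (q.1.2, q.2.2))
  have h := (measurable_cliqueNum_real (ι := Fin n) hA
    (R := fun p q => SignComparable (fun _ => true) p.2 q.2) hR).comp
    (by fun_prop : Measurable fun (X : Fin (n + 1) → Fin r → ℝ) (k : Fin n) =>
      (X j, X (j.succAbove k)))
  convert h using 1
  ext X
  simp only [Function.comp]
  congr 1

theorem one_add_cliqueNum_boxAbove_le {r n : ℕ} {j : Fin (n + 1)} {X : Fin (n + 1) → Fin r → ℝ} :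
    1 + cliqueNum (boxAbove (X j)) (SignComparable fun _ => true) (fun k => X (j.succAbove k)) ≤
      cliqueNum Set.univ (SignComparable fun _ => true) X := by
  obtain ⟨S, hS, e⟩ := exists_isIndexClique (boxAbove (X j)) (SignComparable fun _ => true)
    (fun k => X (j.succAbove k))
  have hlt : ∀ k ∈ S, SignLT (fun _ => true) (X j) (X (j.succAbove k)) := fun k hk i => by
    simpa using (hS.1 k hk i trivial).1
  have hj : j ∉ S.map j.succAboveEmb := by simp
  have hc : IsIndexClique Set.univ (SignComparable fun _ => true) X
      (insert j (S.map j.succAboveEmb)) := by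
    refine ⟨fun _ _ => trivial, ?_⟩
    simp only [mem_insert, Finset.mem_map, Fin.coe_succAboveEmb]
    rintro a (rfl | ⟨k, hk, rfl⟩) b (rfl | ⟨l, hl, rfl⟩) hab
    · exact absurd rfl hab
    · exact Or.inl (hlt l hl)
    · exact Or.inr (hlt k hk)
    · exact hS.2 k hk l hl fun h => hab (h ▸ rfl)
  have := hc.card_le
  rw [card_insert_of_notMem hj, card_map] at this
  omega

/-- One step of the greedy construction of a long chain, with a bonus event `G` on which the
greedy choice of the point of smallest coordinate sum can be improved. -/
theorem meanChain_succ_ge {r : ℕ} (hr : 0 < r) {n : ℕ} (hn : 0 < n) {a C : ℝ}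
    (ha : 0 ≤ a) (hg : ∀ k ≤ n, a * (k : ℝ) ^ (1 / (r : ℝ)) - C ≤ meanChain r k)
    {G : Set (Fin (n + 1) → Fin r → ℝ)} (hG : MeasurableSet G)
    (hbonus : ∀ X ∈ G, ∀ j, IsSumMin j X →
      2 + cliqueNum (boxAbove (X j)) (SignComparable fun _ => true) (fun k => X (j.succAbove k)) ≤
        cliqueNum Set.univ (SignComparable fun _ => true) X) :
    1 + a * (n : ℝ) ^ (1 / (r : ℝ)) * (1 -
        1 / (r : ℝ) * ∫ X, minClipSum X ∂Measure.pi (fun _ : Fin (n + 1) => cubeMeasure r) -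
        4 * ∫ X, minClipSum X ^ 2 ∂Measure.pi (fun _ : Fin (n + 1) => cubeMeasure r) - 4 / n) - C +
      (Measure.pi fun _ : Fin (n + 1) => cubeMeasure r).real G ≤ meanChain r (n + 1) := by
  classical
  set P := Measure.pi fun _ : Fin (n + 1) => cubeMeasure r with hP
  set D : ℝ → ℝ := fun s =>
    a * ((n : ℝ) ^ (1 / (r : ℝ)) * (1 - 1 / (r : ℝ) * s - 4 * s ^ 2 - 4 / n)) - C with hD
  have hDm : Measurable D := by fun_prop
  set E : Fin (n + 1) → Set (Fin (n + 1) → Fin r → ℝ) := fun j => {X | IsSumMin j X} with hE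
  set L : Fin (n + 1) → (Fin (n + 1) → Fin r → ℝ) → ℝ := fun j X =>
    (cliqueNum (boxAbove (X j)) (SignComparable fun _ => true) (fun k => X (j.succAbove k)) : ℝ)
    with hL
  obtain ⟨K, hK⟩ : ∃ K, ∀ s ∈ Set.Icc (0 : ℝ) 1, |D s| ≤ K := by
    have : ContinuousOn D (Set.Icc 0 1) := by fun_prop
    obtain ⟨K, hK⟩ := isCompact_Icc.exists_bound_of_continuousOn this
    exact ⟨K, fun s hs => hK s hs⟩
  have hLm : ∀ j, Measurable (L j) := measurable_cliqueNum_boxAbove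
  have hdm : ∀ j, Measurable fun X : Fin (n + 1) → Fin r → ℝ => D (clipSum (X j)) := fun j =>
    hDm.comp (measurable_clipSum.comp (measurable_pi_apply j))
  have hfm : ∀ j, Measurable ((E j).indicator fun X => L j X - D (clipSum (X j))) := fun j =>
    ((hLm j).sub (hdm j)).indicator (measurableSet_isSumMin j)
  have hfb : ∀ j X, |(E j).indicator (fun X => L j X - D (clipSum (X j))) X| ≤ n + K := by
    intro j X
    have h1 : |L j X| ≤ n := by
      rw [abs_of_nonneg (Nat.cast_nonneg _)]
      exact Nat.cast_le.2 ((cliqueNum_le_card _ _ _).trans (Fintype.card_fin n).le)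
    have h2 := hK (clipSum (X j)) ⟨clipSum_nonneg _, clipSum_le_one _⟩
    by_cases h : X ∈ E j
    · rw [Set.indicator_of_mem h]
      exact (abs_sub _ _).trans (add_le_add h1 h2)
    · rw [Set.indicator_of_notMem h, abs_zero]
      exact add_nonneg (Nat.cast_nonneg _) ((abs_nonneg _).trans h2)
  have hnn : ∀ j, 0 ≤ ∫ X, (E j).indicator (fun X => L j X - D (clipSum (X j))) X ∂P := by
    intro j
    rw [hP, integral_pi_insertNth _ j (hfm j) _ (hfb j)]
    refine integral_nonneg_of_ae ?_
    filter_upwards [cubeMeasure_ae_mem r] with x hx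
    refine (integral_indicator_boxAbove_nonneg hr hn ha hg hx).trans (le_of_eq ?_)
    refine integral_congr_ae (Eventually.of_forall fun Y => ?_)
    simp only [Set.indicator_apply, hE, Set.mem_ofPred_eq, IsSumMin, Set.mem_univ_pi, hL, hD,
      Fin.insertNth_apply_same, Fin.insertNth_apply_succAbove]
  have hpt : ∀ X, (∃ j, IsSumMin j X) →
      ∑ j, (E j).indicator (fun X => L j X - D (clipSum (X j))) X +
      (1 + D (minClipSum X)) + G.indicator (fun _ => (1 : ℝ)) X ≤
      cliqueNum Set.univ (SignComparable fun _ => true) X := by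
    rintro X ⟨j, hj⟩
    rw [sum_eq_single j]
    · rw [Set.indicator_of_mem (by exact hj)]
      have hs : minClipSum X = clipSum (X j) := by
        refine le_antisymm (inf'_le _ (mem_univ j)) (le_inf' _ _ fun k _ => clipSum_mono ?_)
        rcases eq_or_ne k j with rfl | h
        · exact le_rfl
        · exact (hj.lt h).le
      rw [hs]
      by_cases h : X ∈ G
      · have := hbonus X h j hj
        rw [Set.indicator_of_mem h]
        have : (2 : ℝ) + L j X ≤ cliqueNum Set.univ (SignComparable fun _ => true) X := by
          simp only [hL]
          exact_mod_cast this
        linarith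
      · have := one_add_cliqueNum_boxAbove_le (j := j) (X := X)
        rw [Set.indicator_of_notMem h]
        have : (1 : ℝ) + L j X ≤ cliqueNum Set.univ (SignComparable fun _ => true) X := by
          simp only [hL]
          exact_mod_cast this
        linarith
    · intro k _ hk
      refine Set.indicator_of_notMem (fun (h : IsSumMin k X) => ?_) _
      exact lt_asymm (h.lt hk.symm) (hj.lt hk)
    · simp
  have i1 : ∀ j, Integrable ((E j).indicator fun X => L j X - D (clipSum (X j))) P := fun j =>
    integrable_of_bounded (hfm j) _ (hfb j)
  have i2 : Integrable (fun X => ∑ j, (E j).indicator (fun X => L j X - D (clipSum (X j))) X) P :=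
    integrable_finsetSum _ fun j _ => i1 j
  have j1 : Integrable (fun X => minClipSum X) P := by simpa using integrable_minClipSum_pow P 1
  have j2 := integrable_minClipSum_pow P 2
  have e3 : ∀ X : Fin (n + 1) → Fin r → ℝ, 1 + D (minClipSum X) =
      (1 + a * (n : ℝ) ^ (1 / (r : ℝ)) * (1 - 4 / n) - C) -
        (a * (n : ℝ) ^ (1 / (r : ℝ)) * (1 / (r : ℝ)) * minClipSum X +
        a * (n : ℝ) ^ (1 / (r : ℝ)) * 4 * minClipSum X ^ 2) := fun X => by
    simp only [hD]
    ring
  have j3 : Integrable (fun X => a * (n : ℝ) ^ (1 / (r : ℝ)) * (1 / (r : ℝ)) * minClipSum X +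
        a * (n : ℝ) ^ (1 / (r : ℝ)) * 4 * minClipSum X ^ 2) P :=
    (j1.const_mul _).add (j2.const_mul _)
  have i3 : Integrable (fun X => 1 + D (minClipSum X)) P := by
    simp_rw [e3]
    exact (integrable_const _).sub j3
  have i4 : Integrable (G.indicator fun _ => (1 : ℝ)) P := (integrable_const _).indicator hG
  have i5 : Integrable (fun X => ∑ j, (E j).indicator (fun X => L j X - D (clipSum (X j))) X +
      (1 + D (minClipSum X))) P := i2.add i3
  have h := integral_mono_ae (i5.add i4) (integrable_cliqueNum MeasurableSet.univ
    (measurableSet_signComparable fun _ : Fin r => true) P)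
    ((ae_exists_isSumMin hr).mono fun X hX => hpt X hX)
  simp only [Pi.add_apply] at h
  rw [integral_add i5 i4, integral_add i2 i3, integral_finsetSum _ fun j _ => i1 j,
    integral_indicator_const _ hG] at h
  have h3 : ∫ X, (1 + D (minClipSum X)) ∂P = (1 + a * (n : ℝ) ^ (1 / (r : ℝ)) * (1 - 4 / n) - C) -
        (a * (n : ℝ) ^ (1 / (r : ℝ)) * (1 / (r : ℝ)) * ∫ X, minClipSum X ∂P +
        a * (n : ℝ) ^ (1 / (r : ℝ)) * 4 * ∫ X, minClipSum X ^ 2 ∂P) := by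
    simp_rw [e3]
    rw [integral_sub (integrable_const _) j3, integral_add (j1.const_mul _) (j2.const_mul _),
      integral_const_mul, integral_const_mul]
    simp
  rw [h3] at h
  have h4 := sum_nonneg fun j (_ : j ∈ univ) => hnn j
  simp only [smul_eq_mul, mul_one] at h
  rw [meanChain, meanClique]
  have h5 : 1 + a * (n : ℝ) ^ (1 / (r : ℝ)) * (1 - 1 / (r : ℝ) * ∫ X, minClipSum X ∂P -
        4 * ∫ X, minClipSum X ^ 2 ∂P - 4 / n) - C =
      (1 + a * (n : ℝ) ^ (1 / (r : ℝ)) * (1 - 4 / n) - C) -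
        (a * (n : ℝ) ^ (1 / (r : ℝ)) * (1 / (r : ℝ)) * ∫ X, minClipSum X ∂P +
        a * (n : ℝ) ^ (1 / (r : ℝ)) * 4 * ∫ X, minClipSum X ^ 2 ∂P) := by ring
  rw [h5]
  linarith

/-- Lower bound for the probability that, among `N` independent points, each of the cells `A c`
contains exactly one point and all the other points lie in `O`. -/
theorem le_pi_real_exists_embedding {κ α : Type*} [Fintype κ] [MeasurableSpace α] (ν : Measure α)
    [IsProbabilityMeasure ν] {A : κ → Set α} {O : Set α} (hA : ∀ c, MeasurableSet (A c))
    (hO : MeasurableSet O) (hAA : ∀ c d, c ≠ d → Disjoint (A c) (A d))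
    (hAO : ∀ c, Disjoint (A c) O) {v q : ℝ} (hv0 : 0 ≤ v) (hq0 : 0 ≤ q)
    (hv : ∀ c, v ≤ ν.real (A c)) (hq : q ≤ ν.real O) (N : ℕ) :
    MeasurableSet {X : Fin N → α | ∃ f : κ ↪ Fin N, (∀ c, X (f c) ∈ A c) ∧
      ∀ k, k ∉ Set.range f → X k ∈ O} ∧
    (N.descFactorial (Fintype.card κ) : ℝ) * (v ^ Fintype.card κ * q ^ N) ≤
      (Measure.pi fun _ : Fin N => ν).real {X | ∃ f : κ ↪ Fin N, (∀ c, X (f c) ∈ A c) ∧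
        ∀ k, k ∉ Set.range f → X k ∈ O} := by
  classical
  set s : (κ ↪ Fin N) → Fin N → Set α := fun f => Function.extend f A fun _ => O with hs
  have h1 : ∀ f : κ ↪ Fin N, ∀ c, s f (f c) = A c := fun f c => f.injective.extend_apply _ _ _
  have h2 : ∀ f : κ ↪ Fin N, ∀ k, k ∉ Set.range f → s f k = O := fun f k hk =>
    Function.extend_apply' _ _ _ (by simpa using hk)
  have hmeas : ∀ f k, MeasurableSet (s f k) := fun f k => by
    by_cases hk : k ∈ Set.range f
    · obtain ⟨c, rfl⟩ := hk
      rw [h1]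
      exact hA c
    · rw [h2 f k hk]
      exact hO
  have e : {X : Fin N → α | ∃ f : κ ↪ Fin N, (∀ c, X (f c) ∈ A c) ∧
      ∀ k, k ∉ Set.range f → X k ∈ O} = ⋃ f, Set.univ.pi (s f) := by
    ext X
    simp only [Set.mem_ofPred_eq, Set.mem_iUnion, Set.mem_univ_pi]
    refine exists_congr fun f => ⟨fun h k => ?_, fun h => ⟨fun c => h1 f c ▸ h (f c),
      fun k hk => h2 f k hk ▸ h k⟩⟩
    by_cases hk : k ∈ Set.range f
    · obtain ⟨c, rfl⟩ := hk
      rw [h1]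
      exact h.1 c
    · rw [h2 f k hk]
      exact h.2 k hk
  have hpm : ∀ f, MeasurableSet (Set.univ.pi (s f)) := fun f => MeasurableSet.univ_pi (hmeas f)
  have hdisj : Pairwise fun f g => Disjoint (Set.univ.pi (s f)) (Set.univ.pi (s g)) := by
    intro f g hfg
    obtain ⟨c, hc⟩ : ∃ c, f c ≠ g c := by
      by_contra! h
      exact hfg (DFunLike.ext _ _ h)
    rw [Set.disjoint_left]
    intro X hf hg
    have hX : X (f c) ∈ A c := h1 f c ▸ hf (f c) trivial
    have hX' := hg (f c) trivial
    by_cases hk : f c ∈ Set.range g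
    · obtain ⟨d, hd⟩ := hk
      rw [← hd, h1] at hX'
      have hcd : c ≠ d := fun h => hc (by rw [← hd, h])
      rw [hd] at hX'
      exact Set.disjoint_left.1 (hAA c d hcd) hX hX'
    · rw [h2 g _ hk] at hX'
      exact Set.disjoint_left.1 (hAO c) hX hX'
  rw [e]
  refine ⟨MeasurableSet.iUnion hpm, ?_⟩
  have hq1 : q ≤ 1 := hq.trans measureReal_le_one
  have hbound : ∀ f, v ^ Fintype.card κ * q ^ N ≤
      (Measure.pi fun _ : Fin N => ν).real (Set.univ.pi (s f)) := by
    intro f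
    rw [measureReal_def, Measure.pi_pi, ENNReal.toReal_prod,
      ← prod_mul_prod_compl (univ.map f), prod_map]
    refine mul_le_mul ?_ ?_ (pow_nonneg hq0 _) (prod_nonneg fun _ _ => ENNReal.toReal_nonneg)
    · refine le_trans (le_of_eq ?_) (prod_le_prod (fun _ _ => hv0) fun c _ => ?_)
      · rw [prod_const, card_univ]
      · rw [h1]
        exact hv c
    · refine le_trans ?_ (prod_le_prod (f := fun _ => q) (fun _ _ => hq0) fun k hk => ?_)
      · rw [prod_const]
        exact pow_le_pow_of_le_one hq0 hq1 ((card_le_univ _).trans (Fintype.card_fin N).le)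
      · rw [h2 f k (by simpa using hk)]
        exact hq
  rw [measureReal_iUnion_fintype hdisj hpm]
  refine le_trans (le_of_eq ?_) (sum_le_sum fun f _ => hbound f)
  rw [sum_const, card_univ, Fintype.card_embedding_eq, Fintype.card_fin, nsmul_eq_mul]

/-- The lower corners of the cells used to improve a greedy step, in units of the cell scale. -/
noncomputable def bonusCorner (r : ℕ) : Option (Fin r × Bool) → Fin r → ℝ
  | none, _ => 1
  | some (i, false), k => if k = i then 3 / 2 else 1 - 2 * (1 / (6 * r))
  | some (i, true), k => if k = i then 3 / 2 + 1 / (6 * r) else 1 - 1 / (6 * r)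

/-- The cells used to improve a greedy step, at scale `h`. -/
noncomputable def bonusCell (r : ℕ) (h : ℝ) (c : Option (Fin r × Bool)) : Set (Fin r → ℝ) :=
  Set.univ.pi fun i => Set.Ioo (h * bonusCorner r c i) (h * (bonusCorner r c i + 1 / (6 * r)))

/-- The region avoiding the vicinity of the origin at scale `h`. -/
def bonusOutside (r : ℕ) (h : ℝ) : Set (Fin r → ℝ) :=
  {y | (∀ i, 0 < y i) ∧ ∃ i, 2 * r * h < y i}

theorem bonusCorner_bounds {r : ℕ} (hr : 2 ≤ r) (c : Option (Fin r × Bool)) (i : Fin r) :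
    1 / 2 ≤ bonusCorner r c i ∧ bonusCorner r c i + 1 / (6 * r) ≤ 2 * r := by
  have hr' : (2 : ℝ) ≤ r := by exact_mod_cast hr
  have he : (1 : ℝ) / (6 * r) ≤ 1 / 12 := by
    apply one_div_le_one_div_of_le <;> linarith
  have he0 : (0 : ℝ) < 1 / (6 * r) := by positivity
  rcases c with _ | ⟨k, _ | _⟩ <;> simp only [bonusCorner] <;> (try split_ifs) <;>
    constructor <;> linarith

theorem sum_bonusCorner_some_ge {r : ℕ} (hr : 2 ≤ r) (i : Fin r) (s : Bool) :
    (r : ℝ) + 1 / 6 ≤ ∑ k, bonusCorner r (some (i, s)) k := by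
  have hr' : (2 : ℝ) ≤ r := by exact_mod_cast hr
  have he0 : (0 : ℝ) < 1 / (6 * r) := by positivity
  have h1 : ∀ k, (1 - 2 * (1 / (6 * (r : ℝ)))) + (if k = i then (1 : ℝ) / 2 else 0) ≤
      bonusCorner r (some (i, s)) k := by
    intro k
    rcases s <;> simp only [bonusCorner] <;> split_ifs <;> linarith
  refine le_trans ?_ (sum_le_sum fun k _ => h1 k)
  rw [sum_add_distrib, sum_ite_eq' univ i]
  simp only [sum_const, card_univ, Fintype.card_fin, nsmul_eq_mul, mem_univ, if_true]
  have : (r : ℝ) * (2 * (1 / (6 * r))) = 1 / 3 := by field_simp; norm_num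
  linarith

theorem disjoint_bonusCell {r : ℕ} (hr : 2 ≤ r) {h : ℝ} (hh : 0 < h)
    (c d : Option (Fin r × Bool)) (hcd : c ≠ d) :
    Disjoint (bonusCell r h c) (bonusCell r h d) := by
  have hr' : (2 : ℝ) ≤ r := by exact_mod_cast hr
  have he : (1 : ℝ) / (6 * r) ≤ 1 / 12 := by
    apply one_div_le_one_div_of_le <;> linarith
  have he0 : (0 : ℝ) < 1 / (6 * r) := by positivity
  have hsep : ∃ i, bonusCorner r c i + 1 / (6 * r) ≤ bonusCorner r d i ∨
      bonusCorner r d i + 1 / (6 * r) ≤ bonusCorner r c i := by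
    rcases c with _ | ⟨i, s⟩
    · rcases d with _ | ⟨j, t⟩
      · exact absurd rfl hcd
      · refine ⟨j, Or.inl ?_⟩
        rcases t <;> simp only [bonusCorner, if_true] <;> linarith
    · refine ⟨i, ?_⟩
      rcases d with _ | ⟨j, t⟩
      · refine Or.inr ?_
        rcases s <;> simp only [bonusCorner, if_true] <;> linarith
      · rcases eq_or_ne i j with rfl | hij
        · rcases s <;> rcases t
          · exact absurd rfl hcd
          · refine Or.inl ?_
            simp only [bonusCorner, if_true]
            linarith
          · refine Or.inr ?_
            simp only [bonusCorner, if_true]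
            linarith
          · exact absurd rfl hcd
        · refine Or.inr ?_
          rcases s <;> rcases t <;> simp only [bonusCorner, if_true, if_neg hij] <;> linarith
  obtain ⟨i, hi⟩ := hsep
  rw [Set.disjoint_left]
  intro x hx hy
  have h1 := hx i trivial
  have h2 := hy i trivial
  rcases hi with hi | hi
  · have := mul_le_mul_of_nonneg_left hi hh.le
    linarith [h1.2, h2.1]
  · have := mul_le_mul_of_nonneg_left hi hh.le
    linarith [h1.1, h2.2]

theorem disjoint_bonusCell_outside {r : ℕ} (hr : 2 ≤ r) {h : ℝ} (hh : 0 < h)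
    (c : Option (Fin r × Bool)) : Disjoint (bonusCell r h c) (bonusOutside r h) := by
  rw [Set.disjoint_left]
  rintro x hx ⟨-, i, hi⟩
  have h1 := hx i trivial
  have := mul_le_mul_of_nonneg_left (bonusCorner_bounds hr c i).2 hh.le
  linarith [h1.2]

theorem IsSumMin.eq_of_bonus {r : ℕ} (hr : 2 ≤ r) {h : ℝ} (hh : 0 < h) {n : ℕ}
    {X : Fin (n + 1) → Fin r → ℝ} {f : Option (Fin r × Bool) ↪ Fin (n + 1)}
    (hf : ∀ c, X (f c) ∈ bonusCell r h c)
    (hO : ∀ k, k ∉ Set.range f → X k ∈ bonusOutside r h) {j : Fin (n + 1)} (hj : IsSumMin j X) :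
    j = f none := by
  have hr' : (2 : ℝ) ≤ r := by exact_mod_cast hr
  by_contra hne
  have h1 := hj.lt (Ne.symm hne)
  have h2 : ∑ i, X (f none) i ≤ h * (r + 1 / 6) := by
    have : ∀ i, X (f none) i ≤ h * (1 + 1 / (6 * r)) := fun i => (hf none i trivial).2.le
    refine (sum_le_sum fun i _ => this i).trans (le_of_eq ?_)
    rw [sum_const, card_univ, Fintype.card_fin, nsmul_eq_mul]
    field_simp
  by_cases hk : j ∈ Set.range f
  · obtain ⟨c, rfl⟩ := hk
    rcases c with _ | ⟨i, s⟩
    · exact hne rfl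
    · have h3 : h * (r + 1 / 6) ≤ ∑ k, X (f (some (i, s))) k := by
        refine (mul_le_mul_of_nonneg_left (sum_bonusCorner_some_ge hr i s) hh.le).trans ?_
        rw [mul_sum]
        exact sum_le_sum fun k _ => (hf (some (i, s)) k trivial).1.le
      linarith
  · obtain ⟨hpos, i, hi⟩ := hO j hk
    have h3 : X j i ≤ ∑ k, X j k := single_le_sum (fun k _ => (hpos k).le) (mem_univ i)
    nlinarith

theorem two_add_cliqueNum_boxAbove_le {r : ℕ} (hr : 2 ≤ r) {h : ℝ} (hh : 0 < h) {n : ℕ}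
    {X : Fin (n + 1) → Fin r → ℝ} {f : Option (Fin r × Bool) ↪ Fin (n + 1)}
    (hf : ∀ c, X (f c) ∈ bonusCell r h c)
    (hO : ∀ k, k ∉ Set.range f → X k ∈ bonusOutside r h) {j : Fin (n + 1)} (hj : IsSumMin j X) :
    2 + cliqueNum (boxAbove (X j)) (SignComparable fun _ => true) (fun k => X (j.succAbove k)) ≤
      cliqueNum Set.univ (SignComparable fun _ => true) X := by
  classical
  have hr' : (2 : ℝ) ≤ r := by exact_mod_cast hr
  have he : (1 : ℝ) / (6 * r) ≤ 1 / 12 := by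
    apply one_div_le_one_div_of_le <;> linarith
  have he0 : (0 : ℝ) < 1 / (6 * r) := by positivity
  have hjf := hj.eq_of_bonus hr hh hf hO
  obtain ⟨S, hS, e⟩ := exists_isIndexClique (boxAbove (X j)) (SignComparable fun _ => true)
    (fun k => X (j.succAbove k))
  have habove : ∀ k ∈ S, ∀ i, X j i < X (j.succAbove k) i := fun k hk i => (hS.1 k hk i trivial).1
  have hout : ∀ k ∈ S, X (j.succAbove k) ∈ bonusOutside r h := by
    intro k hk
    refine hO _ ?_
    rintro ⟨c, hc⟩
    rcases c with _ | ⟨i, s⟩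
    · exact Fin.succAbove_ne j k (by rw [← hc, hjf])
    · obtain ⟨l, hl⟩ : ∃ l : Fin r, l ≠ i := by
        have : Nontrivial (Fin r) := Fin.nontrivial_iff_two_le.2 hr
        exact exists_ne i
      have h1 := habove k hk l
      rw [← hc, hjf] at h1
      have h2 := (hf none l trivial).1
      have h3 := (hf (some (i, s)) l trivial).2
      have h4 : bonusCorner r (some (i, s)) l + 1 / (6 * r) ≤ bonusCorner r none l := by
        rcases s <;> simp only [bonusCorner, if_neg hl] <;> linarith
      have := mul_le_mul_of_nonneg_left h4 hh.le
      linarith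
  obtain ⟨i, hi⟩ : ∃ i : Fin r, ∀ k ∈ S, 2 * r * h < X (j.succAbove k) i := by
    rcases S.eq_empty_or_nonempty with rfl | hne
    · exact ⟨⟨0, by omega⟩, by simp⟩
    · obtain ⟨k0, hk0, hmin⟩ := exists_min_image S (fun k => X (j.succAbove k) ⟨0, by omega⟩) hne
      obtain ⟨-, i, hi⟩ := hout k0 hk0
      refine ⟨i, fun k hk => ?_⟩
      rcases eq_or_ne k0 k with rfl | hkk
      · exact hi
      · rcases hS.2 k0 hk0 k hk hkk with hlt | hlt
        · exact hi.trans (by simpa using hlt i)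
        · have := hlt ⟨0, by omega⟩
          simp only [if_true] at this
          exact absurd this (hmin k hk).not_gt
  set a := f (some (i, false)) with ha
  set b := f (some (i, true)) with hb
  have hab : SignLT (fun _ => true) (X a) (X b) := by
    intro l
    have h1 := (hf (some (i, false)) l trivial).2
    have h2 := (hf (some (i, true)) l trivial).1
    have h4 : bonusCorner r (some (i, false)) l + 1 / (6 * r) ≤
        bonusCorner r (some (i, true)) l := by
      simp only [bonusCorner]
      split_ifs <;> linarith
    have := mul_le_mul_of_nonneg_left h4 hh.le
    simp only [if_true]
    linarith
  have hbS : ∀ k ∈ S, SignLT (fun _ => true) (X b) (X (j.succAbove k)) := by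
    intro k hk l
    have h1 := (hf (some (i, true)) l trivial).2
    simp only [if_true]
    rcases eq_or_ne l i with rfl | hl
    · have h2 := hi k hk
      have := mul_le_mul_of_nonneg_left (bonusCorner_bounds hr (some (l, true)) l).2 hh.le
      linarith
    · have h2 := habove k hk l
      rw [hjf] at h2
      rw [hjf]
      have h3 := (hf none l trivial).1
      have h4 : bonusCorner r (some (i, true)) l + 1 / (6 * r) ≤ bonusCorner r none l := by
        simp only [bonusCorner, if_neg hl]
        linarith
      have := mul_le_mul_of_nonneg_left h4 hh.le
      linarith
  have htrans : ∀ x y z : Fin r → ℝ, SignLT (fun _ => true) x y → SignLT (fun _ => true) y z →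
      SignLT (fun _ => true) x z := fun x y z h1 h2 l => by
    have h1 := h1 l
    have h2 := h2 l
    simp only [if_true] at h1 h2 ⊢
    exact h1.trans h2
  have hirr : ∀ x : Fin r → ℝ, ¬ SignLT (fun _ => true) x x := fun x h1 => by
    simpa using h1 ⟨0, by omega⟩
  have hc1 : IsIndexClique Set.univ (SignComparable fun _ => true) X
      (insert a (insert b (S.map j.succAboveEmb))) := by
    refine ⟨fun _ _ => trivial, ?_⟩
    simp only [mem_insert, Finset.mem_map, Fin.coe_succAboveEmb]
    rintro x (rfl | rfl | ⟨k, hk, rfl⟩) y (rfl | rfl | ⟨l, hl, rfl⟩) hxy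
    · exact absurd rfl hxy
    · exact Or.inl hab
    · exact Or.inl (htrans _ _ _ hab (hbS l hl))
    · exact Or.inr hab
    · exact absurd rfl hxy
    · exact Or.inl (hbS l hl)
    · exact Or.inr (htrans _ _ _ hab (hbS k hk))
    · exact Or.inr (hbS k hk)
    · exact hS.2 k hk l hl fun h => hxy (h ▸ rfl)
  have hbm : b ∉ S.map j.succAboveEmb := by
    simp only [Finset.mem_map, Fin.coe_succAboveEmb, not_exists, not_and]
    intro k hk hkb
    exact hirr (X b) (by simpa only [hkb] using hbS k hk)
  have ham : a ∉ insert b (S.map j.succAboveEmb) := by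
    simp only [mem_insert, Finset.mem_map, Fin.coe_succAboveEmb, not_or, not_exists, not_and]
    refine ⟨fun hh' => hirr (X b) (by simpa only [hh'] using hab), fun k hk hkb => ?_⟩
    exact hirr (X a) (by simpa only [hkb] using htrans _ _ _ hab (hbS k hk))
  have := hc1.card_le
  rw [card_insert_of_notMem ham, card_insert_of_notMem hbm, card_map] at this
  omega

theorem measurableSet_bonusOutside (r : ℕ) (h : ℝ) : MeasurableSet (bonusOutside r h) := by
  have e : bonusOutside r h = (⋂ i, {y : Fin r → ℝ | 0 < y i}) ∩
      ⋃ i, {y : Fin r → ℝ | 2 * r * h < y i} := by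
    ext y
    simp [bonusOutside]
  rw [e]
  exact (MeasurableSet.iInter fun i => measurableSet_lt measurable_const (by fun_prop)).inter
    (MeasurableSet.iUnion fun i => measurableSet_lt measurable_const (by fun_prop))

theorem cubeMeasure_bonusOutside_ge (r : ℕ) {h : ℝ} (hh : 0 ≤ h) :
    1 - (2 * r * h) ^ r ≤ (cubeMeasure r).real (bonusOutside r h) := by
  set T : Set (Fin r → ℝ) := Set.univ.pi fun _ => Set.Iic (2 * r * h) with hT
  have hTm : MeasurableSet T := MeasurableSet.univ_pi fun _ => measurableSet_Iic
  have h0 : 0 ≤ 2 * r * h := by positivity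
  have h1 : (cubeMeasure r).real T ≤ (2 * r * h) ^ r := by
    have hU : unitMeasure.real (Set.Iic (2 * r * h)) ≤ 2 * r * h := by
      rw [measureReal_def]
      refine ENNReal.toReal_le_of_le_ofReal h0 ?_
      rw [unitMeasure, Measure.restrict_apply measurableSet_Iic]
      calc volume (Set.Iic (2 * r * h) ∩ Set.Ioo 0 1) ≤ volume (Set.Ioc 0 (2 * r * h)) :=
            measure_mono fun x hx => ⟨hx.2.1, hx.1⟩
        _ = ENNReal.ofReal (2 * r * h) := by simp
    rw [measureReal_def, cubeMeasure, hT, Measure.pi_pi, ENNReal.toReal_prod]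
    refine (prod_le_prod (fun _ _ => ENNReal.toReal_nonneg) fun i _ => hU).trans ?_
    simp
  have h2 : (cubeMeasure r).real Tᶜ = 1 - (cubeMeasure r).real T := probReal_compl_eq_one_sub hTm
  have h3 : (cubeMeasure r).real Tᶜ ≤ (cubeMeasure r).real (bonusOutside r h) := by
    refine ENNReal.toReal_mono (measure_ne_top _ _) (measure_mono_ae ?_)
    filter_upwards [cubeMeasure_ae_mem r] with x hx hxT
    refine ⟨fun i => (hx i).1, ?_⟩
    by_contra! hcon
    exact hxT fun i _ => hcon i
  linarith

theorem cubeMeasure_bonusCell {r : ℕ} (hr : 2 ≤ r) {h : ℝ} (hh : 0 < h) (hh1 : 2 * r * h ≤ 1)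
    (c : Option (Fin r × Bool)) :
    (cubeMeasure r).real (bonusCell r h c) = (h * (1 / (6 * r))) ^ r := by
  rw [measureReal_def, bonusCell, cubeMeasure_box, ENNReal.toReal_prod]
  · have : ∀ i,
        (ENNReal.ofReal (h * (bonusCorner r c i + 1 / (6 * r)) - h * bonusCorner r c i)).toReal
        = h * (1 / (6 * r)) := fun i => by
      rw [ENNReal.toReal_ofReal] <;> rw [← mul_sub, add_sub_cancel_left]
      positivity
    simp_rw [this]
    simp
  · intro i
    have := (bonusCorner_bounds hr c i).1
    exact mul_nonneg hh.le (by linarith)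
  · intro i
    have := mul_le_mul_of_nonneg_left (bonusCorner_bounds hr c i).2 hh.le
    linarith

theorem exists_bonus_event {r : ℕ} (hr : 2 ≤ r) : ∃ p : ℝ, 0 < p ∧ ∃ N₀ : ℕ, ∀ n ≥ N₀,
    ∃ G : Set (Fin (n + 1) → Fin r → ℝ), MeasurableSet G ∧
      p ≤ (Measure.pi fun _ : Fin (n + 1) => cubeMeasure r).real G ∧
      ∀ X ∈ G, ∀ j, IsSumMin j X →
        2 + cliqueNum (boxAbove (X j)) (SignComparable fun _ => true)
          (fun k => X (j.succAbove k)) ≤ cliqueNum Set.univ (SignComparable fun _ => true) X := by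
  have hr0 : (0 : ℝ) < r := by positivity
  set m := Fintype.card (Option (Fin r × Bool)) with hm
  set e : ℝ := 1 / (6 * r) with he
  have he0 : 0 < e := by positivity
  refine ⟨(e ^ r / 2) ^ m * Real.exp (-(2 * (2 * r : ℝ) ^ r)), by positivity,
    max (2 * m) ⌈2 * (2 * r : ℝ) ^ r⌉₊, fun n hn => ?_⟩
  have hn1 : 2 * m ≤ n := (le_max_left _ _).trans hn
  have hn2 : 2 * (2 * r : ℝ) ^ r ≤ n :=
    (Nat.le_ceil _).trans (Nat.cast_le.2 ((le_max_right _ _).trans hn))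
  set N : ℝ := ((n + 1 : ℕ) : ℝ) with hN
  have hNn : N = n + 1 := by simp [hN]
  have hN0 : 0 < N := by rw [hNn]; positivity
  set h : ℝ := N ^ (-1 / (r : ℝ)) with hh
  have hh0 : 0 < h := Real.rpow_pos_of_pos hN0 _
  have hhr : h ^ r = 1 / N := by
    rw [hh, ← Real.rpow_natCast, ← Real.rpow_mul hN0.le, div_mul_cancel₀ _ hr0.ne',
      Real.rpow_neg_one, one_div]
  have hV : (2 * r * h) ^ r = (2 * r : ℝ) ^ r / N := by
    rw [mul_pow, hhr, mul_one_div]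
  have hV1 : (2 * r : ℝ) ^ r / N ≤ 1 / 2 := by
    rw [div_le_iff₀ hN0]
    linarith
  have hh1 : 2 * r * h ≤ 1 := by
    by_contra! hc
    have := one_lt_pow₀ hc (by omega : r ≠ 0)
    rw [hV] at this
    linarith
  obtain ⟨hG, hp⟩ := le_pi_real_exists_embedding (cubeMeasure r) (A := bonusCell r h)
    (O := bonusOutside r h) (fun c => measurableSet_box _ _) (measurableSet_bonusOutside r h)
    (fun c d hcd => disjoint_bonusCell hr hh0 c d hcd)
    (disjoint_bonusCell_outside hr hh0) (v := (h * e) ^ r) (q := 1 - (2 * r * h) ^ r)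
    (by positivity) (by rw [hV]; linarith)
    (fun c => (cubeMeasure_bonusCell hr hh0 hh1 c).ge) (cubeMeasure_bonusOutside_ge r hh0.le)
    (n + 1)
  refine ⟨_, hG, le_trans ?_ hp, fun X hX j hj => ?_⟩
  · have h1 : (N / 2) ^ m ≤ ((n + 1).descFactorial m : ℝ) := by
      have h2 : ((n + 1 + 1 - m : ℕ) : ℝ) ^ m ≤ ((n + 1).descFactorial m : ℝ) := by
        exact_mod_cast Nat.pow_sub_le_descFactorial (n + 1) m
      refine (pow_le_pow_left₀ (by positivity) ?_ m).trans h2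
      rw [Nat.cast_sub (by omega)]
      have : (2 : ℝ) * m ≤ n := by exact_mod_cast hn1
      rw [hNn]
      push_cast
      linarith
    have h3 : Real.exp (-(2 * (2 * r : ℝ) ^ r)) ≤ (1 - (2 * r * h) ^ r) ^ (n + 1) := by
      set V := (2 * r : ℝ) ^ r / N with hVd
      have hV0 : 0 ≤ V := by positivity
      have h4 : Real.exp (-(2 * V)) ≤ 1 - V := by
        have := Real.add_one_le_exp (2 * V)
        rw [Real.exp_neg]
        refine inv_le_of_inv_le₀ (by linarith) (le_trans ?_ this)
        rw [inv_le_iff_one_le_mul₀ (by linarith)]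
        nlinarith
      rw [hV]
      refine le_trans (le_of_eq ?_) (pow_le_pow_left₀ (Real.exp_pos _).le h4 (n + 1))
      rw [← Real.exp_nat_mul, ← hN, hVd]
      congr 1
      field_simp
    calc (e ^ r / 2) ^ m * Real.exp (-(2 * (2 * r : ℝ) ^ r))
        = (N / 2) ^ m * (((h * e) ^ r) ^ m * Real.exp (-(2 * (2 * r : ℝ) ^ r))) := by
          rw [← mul_assoc, ← mul_pow, mul_pow h, hhr]
          congr 2
          field_simp
      _ ≤ _ := by
          refine mul_le_mul h1 (mul_le_mul_of_nonneg_left h3 (by positivity)) (by positivity)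
            (by positivity)
  · obtain ⟨f, hf, hO⟩ := hX
    exact two_add_cliqueNum_boxAbove_le hr hh0 hf hO hj

theorem tendsto_natCast_rpow_neg {s : ℝ} (hs : s < 0) :
    Tendsto (fun n : ℕ => (n : ℝ) ^ s) atTop (𝓝 0) := by
  have := (tendsto_rpow_neg_atTop (y := -s) (by linarith)).comp tendsto_natCast_atTop_atTop
  simpa [Function.comp_def] using this

theorem lt_chainConstant {r : ℕ} (hr : 2 ≤ r) :
    (r : ℝ) / ((r.factorial : ℝ) ^ (1 / (r : ℝ)) * Real.Gamma (1 / (r : ℝ) + 1)) <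
      chainConstant r := by
  have hr0 : 0 < r := by omega
  have hr' : (2 : ℝ) ≤ r := by exact_mod_cast hr
  obtain ⟨p, hp, N₁, hG⟩ := exists_bonus_event hr
  set s : ℝ := 1 / (r : ℝ) with hs
  have hs0 : 0 < s := by positivity
  have hs1 : s ≤ 1 / 2 := one_div_le_one_div_of_le (by norm_num) hr'
  have hΓ : 0 < Real.Gamma (s + 1) := Real.Gamma_pos_of_pos (by linarith)
  have hf0 : (0 : ℝ) < r.factorial := by exact_mod_cast r.factorial_pos
  set α : ℝ := (r : ℝ) / ((r.factorial : ℝ) ^ s * Real.Gamma (s + 1)) with hα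
  have hα0 : 0 < α := by positivity
  set a : ℝ := (1 + p / 2) * α with ha
  have ha0 : 0 < a := by positivity
  set Q : ℝ := (r.factorial : ℝ) ^ (2 * s) * Real.Gamma (1 / ((r : ℝ) / 2) + 1) with hQ
  have hQ0 : 0 < Q := by
    have : 0 < Real.Gamma (1 / ((r : ℝ) / 2) + 1) := Real.Gamma_pos_of_pos (by positivity)
    positivity
  have hlim : Tendsto (fun n : ℕ => a * 5 * (n : ℝ) ^ (s - 1) + a * 4 * Q * (n : ℝ) ^ (-s))
      atTop (𝓝 0) := by
    have h1 := (tendsto_natCast_rpow_neg (s := s - 1) (by linarith)).const_mul (a * 5)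
    have h2 := (tendsto_natCast_rpow_neg (s := -s) (by linarith)).const_mul (a * 4 * Q)
    simpa using h1.add h2
  obtain ⟨N₂, hN₂⟩ := eventually_atTop.1 (hlim.eventually (gt_mem_nhds (half_pos hp)))
  set N₀ := max (max N₁ N₂) 1 with hN₀
  set C : ℝ := a * (N₀ : ℝ) ^ s with hC
  have hstep : ∀ n ≥ N₀, (∀ k ≤ n, a * (k : ℝ) ^ s - C ≤ meanChain r k) →
      a * ((n + 1 : ℕ) : ℝ) ^ s - C ≤ meanChain r (n + 1) := by
    intro n hn hk
    have hnN₁ : N₁ ≤ n := ((le_max_left _ _).trans (le_max_left _ _)).trans hn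
    have hnN₂ : N₂ ≤ n := ((le_max_right _ _).trans (le_max_left _ _)).trans hn
    have hn1 : 1 ≤ n := (le_max_right _ _).trans hn
    have hn0 : (0 : ℝ) < n := by exact_mod_cast hn1
    obtain ⟨G, hGm, hGp, hGb⟩ := hG n hnN₁
    have hmain := meanChain_succ_ge hr0 hn1 ha0.le hk hGm hGb
    have hsmall := hN₂ n hnN₂
    set I1 := ∫ X, minClipSum X ∂Measure.pi (fun _ : Fin (n + 1) => cubeMeasure r)
    set I2 := ∫ X, minClipSum X ^ 2 ∂Measure.pi (fun _ : Fin (n + 1) => cubeMeasure r)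
    have hI1 : I1 ≤ (n : ℝ) ^ (-s) * ((r.factorial : ℝ) ^ s * Real.Gamma (s + 1)) := by
      refine (integral_minClipSum_le hr0).trans ?_
      rw [← mul_assoc]
      refine mul_le_mul_of_nonneg_right ?_ hΓ.le
      rw [neg_div, ← hs, Real.div_rpow (by positivity) hf0.le, Real.rpow_neg hf0.le, div_inv_eq_mul]
      refine mul_le_mul_of_nonneg_right ?_ (by positivity)
      exact Real.rpow_le_rpow_of_nonpos hn0 (by linarith) (by linarith)
    have hI2 : I2 ≤ (n : ℝ) ^ (-(2 * s)) * Q := by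
      refine (integral_minClipSum_sq_le hr0).trans ?_
      rw [hQ, ← mul_assoc]
      refine mul_le_mul_of_nonneg_right ?_ (Real.Gamma_pos_of_pos (by positivity)).le
      have e : -1 / ((r : ℝ) / 2) = -(2 * s) := by rw [hs]; field_simp
      rw [e, Real.div_rpow (by positivity) hf0.le, Real.rpow_neg hf0.le, div_inv_eq_mul]
      refine mul_le_mul_of_nonneg_right ?_ (by positivity)
      exact Real.rpow_le_rpow_of_nonpos hn0 (by linarith) (by linarith)
    have h1 : a * (n : ℝ) ^ s * (s * I1) ≤ 1 + p / 2 := by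
      calc a * (n : ℝ) ^ s * (s * I1)
          ≤ a * (n : ℝ) ^ s * (s * ((n : ℝ) ^ (-s) *
            ((r.factorial : ℝ) ^ s * Real.Gamma (s + 1)))) := by gcongr
        _ = (n : ℝ) ^ s * (n : ℝ) ^ (-s) * (1 + p / 2) := by
            rw [ha, hα, hs]
            field_simp
        _ = 1 + p / 2 := by
            rw [← Real.rpow_add hn0, add_neg_cancel, Real.rpow_zero, one_mul]
    have h2 : a * (n : ℝ) ^ s * (4 * I2) ≤ a * 4 * Q * (n : ℝ) ^ (-s) := by
      calc a * (n : ℝ) ^ s * (4 * I2) ≤ a * (n : ℝ) ^ s * (4 * ((n : ℝ) ^ (-(2 * s)) * Q)) := by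
            gcongr
        _ = a * 4 * Q * ((n : ℝ) ^ s * (n : ℝ) ^ (-(2 * s))) := by ring
        _ = a * 4 * Q * (n : ℝ) ^ (-s) := by
            rw [← Real.rpow_add hn0]
            ring_nf
    have e3 : (n : ℝ) ^ (s - 1) = (n : ℝ) ^ s / n := Real.rpow_sub_one hn0.ne' s
    have h4 : ((n + 1 : ℕ) : ℝ) ^ s ≤ (n : ℝ) ^ s + (n : ℝ) ^ (s - 1) := by
      have e4 : ((n + 1 : ℕ) : ℝ) = n * (1 + 1 / n) := by
        push_cast
        field_simp
      rw [e4, Real.mul_rpow hn0.le (by positivity), e3]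
      have : (1 + 1 / (n : ℝ)) ^ s ≤ 1 + 1 / n := by
        have h5 : (1 : ℝ) ≤ 1 + 1 / n := by
          have : (0 : ℝ) ≤ 1 / n := by positivity
          linarith
        calc (1 + 1 / (n : ℝ)) ^ s ≤ (1 + 1 / (n : ℝ)) ^ (1 : ℝ) :=
              Real.rpow_le_rpow_of_exponent_le h5 (by linarith)
          _ = _ := Real.rpow_one _
      calc (n : ℝ) ^ s * (1 + 1 / (n : ℝ)) ^ s ≤ (n : ℝ) ^ s * (1 + 1 / n) := by gcongr
        _ = _ := by ring
    have h5 := mul_le_mul_of_nonneg_left h4 ha0.le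
    have e5 : 1 + a * (n : ℝ) ^ s * (1 - s * I1 - 4 * I2 - 4 / n) - C =
        1 + a * (n : ℝ) ^ s - a * (n : ℝ) ^ s * (s * I1) - a * (n : ℝ) ^ s * (4 * I2) -
          a * 4 * (n : ℝ) ^ (s - 1) - C := by
      rw [e3]
      ring
    rw [e5] at hmain
    linarith
  have hall : ∀ n : ℕ, ∀ k ≤ n, a * (k : ℝ) ^ s - C ≤ meanChain r k := by
    have hbase : ∀ k : ℕ, k ≤ N₀ → a * (k : ℝ) ^ s - C ≤ meanChain r k := fun k hk => by
      have : a * (k : ℝ) ^ s ≤ C :=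
        mul_le_mul_of_nonneg_left (Real.rpow_le_rpow (by positivity) (by exact_mod_cast hk) hs0.le)
          ha0.le
      linarith [meanChain_nonneg r k]
    intro n
    induction n with
    | zero => exact fun k hk => hbase k (hk.trans (Nat.zero_le _))
    | succ n ih =>
      intro k hk
      rcases Nat.lt_or_ge N₀ k with h | h
      · rcases Nat.lt_or_ge n k with h' | h'
        · obtain rfl : k = n + 1 := by omega
          exact hstep n (by omega) ih
        · exact ih k h'
      · exact hbase k h
  have hle : a ≤ chainConstant r := by
    have hl : Tendsto (fun n : ℕ => a - C * (n : ℝ) ^ (-s)) atTop (𝓝 a) := by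
      simpa using ((tendsto_natCast_rpow_neg (s := -s) (by linarith)).const_mul C).const_sub a
    refine le_of_tendsto_of_tendsto hl (tendsto_meanChain hr0) ?_
    filter_upwards [eventually_ge_atTop 1] with n hn
    have hn0 : (0 : ℝ) < n := by exact_mod_cast hn
    have hpos : (0 : ℝ) < (n : ℝ) ^ s := Real.rpow_pos_of_pos hn0 _
    rw [le_div_iff₀ hpos, sub_mul, mul_assoc C, ← Real.rpow_add hn0]
    simpa using hall n n le_rfl
  refine lt_of_lt_of_le ?_ hle
  rw [ha]
  nlinarith

section CountLimits

variable {α : Type*} [MeasurableSpace α]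

theorem eventually_mul_le_integral_countIn (ν : Measure α) [IsProbabilityMeasure ν] {B : Set α}
    (hB : MeasurableSet B) (hB0 : 0 < ν.real B) {F : ℕ → ℝ} (hF : Monotone F)
    (hF0 : ∀ k, 0 ≤ F k) {δ : ℝ} (hδ : 0 < δ) (hδ1 : δ < 1) :
    ∀ᶠ n : ℕ in atTop, F ⌊(1 - δ) * (n * ν.real B)⌋₊ * (1 - δ) ≤
      ∫ X, F (countIn B X) ∂Measure.pi (fun _ : Fin n => ν) := by
  have h1 : Tendsto (fun n : ℕ => (n : ℝ) * ν.real B) atTop atTop :=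
    tendsto_natCast_atTop_atTop.atTop_mul_const hB0
  filter_upwards [h1.eventually_ge_atTop (1 / δ ^ 3)] with n hn
  set l := (n : ℝ) * ν.real B with hl
  have hl0 : 0 < l := lt_of_lt_of_le (by positivity) hn
  have hm : (⌊(1 - δ) * l⌋₊ : ℝ) ≤ (1 - δ) * l := Nat.floor_le (by nlinarith)
  have hml : δ * l ≤ l - ⌊(1 - δ) * l⌋₊ := by linarith
  have hδl : 0 < δ * l := by positivity
  refine le_trans (mul_le_mul_of_nonneg_left ?_ (hF0 _))
    (le_integral_countIn ν hB n ⌊(1 - δ) * l⌋₊ hF hF0 (by linarith))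
  have h2 : l / (l - ⌊(1 - δ) * l⌋₊) ^ 2 ≤ l / (δ * l) ^ 2 := by gcongr
  have h3 : l / (δ * l) ^ 2 ≤ δ := by
    rw [div_le_iff₀ (by positivity)]
    rw [div_le_iff₀ (by positivity)] at hn
    nlinarith
  linarith

theorem eventually_le_integral_countIn (ν : Measure α) [IsProbabilityMeasure ν] {B : Set α}
    (hB : MeasurableSet B) (hB0 : 0 < ν.real B) {F : ℕ → ℝ} (hF : Monotone F)
    (hF0 : ∀ k, 0 ≤ F k) {s c : ℝ} (hs : 0 < s)
    (hc : Tendsto (fun n : ℕ => F n / (n : ℝ) ^ s) atTop (𝓝 c)) {a : ℝ}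
    (ha : a < c * ν.real B ^ s) :
    ∀ᶠ n : ℕ in atTop, a * (n : ℝ) ^ s ≤
      ∫ X, F (countIn B X) ∂Measure.pi (fun _ : Fin n => ν) := by
  have hcont : Tendsto (fun δ : ℝ => (c - δ) * ((1 - 2 * δ) * ν.real B) ^ s * (1 - δ)) (𝓝 0)
      (𝓝 (c * ν.real B ^ s)) := by
    have : ContinuousAt (fun δ : ℝ => (c - δ) * ((1 - 2 * δ) * ν.real B) ^ s * (1 - δ)) 0 := by
      refine ((continuousAt_const.sub continuousAt_id).mul
        (ContinuousAt.rpow_const (by fun_prop) (Or.inr hs.le))).mul (by fun_prop)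
    have h := this.tendsto
    simpa using h
  have hev := (hcont.mono_left (nhdsWithin_le_nhds (s := Set.Ioi 0))).eventually (lt_mem_nhds ha)
  obtain ⟨δ, hδa, hδ0, hδ1⟩ := (hev.and (Ioo_mem_nhdsGT (show (0 : ℝ) < 1 / 2 by norm_num))).exists
  have h1 : Tendsto (fun n : ℕ => (n : ℝ) * ν.real B) atTop atTop :=
    tendsto_natCast_atTop_atTop.atTop_mul_const hB0
  have h2 : Tendsto (fun n : ℕ => ⌊(1 - δ) * (n * ν.real B)⌋₊) atTop atTop :=
    tendsto_nat_floor_atTop.comp (h1.const_mul_atTop (by linarith))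
  have h3 := h2.eventually (hc.eventually (lt_mem_nhds (show c - δ < c by linarith)))
  filter_upwards [eventually_mul_le_integral_countIn ν hB hB0 hF hF0 hδ0 (by linarith : δ < 1), h3,
    h1.eventually_ge_atTop (1 / δ), h2.eventually_ge_atTop 1] with n hn hn3 hnδ hm1
  refine le_trans ?_ hn
  set l := (n : ℝ) * ν.real B with hl
  set m := ⌊(1 - δ) * l⌋₊ with hm
  have hl0 : 0 < l := lt_of_lt_of_le (by positivity) hnδ
  have hm0 : (0 : ℝ) < m := by exact_mod_cast hm1
  have hml : (1 - 2 * δ) * l ≤ m := by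
    have := Nat.sub_one_lt_floor ((1 - δ) * l)
    rw [div_le_iff₀ hδ0] at hnδ
    linarith
  rw [lt_div_iff₀ (Real.rpow_pos_of_pos hm0 _)] at hn3
  have e : ((1 - 2 * δ) * ν.real B) ^ s * (n : ℝ) ^ s = ((1 - 2 * δ) * l) ^ s := by
    rw [← Real.mul_rpow (mul_nonneg (by linarith) hB0.le) (Nat.cast_nonneg _), hl]
    ring_nf
  have hns : (0 : ℝ) ≤ (n : ℝ) ^ s := by positivity
  have hmono : ((1 - 2 * δ) * l) ^ s ≤ (m : ℝ) ^ s :=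
    Real.rpow_le_rpow (mul_nonneg (by linarith) hl0.le) hml hs.le
  rcases le_or_gt 0 (c - δ) with hcd | hcd
  · calc a * (n : ℝ) ^ s ≤ (c - δ) * ((1 - 2 * δ) * ν.real B) ^ s * (1 - δ) * (n : ℝ) ^ s := by
          gcongr
      _ = (c - δ) * ((1 - 2 * δ) * l) ^ s * (1 - δ) := by rw [← e]; ring
      _ ≤ (c - δ) * (m : ℝ) ^ s * (1 - δ) := by
          have : (0 : ℝ) ≤ 1 - δ := by linarith
          gcongr
      _ ≤ F m * (1 - δ) := mul_le_mul_of_nonneg_right hn3.le (by linarith)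
  · have h4 : a ≤ 0 := by
      refine hδa.le.trans ?_
      have : (0 : ℝ) ≤ ((1 - 2 * δ) * ν.real B) ^ s :=
        Real.rpow_nonneg (mul_nonneg (by linarith) hB0.le) _
      have := mul_nonpos_of_nonpos_of_nonneg hcd.le this
      exact mul_nonpos_of_nonpos_of_nonneg this (by linarith)
    exact (mul_nonpos_of_nonpos_of_nonneg h4 hns).trans
      (mul_nonneg (hF0 _) (by linarith))

theorem eventually_le_of_integral_countIn_le (ν : Measure α) [IsProbabilityMeasure ν] {B : Set α}
    (hB : MeasurableSet B) (hB0 : 0 < ν.real B) {F : ℕ → ℝ} (hF : Monotone F)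
    (hF0 : ∀ k, 0 ≤ F k) {s d : ℝ} (hs : 0 < s) (hd0 : 0 ≤ d)
    (hd : ∀ d' > d, ∀ᶠ n : ℕ in atTop,
      ∫ X, F (countIn B X) ∂Measure.pi (fun _ : Fin n => ν) ≤ d' * (n : ℝ) ^ s) {a : ℝ}
    (ha : d * (ν.real B)⁻¹ ^ s < a) :
    ∀ᶠ n : ℕ in atTop, F n ≤ a * (n : ℝ) ^ s := by
  have hcont : Tendsto (fun δ : ℝ => (d + δ) * ((1 - 2 * δ)⁻¹ * (ν.real B)⁻¹) ^ s * (1 - δ)⁻¹)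
      (𝓝 0) (𝓝 (d * (ν.real B)⁻¹ ^ s)) := by
    have : ContinuousAt (fun δ : ℝ => (d + δ) * ((1 - 2 * δ)⁻¹ * (ν.real B)⁻¹) ^ s *
        (1 - δ)⁻¹) 0 := by
      refine ((continuousAt_const.add continuousAt_id).mul
        (ContinuousAt.rpow_const (ContinuousAt.mul (ContinuousAt.inv₀ (by fun_prop) (by norm_num))
          continuousAt_const) (Or.inr hs.le))).mul (ContinuousAt.inv₀ (by fun_prop) (by norm_num))
    have h := this.tendsto
    simpa using h
  have hev := (hcont.mono_left (nhdsWithin_le_nhds (s := Set.Ioi 0))).eventually (gt_mem_nhds ha)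
  obtain ⟨δ, hδa, hδ0, hδ1⟩ := (hev.and (Ioo_mem_nhdsGT (show (0 : ℝ) < 1 / 2 by norm_num))).exists
  set p := ν.real B with hp
  set u : ℝ := (1 - δ) * p with hu
  have hu0 : 0 < u := mul_pos (by linarith) hB0
  set v : ℝ := (1 - 2 * δ) * p with hv
  have hv0 : 0 < v := mul_pos (by linarith) hB0
  have hvu : v < u := mul_lt_mul_of_pos_right (by linarith) hB0
  set N : ℕ → ℕ := fun m => ⌈(m : ℝ) / u⌉₊ with hN
  have hNt : Tendsto N atTop atTop :=
    tendsto_nat_ceil_atTop.comp (tendsto_natCast_atTop_atTop.atTop_div_const hu0)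
  have hlin : Tendsto (fun m : ℕ => (m : ℝ) * (v⁻¹ - u⁻¹)) atTop atTop :=
    tendsto_natCast_atTop_atTop.atTop_mul_const (sub_pos.2 (inv_strictAnti₀ hv0 hvu))
  filter_upwards [hNt.eventually (eventually_mul_le_integral_countIn ν hB hB0 hF hF0 hδ0
    (by linarith : δ < 1)), hNt.eventually (hd (d + δ) (by linarith)),
    hlin.eventually_ge_atTop 1] with m h1 h2 h3
  have hmN : m ≤ ⌊(1 - δ) * (N m * p)⌋₊ := by
    refine Nat.le_floor ?_
    have := Nat.le_ceil ((m : ℝ) / u)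
    rw [div_le_iff₀ hu0] at this
    calc (m : ℝ) ≤ N m * u := this
      _ = _ := by rw [hu]; ring
  have hNm : (N m : ℝ) ≤ m * v⁻¹ := by
    have := (Nat.ceil_lt_add_one (show 0 ≤ (m : ℝ) / u by positivity)).le
    rw [div_eq_mul_inv] at this
    have h4 : (N m : ℝ) ≤ m * u⁻¹ + 1 := by
      simp only [hN, div_eq_mul_inv]
      exact this
    linarith
  have h5 : F m * (1 - δ) ≤ (d + δ) * (N m : ℝ) ^ s :=
    ((mul_le_mul_of_nonneg_right (hF hmN) (by linarith)).trans h1).trans h2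
  have hms : (0 : ℝ) ≤ (m : ℝ) ^ s := by positivity
  have h : 0 ≤ d + δ := by linarith
  have h6 : (N m : ℝ) ^ s ≤ (m : ℝ) ^ s * v⁻¹ ^ s := by
    rw [← Real.mul_rpow (by positivity) (by positivity)]
    exact Real.rpow_le_rpow (by positivity) hNm hs.le
  have hδ' : (0 : ℝ) < 1 - δ := by linarith
  have h7 : F m ≤ ((d + δ) * ((m : ℝ) ^ s * v⁻¹ ^ s)) * (1 - δ)⁻¹ := by
    rw [← div_eq_mul_inv, le_div_iff₀ hδ']
    exact h5.trans (mul_le_mul_of_nonneg_left h6 h)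
  refine h7.trans ?_
  have e : v⁻¹ = (1 - 2 * δ)⁻¹ * p⁻¹ := by rw [hv, mul_inv]
  rw [e]
  calc _ = ((d + δ) * ((1 - 2 * δ)⁻¹ * p⁻¹) ^ s * (1 - δ)⁻¹) * (m : ℝ) ^ s := by ring
    _ ≤ _ := mul_le_mul_of_nonneg_right hδa.le hms

end CountLimits

/-- The set of strictly increasing vectors. -/
def chamber (r : ℕ) : Set (Fin r → ℝ) := {x | StrictMono x}

/-- Two vectors form an `r`-partite pattern with sign vector `ε`: they interleave blockwise and
are comparable for `SignLT ε`. -/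
def PartiteRel {r : ℕ} (ε : Fin r → Bool) (x y : Fin r → ℝ) : Prop :=
  SignComparable ε x y ∧ ∀ i j, i < j → x i < y j ∧ y i < x j

theorem measurableSet_partiteRel {r : ℕ} (ε : Fin r → Bool) :
    MeasurableSet {p : (Fin r → ℝ) × (Fin r → ℝ) | PartiteRel ε p.1 p.2} := by
  refine (measurableSet_signComparable ε).inter ?_
  have : {p : (Fin r → ℝ) × (Fin r → ℝ) | ∀ i j, i < j → p.1 i < p.2 j ∧ p.2 i < p.1 j} =
      ⋂ i, ⋂ j, ⋂ _ : i < j, {p | p.1 i < p.2 j} ∩ {p | p.2 i < p.1 j} := by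
    ext p
    simp
  change MeasurableSet {p : (Fin r → ℝ) × (Fin r → ℝ) |
    ∀ i j, i < j → p.1 i < p.2 j ∧ p.2 i < p.1 j}
  rw [this]
  exact MeasurableSet.iInter fun i => MeasurableSet.iInter fun j =>
    MeasurableSet.iInter fun _ => (measurableSet_lt (by fun_prop) (by fun_prop)).inter
      (measurableSet_lt (by fun_prop) (by fun_prop))

theorem cubeMeasure_chamber_le (r : ℕ) : (cubeMeasure r).real (chamber r) ≤ 1 / r.factorial := by
  have h := pi_strictMono_comp_le unitMeasure MeasurableSet.univ (Equiv.refl (Fin r))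
  have e : {x : Fin r → ℝ | StrictMono (x ∘ Equiv.refl (Fin r)) ∧ ∀ j, x j ∈ Set.univ} =
      chamber r := by
    ext x
    simp [chamber]
  rw [e, measure_univ, one_pow] at h
  refine (ENNReal.toReal_mono (by simp [Nat.factorial_ne_zero]) h).trans (le_of_eq ?_)
  simp

/-- The open box delimited by cuts at multiples of `1 / K`, enlarged by `1 / K` on the right. -/
def cutBox {r : ℕ} (K : ℕ) (T : Fin (r + 1) → Fin K) : Set (Fin r → ℝ) :=
  Set.univ.pi fun i => Set.Ioo ((T i.castSucc : ℝ) / K) (((T i.succ : ℝ) + 1) / K)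

theorem exists_cliqueNum_le_cutBox {r K : ℕ} (hr : 0 < r) (hK : 0 < K) (ε : Fin r → Bool)
    {ι : Type*} [Fintype ι] {X : ι → Fin r → ℝ} (hX : ∀ j i, X j i ∈ Set.Ioo (0 : ℝ) 1) :
    ∃ T : Fin (r + 1) → Fin K, cliqueNum (chamber r) (PartiteRel ε) X ≤
      cliqueNum (cutBox K T) (SignComparable ε) X := by
  obtain ⟨S, hS, e⟩ := exists_isIndexClique (chamber r) (PartiteRel ε) X
  have hK' : (0 : ℝ) < K := by exact_mod_cast hK
  rcases S.eq_empty_or_nonempty with rfl | hne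
  · refine ⟨fun _ => ⟨0, hK⟩, ?_⟩
    rw [← e]
    simp
  set M : Fin r → ℝ := fun i => S.sup' hne fun j => X j i with hM
  have hMmem : ∀ i, ∃ k ∈ S, M i = X k i := fun i => exists_mem_eq_sup' hne _
  have hMle : ∀ i, ∀ j ∈ S, X j i ≤ M i := fun i j hj => le_sup' (fun j => X j i) hj
  have hM0 : ∀ i, 0 ≤ K * M i := fun i => by
    obtain ⟨k, -, hk⟩ := hMmem i
    rw [hk]
    exact mul_nonneg hK'.le (hX k i).1.le
  have hfl : ∀ i, ⌊K * M i⌋₊ < K := fun i => by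
    obtain ⟨k, -, hk⟩ := hMmem i
    rw [Nat.floor_lt (hM0 i), hk]
    exact mul_lt_of_lt_one_right hK' (hX k i).2
  refine ⟨Fin.cons ⟨0, hK⟩ fun i => ⟨⌊K * M i⌋₊, hfl i⟩, e ▸ IsIndexClique.card_le
    ⟨fun j hj i _ => ⟨?_, ?_⟩, fun j hj k hk hjk => (hS.2 j hj k hk hjk).1⟩⟩
  · rw [div_lt_iff₀ hK']
    obtain ⟨r, rfl⟩ : ∃ r', r = r' + 1 := ⟨r - 1, by omega⟩
    induction i using Fin.cases with
    | zero => simpa using mul_pos (hX j 0).1 hK'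
    | succ i =>
      rw [← Fin.succ_castSucc, Fin.cons_succ]
      refine (Nat.floor_le (hM0 _)).trans_lt ?_
      rw [mul_comm]
      refine mul_lt_mul_of_pos_right ?_ hK'
      obtain ⟨k, hk, hkM⟩ := hMmem i.castSucc
      rw [hkM]
      rcases eq_or_ne k j with rfl | hkj
      · exact hS.1 k hk Fin.castSucc_lt_succ
      · exact ((hS.2 k hk j hj hkj).2 _ _ Fin.castSucc_lt_succ).1
  · rw [Fin.cons_succ, lt_div_iff₀ hK']
    refine (mul_le_mul_of_nonneg_right (hMle i j hj) hK'.le).trans_lt ?_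
    rw [mul_comm]
    exact Nat.lt_floor_add_one _

theorem prod_cutBox_rpow_le {r K : ℕ} (hr : 0 < r) (hK : 0 < K) (T : Fin (r + 1) → Fin K)
    (hT : ∀ i : Fin r, (T i.castSucc : ℝ) / K ≤ ((T i.succ : ℝ) + 1) / K) :
    (∏ i : Fin r, (((T i.succ : ℝ) + 1) / K - (T i.castSucc : ℝ) / K)) ^ (1 / (r : ℝ)) ≤
      (1 + r / K) / r := by
  have hK' : (0 : ℝ) < K := by exact_mod_cast hK
  have hr' : (0 : ℝ) < r := by exact_mod_cast hr
  have hw : ∀ i : Fin r, 0 ≤ ((T i.succ : ℝ) + 1) / K - (T i.castSucc : ℝ) / K := fun i =>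
    sub_nonneg.2 (hT i)
  rw [← Real.finsetProd_rpow _ _ fun i _ => hw i]
  refine (Real.geom_mean_le_arith_mean_weighted univ (fun _ => 1 / (r : ℝ)) _
    (fun _ _ => by positivity) (by simp [hr'.ne']) fun i _ => hw i).trans ?_
  rw [← mul_sum, one_div, div_eq_inv_mul]
  refine mul_le_mul_of_nonneg_left ?_ (by positivity)
  have e1 : ∑ i : Fin r, (T i.succ : ℝ) + (T 0 : ℝ) =
      ∑ i : Fin r, (T i.castSucc : ℝ) + (T (Fin.last r) : ℝ) := by
    rw [add_comm, ← Fin.sum_univ_succ fun i => (T i : ℝ), Fin.sum_univ_castSucc]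
  have e2 : ∑ i : Fin r, (((T i.succ : ℝ) + 1) / K - (T i.castSucc : ℝ) / K) =
      (T (Fin.last r) - T 0 + r) / K := by
    simp_rw [← sub_div]
    rw [← sum_div, sum_sub_distrib, sum_add_distrib]
    simp only [sum_const, card_univ, Fintype.card_fin, nsmul_eq_mul, mul_one]
    congr 1
    linarith
  rw [e2, div_le_iff₀ hK', add_mul, div_mul_cancel₀ _ hK'.ne']
  have h1 : (T (Fin.last r) : ℝ) ≤ K := by exact_mod_cast (T (Fin.last r)).2.le
  have h2 : (0 : ℝ) ≤ T 0 := by positivity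
  linarith

theorem integral_rpow_countIn_le {α : Type*} [MeasurableSpace α] (ν : Measure α)
    [IsProbabilityMeasure ν] {B : Set α} (hB : MeasurableSet B) (n : ℕ) {p : ℝ}
    (hp : 0 ≤ p) (hp1 : p ≤ 1) :
    ∫ X, (countIn B X : ℝ) ^ p ∂Measure.pi (fun _ : Fin n => ν) ≤ (n * ν.real B) ^ p := by
  rw [← integral_countIn ν hB n]
  exact (Real.concaveOn_rpow hp hp1).le_map_integral
    (continuousOn_id.rpow_const fun x _ => Or.inr hp) isClosed_Ici
    (Eventually.of_forall fun X => Set.mem_Ici.2 (Nat.cast_nonneg _))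
    (integrable_comp_countIn hB _ fun k => (k : ℝ))
    (integrable_comp_countIn hB _ fun k => (k : ℝ) ^ p)

theorem meanClique_cutBox_le {r K : ℕ} (hr : 0 < r) (hK : 0 < K) (ε : Fin r → Bool)
    (T : Fin (r + 1) → Fin K) {d C : ℝ} (hd : 0 ≤ d) (hC : 0 ≤ C)
    (h : ∀ k, meanChain r k ≤ d * (k : ℝ) ^ (1 / (r : ℝ)) + C) (n : ℕ) :
    meanClique (cubeMeasure r) (cutBox K T) (SignComparable ε) n ≤
      d * ((1 + r / K) / r) * (n : ℝ) ^ (1 / (r : ℝ)) + C := by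
  have hK' : (0 : ℝ) < K := by exact_mod_cast hK
  have hr' : (1 : ℝ) ≤ r := by exact_mod_cast hr
  by_cases hT : ∀ i : Fin r, (T i.castSucc : ℝ) / K < ((T i.succ : ℝ) + 1) / K
  · have ha : ∀ i : Fin r, 0 ≤ (T i.castSucc : ℝ) / K := fun i => by positivity
    have hb : ∀ i : Fin r, ((T i.succ : ℝ) + 1) / K ≤ 1 := fun i => by
      rw [div_le_one hK']
      exact_mod_cast (T i.succ).2
    have hBm : MeasurableSet (cutBox K T) := measurableSet_box _ _
    have hB0 : cubeMeasure r (cutBox K T) ≠ 0 := cubeMeasure_box_ne_zero hT ha hb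
    rw [integral_cliqueNum_eq_integral_meanClique _ hBm hB0 (measurableSet_signComparable ε)]
    have e : ∀ k, meanClique ((cubeMeasure r)[|cutBox K T]) Set.univ (SignComparable ε) k =
        meanChain r k := fun k => meanClique_box_eq_meanChain ε hT ha hb k
    simp_rw [e]
    have hp : (0 : ℝ) ≤ 1 / (r : ℝ) := by positivity
    calc ∫ X, meanChain r (countIn (cutBox K T) X) ∂Measure.pi (fun _ : Fin n => cubeMeasure r)
        ≤ ∫ X, (d * (countIn (cutBox K T) X : ℝ) ^ (1 / (r : ℝ)) + C)
          ∂Measure.pi (fun _ : Fin n => cubeMeasure r) :=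
          integral_mono (integrable_comp_countIn hBm _ _)
            (integrable_comp_countIn hBm _ fun k => d * (k : ℝ) ^ (1 / (r : ℝ)) + C)
            fun X => h _
      _ = d * ∫ X, (countIn (cutBox K T) X : ℝ) ^ (1 / (r : ℝ))
          ∂Measure.pi (fun _ : Fin n => cubeMeasure r) + C := by
          rw [integral_add ((integrable_comp_countIn hBm _
            fun k => (k : ℝ) ^ (1 / (r : ℝ))).const_mul d) (integrable_const _),
            integral_const_mul]
          simp
      _ ≤ d * (n * (cubeMeasure r).real (cutBox K T)) ^ (1 / (r : ℝ)) + C := by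
          gcongr
          exact integral_rpow_countIn_le _ hBm n hp (by
            rw [div_le_one (by positivity)]
            exact hr')
      _ ≤ _ := by
          rw [Real.mul_rpow (Nat.cast_nonneg _) measureReal_nonneg, mul_assoc d,
            mul_comm ((1 + r / K) / r : ℝ)]
          gcongr
          rw [measureReal_def, cutBox, cubeMeasure_box ha hb, ENNReal.toReal_prod]
          refine le_trans (le_of_eq ?_) (prod_cutBox_rpow_le hr hK T fun i => (hT i).le)
          congr 1
          exact prod_congr rfl fun i _ => ENNReal.toReal_ofReal (sub_nonneg.2 (hT i).le)
  · push Not at hT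
    obtain ⟨i, hi⟩ := hT
    have hz : ∀ X : Fin n → Fin r → ℝ, cliqueNum (cutBox K T) (SignComparable ε) X = 0 := by
      intro X
      refine Nat.le_zero.1 (cliqueNum_le_iff.2 fun S hS => ?_)
      rw [Nat.le_zero, card_eq_zero, eq_empty_iff_forall_notMem]
      intro j hj
      have := hS.1 j hj i trivial
      exact absurd (this.1.trans this.2) hi.not_gt
    rw [meanClique]
    simp_rw [hz]
    simp only [Nat.cast_zero, integral_zero]
    positivity

theorem meanClique_chamber_le {r K : ℕ} (hr : 0 < r) (hK : 0 < K) (ε : Fin r → Bool) (n : ℕ)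
    {V : ℝ} (hV : ∀ T : Fin (r + 1) → Fin K,
      meanClique (cubeMeasure r) (cutBox K T) (SignComparable ε) n ≤ V) :
    meanClique (cubeMeasure r) (chamber r) (PartiteRel ε) n ≤
      V + Fintype.card (Fin (r + 1) → Fin K) * √V := by
  set P := Measure.pi fun _ : Fin n => cubeMeasure r with hP
  set Z : (Fin (r + 1) → Fin K) → (Fin n → Fin r → ℝ) → ℝ := fun T X =>
    (cliqueNum (cutBox K T) (SignComparable ε) X : ℝ) -
      meanClique (cubeMeasure r) (cutBox K T) (SignComparable ε) n with hZ
  have hBm : ∀ T : Fin (r + 1) → Fin K, MeasurableSet (cutBox K T) := fun T => measurableSet_box _ _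
  have hZm : ∀ T, Measurable (Z T) := fun T =>
    (measurable_cliqueNum_real (hBm T) (measurableSet_signComparable ε)).sub_const _
  have hZb : ∀ T X, |Z T X| ≤ n := fun T X => by
    have h1 : (cliqueNum (cutBox K T) (SignComparable ε) X : ℝ) ≤ n :=
      Nat.cast_le.2 ((cliqueNum_le_card _ _ _).trans (Fintype.card_fin n).le)
    have h2 := meanClique_le (cubeMeasure r) (cutBox K T) (SignComparable ε) n
    have h3 := meanClique_nonneg (cubeMeasure r) (cutBox K T) (SignComparable ε) n
    have h4 : (0 : ℝ) ≤ cliqueNum (cutBox K T) (SignComparable ε) X := Nat.cast_nonneg _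
    rw [abs_le]
    constructor <;> simp only [hZ] <;> linarith
  have hZi : ∀ T, Integrable (fun X => |Z T X|) P := fun T =>
    (integrable_of_bounded (hZm T) _ (hZb T)).abs
  have hZs : ∀ T, ∫ X, |Z T X| ∂P ≤ √V := by
    intro T
    refine Real.le_sqrt_of_sq_le ?_
    refine (integral_sq_ge P (hZm T).abs n fun X => by rw [abs_abs]; exact hZb T X).trans ?_
    simp_rw [sq_abs]
    exact (variance_cliqueNum_le _ (hBm T) (measurableSet_signComparable ε) n).trans (hV T)
  have hcube : ∀ᵐ X ∂P, ∀ j i, X j i ∈ Set.Ioo (0 : ℝ) 1 := by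
    refine ae_all_iff.2 fun j => ?_
    exact (measurePreserving_eval (fun _ : Fin n => cubeMeasure r) j).quasiMeasurePreserving.ae
      (cubeMeasure_ae_mem r)
  have hle : ∀ᵐ X ∂P, (cliqueNum (chamber r) (PartiteRel ε) X : ℝ) ≤ V + ∑ T, |Z T X| := by
    filter_upwards [hcube] with X hX
    obtain ⟨T, hT⟩ := exists_cliqueNum_le_cutBox hr hK ε hX
    have h1 : (cliqueNum (chamber r) (PartiteRel ε) X : ℝ) ≤
        cliqueNum (cutBox K T) (SignComparable ε) X := Nat.cast_le.2 hT
    have h2 : |Z T X| ≤ ∑ T, |Z T X| :=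
      single_le_sum (f := fun T => |Z T X|) (fun T _ => abs_nonneg _) (mem_univ T)
    have h3 := le_abs_self (Z T X)
    have h4 := hV T
    simp only [hZ] at h3 h2 ⊢
    linarith
  have hcm : MeasurableSet (chamber r) := measurableSet_strictMono
  calc meanClique (cubeMeasure r) (chamber r) (PartiteRel ε) n
      ≤ ∫ X, (V + ∑ T, |Z T X|) ∂P :=
        integral_mono_ae (integrable_cliqueNum hcm (measurableSet_partiteRel ε) P)
          ((integrable_const V).add (integrable_finsetSum _ fun T _ => hZi T)) hle
    _ = V + ∑ T, ∫ X, |Z T X| ∂P := by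
        rw [integral_add (integrable_const V) (integrable_finsetSum _ fun T _ => hZi T),
          integral_finsetSum _ fun T _ => hZi T]
        simp
    _ ≤ V + ∑ _T : Fin (r + 1) → Fin K, √V := by
        gcongr with T
        exact hZs T
    _ = _ := by simp [card_univ]

theorem chainConstant_nonneg {r : ℕ} (hr : 0 < r) : 0 ≤ chainConstant r :=
  ge_of_tendsto (tendsto_meanChain hr) (Eventually.of_forall fun n =>
    div_nonneg (meanChain_nonneg r n) (by positivity))

theorem exists_meanChain_le {r : ℕ} (hr : 0 < r) {d : ℝ} (hd : chainConstant r < d) :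
    ∃ C : ℝ, 0 ≤ C ∧ ∀ k, meanChain r k ≤ d * (k : ℝ) ^ (1 / (r : ℝ)) + C := by
  obtain ⟨N, hN⟩ := eventually_atTop.1 ((tendsto_meanChain hr).eventually (gt_mem_nhds hd))
  have hd0 : 0 ≤ d := (chainConstant_nonneg hr).trans hd.le
  refine ⟨N, Nat.cast_nonneg N, fun k => ?_⟩
  rcases le_total k N with h | h
  · have h1 : (k : ℝ) ≤ N := by exact_mod_cast h
    have h2 : 0 ≤ d * (k : ℝ) ^ (1 / (r : ℝ)) := by positivity
    linarith [meanChain_le_self r k]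
  · have h1 := hN k h
    rcases Nat.eq_zero_or_pos k with rfl | hk
    · have h2 := meanChain_le_self r 0
      have h3 : 0 ≤ d * ((0 : ℕ) : ℝ) ^ (1 / (r : ℝ)) := by positivity
      have h4 : (0 : ℝ) ≤ N := Nat.cast_nonneg N
      simp only [Nat.cast_zero] at h2 h3 ⊢
      linarith
    · rw [div_lt_iff₀ (Real.rpow_pos_of_pos (by exact_mod_cast hk) _)] at h1
      have h4 : (0 : ℝ) ≤ N := Nat.cast_nonneg N
      linarith

theorem eventually_meanClique_chamber_le {r : ℕ} (hr : 0 < r) (ε : Fin r → Bool) {d' : ℝ}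
    (hd' : chainConstant r / r < d') :
    ∀ᶠ n : ℕ in atTop, meanClique (cubeMeasure r) (chamber r) (PartiteRel ε) n ≤
      d' * (n : ℝ) ^ (1 / (r : ℝ)) := by
  have hr' : (0 : ℝ) < r := by exact_mod_cast hr
  have hlim : Tendsto (fun K : ℕ => (chainConstant r + 1 / K) * ((1 + r / K) / r)) atTop
      (𝓝 (chainConstant r / r)) := by
    have h1 := tendsto_const_div_atTop_nhds_zero_nat (1 : ℝ)
    have h2 := tendsto_const_div_atTop_nhds_zero_nat (r : ℝ)
    have := (h1.const_add (chainConstant r)).mul ((h2.const_add 1).div_const (r : ℝ))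
    simpa [div_eq_mul_inv] using this
  obtain ⟨K, hKd, hK⟩ := ((hlim.eventually (gt_mem_nhds hd')).and (eventually_gt_atTop 0)).exists
  have hK' : (0 : ℝ) < K := by exact_mod_cast hK
  have hd : chainConstant r < chainConstant r + 1 / K := by
    have : (0 : ℝ) < 1 / K := by positivity
    linarith
  have hd0 : 0 ≤ chainConstant r + 1 / K := (chainConstant_nonneg hr).trans hd.le
  obtain ⟨C, hC0, hC⟩ := exists_meanChain_le hr hd
  set A := (chainConstant r + 1 / K) * ((1 + r / K) / r) with hA
  have hA0 : 0 ≤ A := by positivity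
  set m : ℝ := ((Fintype.card (Fin (r + 1) → Fin K) : ℕ) : ℝ) with hm
  obtain ⟨η, hη0, hη⟩ : ∃ η : ℝ, 0 < η ∧ (1 + η) * A < d' := by
    have : Tendsto (fun η : ℝ => (1 + η) * A) (𝓝[>] 0) (𝓝 A) := by
      have h : Tendsto (fun η : ℝ => (1 + η) * A) (𝓝 0) (𝓝 ((1 + 0) * A)) :=
        (tendsto_id.const_add 1).mul_const A
      rw [add_zero, one_mul] at h
      exact h.mono_left nhdsWithin_le_nhds
    obtain ⟨η, h1, h2⟩ := ((this.eventually (gt_mem_nhds hKd)).and self_mem_nhdsWithin).exists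
    exact ⟨η, h2, h1⟩
  have hns : Tendsto (fun n : ℕ => (n : ℝ) ^ (1 / (r : ℝ)) * (d' - (1 + η) * A)) atTop atTop :=
    ((tendsto_rpow_atTop (by positivity)).comp tendsto_natCast_atTop_atTop).atTop_mul_const
      (sub_pos.2 hη)
  filter_upwards [hns.eventually_ge_atTop ((1 + η) * C + m ^ 2 / η)] with n hn
  set V := A * (n : ℝ) ^ (1 / (r : ℝ)) + C with hV
  have hV0 : 0 ≤ V := by positivity
  have h1 := meanClique_chamber_le hr hK ε n (V := V) fun T =>
    meanClique_cutBox_le hr hK ε T hd0 hC0 hC n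
  have h2 : m * √V ≤ η * V + m ^ 2 / η := by
    have h3 := Real.sq_sqrt hV0
    have h4 : η * V + m ^ 2 / η - m * √V = (η * √V - m / 2) ^ 2 / η + 3 * m ^ 2 / (4 * η) := by
      field_simp
      rw [show V = √V ^ 2 from h3.symm, Real.sqrt_sq (Real.sqrt_nonneg _)]
      ring
    have h5 : 0 ≤ (η * √V - m / 2) ^ 2 / η + 3 * m ^ 2 / (4 * η) := by positivity
    linarith
  have h6 : V + (η * V + m ^ 2 / η) ≤ d' * (n : ℝ) ^ (1 / (r : ℝ)) := by
    rw [hV]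
    linarith
  linarith

/-- The box in which the `i`-th coordinate lies in the `i`-th of `r` equal subintervals. -/
def equalBox (r : ℕ) : Set (Fin r → ℝ) :=
  Set.univ.pi fun i : Fin r => Set.Ioo ((i : ℝ) / r) (((i : ℝ) + 1) / r)

theorem equalBox_lt {r : ℕ} {x y : Fin r → ℝ} (hx : x ∈ equalBox r) (hy : y ∈ equalBox r)
    {i j : Fin r} (hij : i < j) : x i < y j := by
  have h1 : x i < ((i : ℝ) + 1) / r := (hx i trivial).2
  have h2 : ((j : ℝ)) / r < y j := (hy j trivial).1
  have h3 : ((i : ℝ) + 1) ≤ j := by exact_mod_cast Nat.succ_le_of_lt (Fin.lt_def.1 hij)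
  exact h1.trans (lt_of_le_of_lt (by gcongr) h2)

theorem equalBox_subset_chamber (r : ℕ) : equalBox r ⊆ chamber r :=
  fun _ hx _ _ hij => equalBox_lt hx hx hij

theorem equalBox_endpoints {r : ℕ} (i : Fin r) :
    (i : ℝ) / r < ((i : ℝ) + 1) / r ∧ (0 : ℝ) ≤ (i : ℝ) / r ∧ ((i : ℝ) + 1) / r ≤ 1 := by
  have hr : (0 : ℝ) < r := by exact_mod_cast i.pos
  have : (i : ℝ) + 1 ≤ r := by exact_mod_cast Nat.succ_le_of_lt i.isLt
  exact ⟨by gcongr; linarith, by positivity, (div_le_one hr).2 this⟩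

theorem cubeMeasure_real_equalBox (r : ℕ) :
    (cubeMeasure r).real (equalBox r) = ((r : ℝ)⁻¹) ^ r := by
  have h := cubeMeasure_box (fun i => (equalBox_endpoints i).2.1)
    (fun i : Fin r => (equalBox_endpoints i).2.2)
  rw [Measure.real, equalBox, h, ENNReal.toReal_prod]
  have : ∀ i : Fin r, (ENNReal.ofReal (((i : ℝ) + 1) / r - (i : ℝ) / r)).toReal = (r : ℝ)⁻¹ := by
    intro i
    rw [← sub_div, add_sub_cancel_left, one_div, ENNReal.toReal_ofReal (by positivity)]
  simp [this]

theorem measurableSet_chamber (r : ℕ) : MeasurableSet (chamber r) :=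
  measurableSet_strictMono

theorem cubeMeasure_real_chamber_pos {r : ℕ} (hr : 0 < r) :
    0 < (cubeMeasure r).real (chamber r) := by
  refine lt_of_lt_of_le ?_ (measureReal_mono (equalBox_subset_chamber r))
  rw [cubeMeasure_real_equalBox]
  positivity

/-- The uniform distribution on strictly increasing vectors in the unit cube. -/
noncomputable def sortedMeasure (r : ℕ) : Measure (Fin r → ℝ) :=
  (cubeMeasure r)[|chamber r]

theorem cubeMeasure_chamber_ne_zero {r : ℕ} (hr : 0 < r) : cubeMeasure r (chamber r) ≠ 0 :=
  fun h => (cubeMeasure_real_chamber_pos hr).ne' (by simp [Measure.real, h])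

theorem isProbabilityMeasure_sortedMeasure {r : ℕ} (hr : 0 < r) :
    IsProbabilityMeasure (sortedMeasure r) :=
  cond_isProbabilityMeasure (cubeMeasure_chamber_ne_zero hr)

/-- The limiting constant for cliques of `r`-partite patterns. -/
noncomputable def partiteConstant (r : ℕ) : ℝ :=
  chainConstant r / r * ((cubeMeasure r).real (chamber r))⁻¹ ^ (1 / (r : ℝ))

theorem lt_partiteConstant {r : ℕ} (hr : 2 ≤ r) :
    1 / Real.Gamma (((r : ℝ) + 1) / r) < partiteConstant r := by
  have hr0 : (0 : ℝ) < r := by positivity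
  have hG : 0 < Real.Gamma (1 / (r : ℝ) + 1) := Real.Gamma_pos_of_pos (by positivity)
  have hq := cubeMeasure_real_chamber_pos (r := r) (by omega)
  have hf : (0 : ℝ) < r.factorial := by positivity
  have hfac : ((r.factorial : ℝ)) ≤ ((cubeMeasure r).real (chamber r))⁻¹ := by
    rw [le_inv_comm₀ hf hq, ← one_div]
    exact cubeMeasure_chamber_le r
  have hf' : (0 : ℝ) < (r.factorial : ℝ) ^ (1 / (r : ℝ)) := by positivity
  have h := lt_chainConstant hr
  have e : ((r : ℝ) + 1) / r = 1 / (r : ℝ) + 1 := by field_simp; ring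
  rw [e]
  calc 1 / Real.Gamma (1 / (r : ℝ) + 1)
      = (r : ℝ) / ((r.factorial : ℝ) ^ (1 / (r : ℝ)) * Real.Gamma (1 / (r : ℝ) + 1)) / r *
          (r.factorial : ℝ) ^ (1 / (r : ℝ)) := by field_simp
    _ < chainConstant r / r * (r.factorial : ℝ) ^ (1 / (r : ℝ)) := by gcongr
    _ ≤ partiteConstant r := by
        have := chainConstant_nonneg (r := r) (by omega)
        rw [partiteConstant]
        gcongr

theorem eventually_meanClique_sorted_le {r : ℕ} (hr : 0 < r) (ε : Fin r → Bool) {a : ℝ}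
    (ha : partiteConstant r < a) :
    ∀ᶠ n : ℕ in atTop, meanClique (sortedMeasure r) Set.univ (PartiteRel ε) n ≤
      a * (n : ℝ) ^ (1 / (r : ℝ)) := by
  have := isProbabilityMeasure_sortedMeasure hr
  refine eventually_le_of_integral_countIn_le (cubeMeasure r) (measurableSet_chamber r)
    (cubeMeasure_real_chamber_pos hr)
    (meanClique_mono _ MeasurableSet.univ (measurableSet_partiteRel ε))
    (meanClique_nonneg _ _ _) (by positivity)
    (div_nonneg (chainConstant_nonneg hr) (Nat.cast_nonneg r)) (fun d' hd' => ?_) ha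
  filter_upwards [eventually_meanClique_chamber_le hr ε hd'] with n hn
  rwa [integral_cliqueNum_eq_integral_meanClique _ (measurableSet_chamber r)
    (cubeMeasure_chamber_ne_zero hr) (measurableSet_partiteRel ε)] at hn

theorem meanClique_equalBox_le {r : ℕ} (hr : 0 < r) (ε : Fin r → Bool) (n : ℕ) :
    meanClique (sortedMeasure r) (equalBox r) (SignComparable ε) n ≤
      meanClique (sortedMeasure r) Set.univ (PartiteRel ε) n := by
  have := isProbabilityMeasure_sortedMeasure hr
  refine integral_mono
    (integrable_cliqueNum (measurableSet_box _ _) (measurableSet_signComparable ε) _)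
    (integrable_cliqueNum MeasurableSet.univ (measurableSet_partiteRel ε) _) fun X => ?_
  refine Nat.cast_le.2 (cliqueNum_le_iff.2 fun S hS => IsIndexClique.card_le ?_)
  exact ⟨fun _ _ => trivial, fun i hi j hj hij => ⟨hS.2 i hi j hj hij, fun k l hkl =>
    ⟨equalBox_lt (hS.1 i hi) (hS.1 j hj) hkl, equalBox_lt (hS.1 j hj) (hS.1 i hi) hkl⟩⟩⟩

theorem sortedMeasure_real_equalBox (r : ℕ) : (sortedMeasure r).real (equalBox r) =
    ((cubeMeasure r).real (chamber r))⁻¹ * ((r : ℝ)⁻¹) ^ r := by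
  rw [sortedMeasure, Measure.real, ProbabilityTheory.cond_apply (measurableSet_chamber r),
    ENNReal.toReal_mul, ENNReal.toReal_inv, ← Measure.real, ← Measure.real,
    Set.inter_eq_right.2 (equalBox_subset_chamber r), cubeMeasure_real_equalBox]

theorem eventually_le_meanClique_sorted {r : ℕ} (hr : 0 < r) (ε : Fin r → Bool) {a : ℝ}
    (ha : a < partiteConstant r) :
    ∀ᶠ n : ℕ in atTop, a * (n : ℝ) ^ (1 / (r : ℝ)) ≤
      meanClique (sortedMeasure r) Set.univ (PartiteRel ε) n := by
  have := isProbabilityMeasure_sortedMeasure hr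
  have hq := cubeMeasure_real_chamber_pos hr
  have hr0 : (r : ℝ) ≠ 0 := by positivity
  have hpow : (sortedMeasure r).real (equalBox r) ^ (1 / (r : ℝ)) =
      ((cubeMeasure r).real (chamber r))⁻¹ ^ (1 / (r : ℝ)) * (r : ℝ)⁻¹ := by
    rw [sortedMeasure_real_equalBox, Real.mul_rpow (by positivity) (by positivity), one_div (r : ℝ),
      Real.pow_rpow_inv_natCast (by positivity) hr.ne']
  filter_upwards [eventually_le_integral_countIn (sortedMeasure r)
    (B := equalBox r) (measurableSet_box _ _)
    (by rw [sortedMeasure_real_equalBox]; positivity) (meanChain_mono r) (meanChain_nonneg r)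
    (by positivity) (tendsto_meanChain hr) (a := a)
    (by rw [hpow]; refine ha.trans_eq ?_; rw [partiteConstant]; ring)] with n hn
  refine hn.trans (le_trans (le_of_eq ?_) (meanClique_equalBox_le hr ε n))
  exact (meanClique_cond_box ε (measurableSet_chamber r) (fun i => (equalBox_endpoints i).1)
    (fun i => (equalBox_endpoints i).2.1) (fun i => (equalBox_endpoints i).2.2)
    (equalBox_subset_chamber r) n).symm

theorem tendsto_meanClique_sorted {r : ℕ} (hr : 0 < r) (ε : Fin r → Bool) :
    Tendsto (fun n : ℕ => meanClique (sortedMeasure r) Set.univ (PartiteRel ε) n /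
      (n : ℝ) ^ (1 / (r : ℝ))) atTop (𝓝 (partiteConstant r)) := by
  refine tendsto_order.2 ⟨fun a ha => ?_, fun a ha => ?_⟩
  · obtain ⟨a', h1, h2⟩ := exists_between ha
    filter_upwards [eventually_le_meanClique_sorted hr ε h2, eventually_gt_atTop 0] with n hn hn0
    have : (0 : ℝ) < (n : ℝ) ^ (1 / (r : ℝ)) := by positivity
    exact h1.trans_le ((le_div_iff₀ this).2 hn)
  · obtain ⟨a', h1, h2⟩ := exists_between ha
    filter_upwards [eventually_meanClique_sorted_le hr ε h1, eventually_gt_atTop 0] with n hn hn0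
    have : (0 : ℝ) < (n : ℝ) ^ (1 / (r : ℝ)) := by positivity
    exact ((div_le_iff₀ this).2 hn).trans_lt h2

theorem tendsto_pi_sorted_real {r : ℕ} (hr : 0 < r) (ε : Fin r → Bool) {δ : ℝ} (hδ : 0 < δ) :
    Tendsto (fun n : ℕ => (Measure.pi fun _ : Fin n => sortedMeasure r).real
      {X | δ ≤ |(cliqueNum Set.univ (PartiteRel ε) X : ℝ) / (n : ℝ) ^ (1 / (r : ℝ)) -
        partiteConstant r|}) atTop (𝓝 0) := by
  have := isProbabilityMeasure_sortedMeasure hr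
  have hr0 : (0 : ℝ) < r := by exact_mod_cast hr
  have hm := tendsto_meanClique_sorted hr ε
  have hs := tendsto_natCast_rpow_neg (s := -(1 / (r : ℝ))) (by simpa using hr0)
  have hlim : Tendsto (fun n : ℕ => meanClique (sortedMeasure r) Set.univ (PartiteRel ε) n /
      (n : ℝ) ^ (1 / (r : ℝ)) * (n : ℝ) ^ (-(1 / (r : ℝ))) * (4 / δ ^ 2)) atTop (𝓝 0) := by
    simpa using (hm.mul hs).mul_const (4 / δ ^ 2)
  refine tendsto_of_tendsto_of_tendsto_of_le_of_le' tendsto_const_nhds hlim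
    (Eventually.of_forall fun n => measureReal_nonneg) ?_
  have hclose := (tendsto_order.1 ((hm.sub_const (partiteConstant r)).abs)).2 (δ / 2)
    (by simpa using hδ)
  filter_upwards [hclose, eventually_gt_atTop 0] with n hn hn0
  set t := (n : ℝ) ^ (1 / (r : ℝ)) with ht
  have ht0 : 0 < t := by positivity
  set m := meanClique (sortedMeasure r) Set.univ (PartiteRel ε) n with hmdef
  have hvar := variance_cliqueNum_le (sortedMeasure r) MeasurableSet.univ
    (measurableSet_partiteRel ε) n
  have hmeas := measurable_cliqueNum_real (ι := Fin n) MeasurableSet.univ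
    (measurableSet_partiteRel ε)
  set P := Measure.pi fun _ : Fin n => sortedMeasure r with hP
  have hint : Integrable (fun X : Fin n → Fin r → ℝ =>
      ((cliqueNum Set.univ (PartiteRel ε) X : ℝ) - m) ^ 2) P := by
    refine integrable_of_bounded ((hmeas.sub_const m).pow_const 2) ((n + |m|) ^ 2) fun X => ?_
    rw [abs_pow]
    gcongr
    refine (abs_sub _ _).trans ?_
    gcongr
    rw [abs_of_nonneg (Nat.cast_nonneg _)]
    simpa using cliqueNum_le_card Set.univ (PartiteRel ε) X
  have hmk := mul_meas_ge_le_integral_of_nonneg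
    (Eventually.of_forall fun X => sq_nonneg _) hint ((δ / 2 * t) ^ 2)
  have hsub : {X : Fin n → Fin r → ℝ | δ ≤ |(cliqueNum Set.univ (PartiteRel ε) X : ℝ) / t -
      partiteConstant r|} ⊆ {X | (δ / 2 * t) ^ 2 ≤
        ((cliqueNum Set.univ (PartiteRel ε) X : ℝ) - m) ^ 2} := by
    intro X hX
    rw [Set.mem_ofPred_eq] at hX ⊢
    have h1 : δ / 2 ≤ |(cliqueNum Set.univ (PartiteRel ε) X : ℝ) / t - m / t| := by
      have := abs_sub_le ((cliqueNum Set.univ (PartiteRel ε) X : ℝ) / t) (m / t)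
        (partiteConstant r)
      linarith
    rw [← sub_div, abs_div, abs_of_pos ht0, le_div_iff₀ ht0] at h1
    rw [← sq_abs ((cliqueNum Set.univ (PartiteRel ε) X : ℝ) - m)]
    gcongr
  have hmono := measureReal_mono (μ := P) hsub
  have h2 : P.real {X : Fin n → Fin r → ℝ | δ ≤ |(cliqueNum Set.univ (PartiteRel ε) X : ℝ) / t -
      partiteConstant r|} * (δ / 2 * t) ^ 2 ≤ m := by
    rw [mul_comm]
    exact (mul_le_mul_of_nonneg_left hmono (by positivity)).trans (hmk.trans hvar)
  rw [← le_div_iff₀ (by positivity)] at h2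
  refine h2.trans (le_of_eq ?_)
  rw [Real.rpow_neg (Nat.cast_nonneg _), ← ht]
  field_simp
  ring

theorem image_comp_eq_iff {r : ℕ} {u p : Fin r → ℕ} {φ : ℕ → ℕ} (hp : StrictMono p)
    (hφ : StrictMono (φ ∘ u)) (h : (univ.image u).image φ = univ.image p) (i : Fin r) :
    φ (u i) = p i := by
  refine congrFun ((hφ.range_inj hp).1 ?_) i
  have := congrArg (fun s : Finset ℕ => (s : Set ℕ)) h
  simpa [Set.range_comp] using this

/-- Two pairs of interleaved increasing sequences with the same sign vector are order
isomorphic. -/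
theorem exists_strictMonoOn_map {r : ℕ} {u v p q : Fin r → ℕ} (hu : StrictMono u)
    (hv : StrictMono v) (hp : StrictMono p) (hq : StrictMono q) (huv : ∀ i j, u i ≠ v j)
    (h1 : ∀ i j, u i < v j → p i < q j) (h2 : ∀ i j, v i < u j → q i < p j) :
    ∃ φ : ℕ → ℕ, StrictMonoOn φ (↑(univ.image u ∪ univ.image v) : Set ℕ) ∧
      (univ.image u).image φ = univ.image p ∧ (univ.image v).image φ = univ.image q := by
  have eu : ∀ i, Function.extend u p (Function.extend v q id) (u i) = p i :=
    fun i => hu.injective.extend_apply _ _ i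
  have ev : ∀ i, Function.extend u p (Function.extend v q id) (v i) = q i := fun i => by
    rw [Function.extend_apply' _ _ _ fun ⟨j, hj⟩ => huv j i hj, hv.injective.extend_apply]
  refine ⟨Function.extend u p (Function.extend v q id), ?_, ?_, ?_⟩
  · intro x hx y hy hxy
    simp only [coe_union, coe_image, coe_univ, Set.image_univ, Set.mem_union, Set.mem_range]
      at hx hy
    obtain ⟨i, rfl⟩ | ⟨i, rfl⟩ := hx <;> obtain ⟨j, rfl⟩ | ⟨j, rfl⟩ := hy
    · rw [eu, eu]
      exact hp (hu.lt_iff_lt.1 hxy)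
    · rw [eu, ev]
      exact h1 i j hxy
    · rw [ev, eu]
      exact h2 i j hxy
    · rw [ev, ev]
      exact hq (hv.lt_iff_lt.1 hxy)
  · rw [image_image]
    exact image_congr fun i _ => eu i
  · rw [image_image]
    exact image_congr fun i _ => ev i

/-- The real vector with the given natural number coordinates. -/
def realVec {r : ℕ} (u : Fin r → ℕ) : Fin r → ℝ := fun i => u i

theorem partiteRel_symm {r : ℕ} {ε : Fin r → Bool} {x y : Fin r → ℝ} (h : PartiteRel ε x y) :
    PartiteRel ε y x :=
  ⟨h.1.symm, fun i j hij => (h.2 i j hij).symm⟩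

theorem partiteRel_congr {r : ℕ} {ε : Fin r → Bool} {x y x' y' : Fin r → ℝ}
    (h1 : ∀ i j, x i < y j ↔ x' i < y' j) (h2 : ∀ i j, y i < x j ↔ y' i < x' j) :
    PartiteRel ε x y ↔ PartiteRel ε x' y' := by
  simp only [PartiteRel, SignComparable, SignLT, h1, h2]

theorem lt_imp_lt_of_signLT {r : ℕ} {ε : Fin r → Bool} {u v p q : Fin r → ℕ}
    (h : PartiteRel ε (realVec u) (realVec v)) (hs : SignLT ε (realVec u) (realVec v))
    (h' : PartiteRel ε (realVec p) (realVec q)) (hs' : SignLT ε (realVec p) (realVec q)) :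
    (∀ i j, u i < v j → p i < q j) ∧ ∀ i j, v i < u j → q i < p j := by
  have key : ∀ i, (if ε i then u i < v i else v i < u i) ∧ (if ε i then p i < q i else q i < p i) :=
    fun i => ⟨by simpa [realVec] using hs i, by simpa [realVec] using hs' i⟩
  have c1 : ∀ i j, i < j → u i < v j ∧ v i < u j :=
    fun i j hij => by simpa [realVec] using h.2 i j hij
  have c2 : ∀ i j, i < j → p i < q j ∧ q i < p j :=
    fun i j hij => by simpa [realVec] using h'.2 i j hij
  refine ⟨fun i j hlt => ?_, fun i j hlt => ?_⟩
  · rcases lt_trichotomy i j with hij | rfl | hij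
    · exact (c2 i j hij).1
    · have := key i
      split_ifs at this
      · exact this.2
      · omega
    · have := (c1 j i hij).2
      omega
  · rcases lt_trichotomy i j with hij | rfl | hij
    · exact (c2 i j hij).2
    · have := key i
      split_ifs at this
      · omega
      · exact this.2
    · have := (c1 j i hij).1
      omega

theorem formsPattern_of_partiteRel {r : ℕ} {ε : Fin r → Bool} {u v p q : Fin r → ℕ}
    (hu : StrictMono u) (hv : StrictMono v) (hp : StrictMono p) (hq : StrictMono q)
    (huv : ∀ i j, u i ≠ v j) (h : PartiteRel ε (realVec u) (realVec v))
    (hpq : PartiteRel ε (realVec p) (realVec q)) :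
    FormsPattern (univ.image u) (univ.image v) {univ.image p, univ.image q} := by
  have key : ∀ p q : Fin r → ℕ, StrictMono p → StrictMono q →
      (∀ i j, u i < v j → p i < q j) ∧ (∀ i j, v i < u j → q i < p j) →
      FormsPattern (univ.image u) (univ.image v) {univ.image p, univ.image q} := by
    intro p q hp hq hlt
    obtain ⟨φ, hφ, h1, h2⟩ := exists_strictMonoOn_map hu hv hp hq huv hlt.1 hlt.2
    exact ⟨φ, hφ, by rw [h1, h2]⟩
  rcases h.1 with hs | hs <;> rcases hpq.1 with hs' | hs'
  · exact key p q hp hq (lt_imp_lt_of_signLT h hs hpq hs')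
  · rw [pair_comm]
    exact key q p hq hp (lt_imp_lt_of_signLT h hs (partiteRel_symm hpq) hs')
  · rw [pair_comm]
    exact key q p hq hp (lt_imp_lt_of_signLT (partiteRel_symm h) hs hpq hs').symm
  · exact key p q hp hq (lt_imp_lt_of_signLT (partiteRel_symm h) hs (partiteRel_symm hpq) hs').symm

theorem partiteRel_of_formsPattern {r : ℕ} {ε : Fin r → Bool} {u v p q : Fin r → ℕ}
    (hu : StrictMono u) (hv : StrictMono v) (hp : StrictMono p) (hq : StrictMono q)
    (hpq : PartiteRel ε (realVec p) (realVec q))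
    (h : FormsPattern (univ.image u) (univ.image v) {univ.image p, univ.image q}) :
    PartiteRel ε (realVec u) (realVec v) := by
  obtain ⟨φ, hφ, h⟩ := h
  have mu : ∀ i, u i ∈ (↑(univ.image u ∪ univ.image v) : Set ℕ) := fun i => by simp
  have mv : ∀ i, v i ∈ (↑(univ.image u ∪ univ.image v) : Set ℕ) := fun i => by simp
  have su : StrictMono (φ ∘ u) := fun i j hij => hφ (mu i) (mu j) (hu hij)
  have sv : StrictMono (φ ∘ v) := fun i j hij => hφ (mv i) (mv j) (hv hij)
  have key : ∀ p q : Fin r → ℕ, (∀ i, φ (u i) = p i) → (∀ i, φ (v i) = q i) →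
      PartiteRel ε (realVec p) (realVec q) → PartiteRel ε (realVec u) (realVec v) := by
    intro p q h1 h2 hpq
    refine (partiteRel_congr (fun i j => ?_) fun i j => ?_).1 hpq
    · simp only [realVec, Nat.cast_lt, ← h1, ← h2]
      exact hφ.lt_iff_lt (mu i) (mv j)
    · simp only [realVec, Nat.cast_lt, ← h1, ← h2]
      exact hφ.lt_iff_lt (mv i) (mu j)
  have hpair : ((univ.image u).image φ = univ.image p ∧ (univ.image v).image φ = univ.image q) ∨
      ((univ.image u).image φ = univ.image q ∧ (univ.image v).image φ = univ.image p) := by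
    have h' := congrArg (fun s : Finset (Finset ℕ) => (s : Set (Finset ℕ))) h
    simp only [coe_pair] at h'
    exact Set.pair_eq_pair_iff.1 h'
  rcases hpair with ⟨h1, h2⟩ | ⟨h1, h2⟩
  · exact key p q (image_comp_eq_iff hp su h1) (image_comp_eq_iff hq sv h2) hpq
  · exact key q p (image_comp_eq_iff hq su h1) (image_comp_eq_iff hp sv h2) (partiteRel_symm hpq)

theorem exists_eq_image_of_isPartite {r : ℕ} {e : Finset ℕ} (he : e.card = r)
    (h : ∀ i : ℕ, 1 ≤ i → i ≤ r → (e ∩ Icc ((i - 1) * 2 + 1) (i * 2)).card = 1) :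
    ∃ p : Fin r → ℕ, e = univ.image p ∧ ∀ i : Fin r, 2 * (i : ℕ) + 1 ≤ p i ∧ p i ≤ 2 * i + 2 := by
  have hex : ∀ i : Fin r, ∃ x ∈ e, 2 * (i : ℕ) + 1 ≤ x ∧ x ≤ 2 * i + 2 := by
    intro i
    obtain ⟨x, hx⟩ := card_pos.1 (by rw [h (i + 1) (by omega) (by omega)]; exact one_pos)
    rw [mem_inter, mem_Icc] at hx
    exact ⟨x, hx.1, by omega, by omega⟩
  choose p hp h1 h2 using hex
  have hinj : Function.Injective p := by
    intro i j hij
    have := h1 i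
    have := h2 i
    have := h1 j
    have := h2 j
    exact Fin.ext (by omega)
  refine ⟨p, (eq_of_subset_of_card_le ?_ ?_).symm, fun i => ⟨h1 i, h2 i⟩⟩
  · rw [image_subset_iff]
    exact fun i _ => hp i
  · rw [card_image_of_injective _ hinj, he, card_univ, Fintype.card_fin]

theorem exists_eq_pair_of_isPartite {r : ℕ} {P : Finset (Finset ℕ)} (hP : IsPattern r P)
    (hpart : IsPartite r 2 P) : ∃ (ε : Fin r → Bool) (p q : Fin r → ℕ), StrictMono p ∧
      StrictMono q ∧ PartiteRel ε (realVec p) (realVec q) ∧ P = {univ.image p, univ.image q} := by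
  obtain ⟨hcard, hr, hdisj, -⟩ := hP
  obtain ⟨e, f, hef, rfl⟩ := card_eq_two.1 hcard
  obtain ⟨p, rfl, hp⟩ := exists_eq_image_of_isPartite (hr e (by simp)) (hpart e (by simp))
  obtain ⟨q, rfl, hq⟩ := exists_eq_image_of_isPartite (hr f (by simp)) (hpart f (by simp))
  have hne : ∀ i, p i ≠ q i := fun i h =>
    disjoint_left.1 (hdisj _ (by simp) _ (by simp) hef) (mem_image_of_mem p (mem_univ i))
      (h ▸ mem_image_of_mem q (mem_univ i))
  have hlt : ∀ i j : Fin r, i < j → p i < p j ∧ p i < q j ∧ q i < p j ∧ q i < q j := by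
    intro i j hij
    have := Fin.lt_def.1 hij
    have := hp i
    have := hp j
    have := hq i
    have := hq j
    omega
  refine ⟨fun i => decide (p i < q i), p, q, fun i j h => (hlt i j h).1,
    fun i j h => (hlt i j h).2.2.2, ⟨Or.inl fun i => ?_, fun i j h => ?_⟩, rfl⟩
  · simp only [decide_eq_true_eq, realVec, Nat.cast_lt]
    have := hne i
    split_ifs <;> omega
  · simp only [realVec, Nat.cast_lt]
    exact ⟨(hlt i j h).2.1, (hlt i j h).2.2.1⟩

/-- Bijections from `n` rows of `r` entries to the vertex set of an ordered `r`-matching of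
size `n`. -/
abbrev Ranking (r n : ℕ) := Fin n × Fin r ≃ Icc 1 (r * n)

/-- The entries of row `j` of a ranking. -/
def rowVec {r n : ℕ} (σ : Ranking r n) (j : Fin n) : Fin r → ℕ := fun i => σ (j, i)

/-- Row `j` of a ranking, as an edge. -/
def rowEdge {r n : ℕ} (σ : Ranking r n) (j : Fin n) : Finset ℕ := univ.image (rowVec σ j)

/-- The collection of the rows of a ranking. -/
def rowMatching {r n : ℕ} (σ : Ranking r n) : Finset (Finset ℕ) := univ.image (rowEdge σ)

/-- Every row of the ranking is increasing. -/
def RowIncreasing {r n : ℕ} (σ : Ranking r n) : Prop := ∀ j, StrictMono (rowVec σ j)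

theorem rowVec_ne {r n : ℕ} (σ : Ranking r n) {j k : Fin n} (hjk : j ≠ k) (i l : Fin r) :
    rowVec σ j i ≠ rowVec σ k l := fun h =>
  hjk (congrArg Prod.fst (σ.injective (Subtype.ext h)))

theorem disjoint_rowEdge {r n : ℕ} (σ : Ranking r n) {j k : Fin n} (hjk : j ≠ k) :
    Disjoint (rowEdge σ j) (rowEdge σ k) := by
  rw [disjoint_left]
  intro x hx hy
  obtain ⟨i, -, rfl⟩ := mem_image.1 hx
  obtain ⟨l, -, h⟩ := mem_image.1 hy
  exact rowVec_ne σ hjk i l h.symm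

theorem card_rowEdge {r n : ℕ} (σ : Ranking r n) (j : Fin n) : (rowEdge σ j).card = r := by
  rw [rowEdge, card_image_of_injective, card_univ, Fintype.card_fin]
  intro i l h
  exact congrArg Prod.snd (σ.injective (Subtype.ext h))

theorem rowEdge_injective {r n : ℕ} (hr : 0 < r) (σ : Ranking r n) :
    Function.Injective (rowEdge σ) := by
  intro j k h
  by_contra hjk
  have hd := disjoint_rowEdge σ hjk
  rw [← h, disjoint_self_iff_empty] at hd
  have := card_rowEdge σ j
  rw [hd, card_empty] at this
  omega

theorem isOrderedMatching_rowMatching {r n : ℕ} (hr : 0 < r) (σ : Ranking r n) :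
    IsOrderedMatching r n (rowMatching σ) := by
  refine ⟨?_, ?_, ?_, ?_⟩
  · rw [rowMatching, card_image_of_injective _ (rowEdge_injective hr σ), card_univ,
      Fintype.card_fin]
  · intro e he
    obtain ⟨j, -, rfl⟩ := mem_image.1 he
    exact card_rowEdge σ j
  · intro e he f hf hef
    obtain ⟨j, -, rfl⟩ := mem_image.1 he
    obtain ⟨k, -, rfl⟩ := mem_image.1 hf
    exact disjoint_rowEdge σ fun h => hef (by rw [h])
  · ext x
    simp only [mem_biUnion, rowMatching, mem_image, mem_univ, true_and, id_eq, exists_exists_eq_and,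
      rowEdge, rowVec]
    constructor
    · rintro ⟨j, i, rfl⟩
      exact (σ (j, i)).2
    · intro hx
      exact ⟨(σ.symm ⟨x, hx⟩).1, (σ.symm ⟨x, hx⟩).2, by simp⟩

theorem sigma_equiv_ext {ι : Type*} {Q : Finset (Finset ℕ) → Prop}
    {s t : Σ M : {M : Finset (Finset ℕ) // Q M}, ι ≃ M.1}
    (h : ∀ j, (s.2 j : Finset ℕ) = t.2 j) : s = t := by
  obtain ⟨⟨M, hM⟩, e⟩ := s
  obtain ⟨⟨M', hM'⟩, e'⟩ := t
  have : M = M' := by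
    ext x
    constructor
    · intro hx
      have := h (e.symm ⟨x, hx⟩)
      simp only [Equiv.apply_symm_apply] at this
      rw [this]
      exact (e' _).2
    · intro hx
      have := h (e'.symm ⟨x, hx⟩)
      simp only [Equiv.apply_symm_apply] at this
      rw [← this]
      exact (e _).2
  subst this
  congr 1
  ext j : 2
  exact h j

/-- The matching formed by the rows of a ranking, together with the labelling of its edges. -/
noncomputable def labelledMatching {r n : ℕ} (hr : 0 < r) (Q : Finset (Finset ℕ) → Prop)
    (σ : {σ : Ranking r n // RowIncreasing σ ∧ Q (rowMatching σ)}) :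
    Σ M : {M : Finset (Finset ℕ) // IsOrderedMatching r n M ∧ Q M}, Fin n ≃ M.1 :=
  ⟨⟨rowMatching σ.1, isOrderedMatching_rowMatching hr σ.1, σ.2.2⟩,
    Equiv.ofBijective (fun j => ⟨rowEdge σ.1 j, mem_image_of_mem _ (mem_univ j)⟩)
      ⟨fun j k h => rowEdge_injective hr σ.1 (congrArg Subtype.val h), fun e => by
        obtain ⟨j, -, hj⟩ := mem_image.1 e.2
        exact ⟨j, Subtype.ext hj⟩⟩⟩

theorem labelledMatching_bijective {r n : ℕ} (hr : 0 < r) (Q : Finset (Finset ℕ) → Prop) :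
    Function.Bijective (labelledMatching (n := n) hr Q) := by
  constructor
  · intro σ τ h
    have he : ∀ j, rowEdge σ.1 j = rowEdge τ.1 j := fun j =>
      congrArg (fun s : Σ M : {M : Finset (Finset ℕ) // IsOrderedMatching r n M ∧ Q M},
        Fin n ≃ M.1 => ((s.2 j : s.1.1) : Finset ℕ)) h
    refine Subtype.ext (Equiv.ext fun x => Subtype.ext ?_)
    have := image_comp_eq_iff (φ := id) (τ.2.1 x.1) (σ.2.1 x.1)
      (by rw [image_id]; exact he x.1) x.2
    exact this
  · rintro ⟨⟨M, hM, hQ⟩, e⟩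
    have hcard : ∀ j, (e j : Finset ℕ).card = r := fun j => hM.2.1 _ (e j).2
    have hmem : ∀ x : Fin n × Fin r, (e x.1 : Finset ℕ).orderEmbOfFin (hcard x.1) x.2 ∈
        Icc 1 (r * n) := fun x => by
      rw [← hM.2.2.2, mem_biUnion]
      exact ⟨_, (e x.1).2, orderEmbOfFin_mem _ _ _⟩
    have hbij : Function.Bijective fun x : Fin n × Fin r =>
        (⟨(e x.1 : Finset ℕ).orderEmbOfFin (hcard x.1) x.2, hmem x⟩ : Icc 1 (r * n)) := by
      constructor
      · rintro ⟨j, i⟩ ⟨k, l⟩ h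
        have h' := congrArg Subtype.val h
        simp only at h'
        have hjk : j = k := by
          by_contra hjk
          refine disjoint_left.1 (hM.2.2.1 _ (e j).2 _ (e k).2 fun h =>
            hjk (e.injective (Subtype.ext h))) (orderEmbOfFin_mem _ (hcard j) i) ?_
          rw [h']
          exact orderEmbOfFin_mem _ (hcard k) l
        subst hjk
        rw [((e j : Finset ℕ).orderEmbOfFin (hcard j)).injective h']
      · rintro ⟨y, hy⟩
        rw [← hM.2.2.2, mem_biUnion] at hy
        obtain ⟨f, hf, hyf⟩ := hy
        have hyf' : y ∈ (e (e.symm ⟨f, hf⟩) : Finset ℕ) := by simpa using hyf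
        rw [← mem_coe, ← range_orderEmbOfFin _ (hcard _)] at hyf'
        obtain ⟨i, hi⟩ := hyf'
        exact ⟨(e.symm ⟨f, hf⟩, i), Subtype.ext hi⟩
    set σ : Ranking r n := Equiv.ofBijective _ hbij with hσ
    have hrow : ∀ j, rowVec σ j = (e j : Finset ℕ).orderEmbOfFin (hcard j) := fun j => rfl
    have hedge : ∀ j, rowEdge σ j = e j := fun j => by
      rw [rowEdge, hrow, ← coe_inj, coe_image, coe_univ, Set.image_univ, range_orderEmbOfFin]
    have hMσ : rowMatching σ = M := by
      ext x
      simp only [rowMatching, mem_image, mem_univ, true_and, hedge]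
      exact ⟨fun ⟨j, hj⟩ => hj ▸ (e j).2, fun hx => ⟨e.symm ⟨x, hx⟩, by simp⟩⟩
    refine ⟨⟨σ, fun j => ?_, hMσ.symm ▸ hQ⟩, sigma_equiv_ext fun j => hedge j⟩
    rw [hrow]
    exact ((e j : Finset ℕ).orderEmbOfFin (hcard j)).strictMono

theorem finite_isOrderedMatching (r n : ℕ) (Q : Finset (Finset ℕ) → Prop) :
    Finite {M : Finset (Finset ℕ) // IsOrderedMatching r n M ∧ Q M} := by
  refine Set.Finite.subset (Finset.finite_toSet (Icc 1 (r * n)).powerset.powerset) fun M hM => ?_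
  rw [mem_coe, mem_powerset]
  intro e he
  rw [mem_powerset, ← hM.1.2.2.2]
  exact subset_biUnion_of_mem id he

theorem card_rowIncreasing {r : ℕ} (hr : 0 < r) (n : ℕ) (Q : Finset (Finset ℕ) → Prop) :
    Nat.card {σ : Ranking r n // RowIncreasing σ ∧ Q (rowMatching σ)} =
      Nat.card {M : Finset (Finset ℕ) // IsOrderedMatching r n M ∧ Q M} * n.factorial := by
  have := finite_isOrderedMatching r n Q
  have := Fintype.ofFinite {M : Finset (Finset ℕ) // IsOrderedMatching r n M ∧ Q M}
  rw [Nat.card_congr (Equiv.ofBijective _ (labelledMatching_bijective hr Q)), Nat.card_sigma,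
    sum_congr rfl fun M _ => ?_, sum_const, card_univ, smul_eq_mul, Nat.card_eq_fintype_card]
  have hn : Fintype.card M.1 = n := by rw [Fintype.card_coe, M.2.1.1]
  rw [Nat.card_eq_fintype_card, Fintype.card_equiv (Fintype.equivOfCardEq (by simp [hn])),
    Fintype.card_fin]

/-- The configurations whose coordinates are ordered according to the ranking `σ`. -/
def rankEvent {r n : ℕ} (σ : Ranking r n) : Set (Fin n → Fin r → ℝ) :=
  {X | StrictMono fun k => X (σ.symm k).1 (σ.symm k).2}

theorem lt_iff_of_mem_rankEvent {r n : ℕ} {σ : Ranking r n} {X : Fin n → Fin r → ℝ}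
    (hX : X ∈ rankEvent σ) (j k : Fin n) (i l : Fin r) :
    X j i < X k l ↔ rowVec σ j i < rowVec σ k l := by
  have h : StrictMono fun k => X (σ.symm k).1 (σ.symm k).2 := hX
  have := h.lt_iff_lt (a := σ (j, i)) (b := σ (k, l))
  simpa [rowVec] using this

theorem measurableSet_strictMono_of_fintype (κ : Type*) [Fintype κ] [Preorder κ] :
    MeasurableSet {x : κ → ℝ | StrictMono x} := by
  simp only [StrictMono, Set.ofPred_forall]
  exact MeasurableSet.iInter fun a => MeasurableSet.iInter fun b => MeasurableSet.iInter fun _ =>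
    measurableSet_lt (measurable_pi_apply a) (measurable_pi_apply b)

theorem measurableSet_rankEvent {r n : ℕ} (σ : Ranking r n) : MeasurableSet (rankEvent σ) := by
  have : Measurable fun (X : Fin n → Fin r → ℝ) (k : Icc 1 (r * n)) =>
      X (σ.symm k).1 (σ.symm k).2 := by fun_prop
  exact this (measurableSet_strictMono_of_fintype _)

theorem pi_rankEvent {r n : ℕ} (σ : Ranking r n) :
    (Measure.pi fun _ : Fin n => cubeMeasure r) (rankEvent σ) =
      (Measure.pi fun _ : Icc 1 (r * n) => unitMeasure) {x | StrictMono x} := by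
  rw [← pi_map_comp_injective (fun _ : Fin n × Fin r => unitMeasure) σ.symm σ.symm.injective,
    Measure.map_apply (by fun_prop) (measurableSet_strictMono_of_fintype _)]
  simp only [cubeMeasure]
  rw [← pi_map_curry, Measure.map_apply (MeasurableEquiv.curry _ _ _).measurable
    (measurableSet_rankEvent σ)]
  rfl

theorem ae_injective_pi_unitMeasure (κ : Type*) [Fintype κ] :
    ∀ᵐ x ∂(Measure.pi fun _ : κ => unitMeasure), Function.Injective x := by
  have hac : (Measure.pi fun _ : κ => unitMeasure) ≪ (volume : Measure (κ → ℝ)) := by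
    simp only [unitMeasure]
    rw [← Measure.restrict_pi_pi]
    exact Measure.restrict_le_self.absolutelyContinuous
  have h : ∀ a b : κ, ∀ᵐ x ∂(Measure.pi fun _ : κ => unitMeasure), a ≠ b → x a ≠ x b := by
    intro a b
    by_cases hab : a = b
    · exact Eventually.of_forall fun x h => absurd hab h
    refine hac.ae_le (measure_mono_null ?_ (Measure.addHaar_submodule volume
      (LinearMap.ker (LinearMap.proj (R := ℝ) (φ := fun _ : κ => ℝ) a - LinearMap.proj b)) ?_))
    · intro x hx
      simpa [hab, sub_eq_zero] using hx
    · intro htop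
      classical
      have : (Pi.single a 1 : κ → ℝ) ∈
          LinearMap.ker (LinearMap.proj (R := ℝ) (φ := fun _ : κ => ℝ) a - LinearMap.proj b) :=
        htop ▸ trivial
      simp [Pi.single_eq_of_ne (Ne.symm hab)] at this
  filter_upwards [ae_all_iff.2 fun a => ae_all_iff.2 (h a)] with x hx a b hab
  by_contra hne
  exact hx a b hne hab

theorem ae_injective_pi_cubeMeasure (r n : ℕ) :
    ∀ᵐ X ∂(Measure.pi fun _ : Fin n => cubeMeasure r),
      Function.Injective fun a : Fin n × Fin r => X a.1 a.2 := by
  simp only [cubeMeasure]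
  rw [← pi_map_curry, (MeasurableEquiv.curry _ _ _).measurableEmbedding.ae_map_iff]
  exact ae_injective_pi_unitMeasure _

theorem exists_mem_rankEvent {r n : ℕ} {X : Fin n → Fin r → ℝ}
    (hX : Function.Injective fun a : Fin n × Fin r => X a.1 a.2) :
    ∃ σ : Ranking r n, X ∈ rankEvent σ := by
  set f := fun a : Fin n × Fin r => X a.1 a.2 with hf
  have hcard : (univ.image f).card = r * n := by
    rw [card_image_of_injective _ hX, card_univ, Fintype.card_prod, Fintype.card_fin,
      Fintype.card_fin, mul_comm]
  have hbij : Function.Bijective fun a => (⟨f a, mem_image_of_mem f (mem_univ a)⟩ : univ.image f) :=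
    ⟨fun a b h => hX (congrArg Subtype.val h), fun y => by
      obtain ⟨a, -, ha⟩ := mem_image.1 y.2
      exact ⟨a, Subtype.ext ha⟩⟩
  set g : univ.image f ≃o Icc 1 (r * n) := ((univ.image f).orderIsoOfFin hcard).symm.trans
    ((Icc 1 (r * n)).orderIsoOfFin (by simp)) with hg
  set τ := Equiv.ofBijective _ hbij with hτ
  refine ⟨τ.trans g.toEquiv, fun k l hkl => ?_⟩
  have h : ∀ k, f (τ.symm (g.symm k)) = g.symm k := fun k =>
    congrArg Subtype.val (τ.apply_symm_apply (g.symm k))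
  change f (τ.symm (g.symm k)) < f (τ.symm (g.symm l))
  rw [h, h]
  exact g.symm.strictMono hkl

theorem disjoint_rankEvent {r n : ℕ} {σ τ : Ranking r n} (h : σ ≠ τ) :
    Disjoint (rankEvent σ) (rankEvent τ) := by
  rw [Set.disjoint_left]
  intro X hσ hτ
  have h1 : StrictMono fun k => X (σ.symm k).1 (σ.symm k).2 := hσ
  have h2 : StrictMono fun k => X (τ.symm k).1 (τ.symm k).2 := hτ
  have heq := (h1.range_inj h2).1 (by
    rw [show (fun k => X (σ.symm k).1 (σ.symm k).2) =
        (fun a : Fin n × Fin r => X a.1 a.2) ∘ σ.symm from rfl,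
      show (fun k => X (τ.symm k).1 (τ.symm k).2) =
        (fun a : Fin n × Fin r => X a.1 a.2) ∘ τ.symm from rfl,
      σ.symm.surjective.range_comp, τ.symm.surjective.range_comp])
  have hinj : Function.Injective fun a : Fin n × Fin r => X a.1 a.2 :=
    Function.Injective.of_comp_right (g := σ.symm) h1.injective σ.symm.surjective
  exact h (Equiv.symm_bijective.injective (Equiv.ext fun k => hinj (congrFun heq k)))

/-- Probabilities under independent sorted vectors count rankings. -/
theorem pi_real_chamber_inter {r n : ℕ} (Q : Finset (Finset ℕ) → Prop)
    {F : Set (Fin n → Fin r → ℝ)}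
    (hF : ∀ σ : Ranking r n, RowIncreasing σ → ∀ X ∈ rankEvent σ, X ∈ F ↔ Q (rowMatching σ)) :
    (Measure.pi fun _ : Fin n => cubeMeasure r).real ((Set.univ.pi fun _ => chamber r) ∩ F) =
      Nat.card {σ : Ranking r n // RowIncreasing σ ∧ Q (rowMatching σ)} *
        (Measure.pi fun _ : Icc 1 (r * n) => unitMeasure).real {x | StrictMono x} := by
  classical
  have hae : (((Set.univ.pi fun _ => chamber r) ∩ F : Set (Fin n → Fin r → ℝ)))
      =ᵐ[Measure.pi fun _ : Fin n => cubeMeasure r]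
      ⋃ σ ∈ univ.filter fun σ : Ranking r n => RowIncreasing σ ∧ Q (rowMatching σ),
        rankEvent σ := by
    filter_upwards [ae_injective_pi_cubeMeasure r n] with X hX
    refine propext ?_
    change (X ∈ (Set.univ.pi fun _ => chamber r) ∩ F) ↔ X ∈ ⋃ σ ∈ univ.filter fun σ : Ranking r n =>
      RowIncreasing σ ∧ Q (rowMatching σ), rankEvent σ
    simp only [Set.mem_inter_iff, Set.mem_univ_pi, Set.mem_iUnion, mem_filter, mem_univ, true_and,
      exists_prop]
    constructor
    · rintro ⟨hc, hXF⟩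
      obtain ⟨σ, hσ⟩ := exists_mem_rankEvent hX
      have hrow : RowIncreasing σ := fun j i l hil =>
        (lt_iff_of_mem_rankEvent hσ j j i l).1 (hc j hil)
      exact ⟨σ, ⟨hrow, (hF σ hrow X hσ).1 hXF⟩, hσ⟩
    · rintro ⟨σ, ⟨hrow, hQ⟩, hσ⟩
      exact ⟨fun j i l hil => (lt_iff_of_mem_rankEvent hσ j j i l).2 (hrow j hil),
        (hF σ hrow X hσ).2 hQ⟩
  rw [measureReal_congr hae, measureReal_biUnion_finset
    (fun σ _ τ _ h => disjoint_rankEvent h) fun σ _ => measurableSet_rankEvent σ]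
  simp only [Measure.real, pi_rankEvent]
  rw [sum_const, nsmul_eq_mul, Nat.card_eq_fintype_card, Fintype.card_subtype]

theorem pi_sorted_real_eq {r : ℕ} (hr : 0 < r) {n : ℕ} (Q : Finset (Finset ℕ) → Prop)
    {F : Set (Fin n → Fin r → ℝ)}
    (hF : ∀ σ : Ranking r n, RowIncreasing σ → ∀ X ∈ rankEvent σ, X ∈ F ↔ Q (rowMatching σ)) :
    (Measure.pi fun _ : Fin n => sortedMeasure r).real F =
      (Nat.card {M : Finset (Finset ℕ) // IsOrderedMatching r n M ∧ Q M} : ℝ) /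
        totalMatchings r n := by
  have hC : MeasurableSet (Set.univ.pi fun _ : Fin n => chamber r) :=
    MeasurableSet.univ_pi fun _ => measurableSet_chamber r
  have hC0 : (Measure.pi fun _ : Fin n => cubeMeasure r).real
      (Set.univ.pi fun _ : Fin n => chamber r) ≠ 0 := by
    rw [Measure.real, Measure.pi_pi, ENNReal.toReal_prod]
    exact prod_ne_zero_iff.2 fun _ _ => (cubeMeasure_real_chamber_pos hr).ne'
  have h1 := pi_real_chamber_inter Q hF
  have h2 := pi_real_chamber_inter (r := r) (n := n) (fun _ => True) (F := Set.univ)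
    (fun σ _ X _ => by simp)
  rw [card_rowIncreasing hr] at h1
  rw [card_rowIncreasing hr n fun _ => True] at h2
  rw [Set.inter_univ] at h2
  simp only [sortedMeasure]
  rw [← cond_pi (fun _ : Fin n => cubeMeasure r) (fun _ => measurableSet_chamber r)
    (fun _ => cubeMeasure_chamber_ne_zero hr), Measure.real, ProbabilityTheory.cond_apply hC,
    ENNReal.toReal_mul, ENNReal.toReal_inv, ← Measure.real, ← Measure.real, h1]
  have htot : Nat.card {M : Finset (Finset ℕ) // IsOrderedMatching r n M ∧ True} =
      totalMatchings r n := by simp [totalMatchings]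
  rw [htot] at h2
  have h3 := h2 ▸ hC0
  rw [h2]
  push_cast
  have h4 := left_ne_zero_of_mul h3
  have h5 := right_ne_zero_of_mul h3
  push_cast at h4
  have h6 := left_ne_zero_of_mul h4
  have h7 := right_ne_zero_of_mul h4
  field_simp

theorem partiteRel_iff_formsPattern {r n : ℕ} {ε : Fin r → Bool} {p q : Fin r → ℕ}
    (hp : StrictMono p) (hq : StrictMono q) (hpq : PartiteRel ε (realVec p) (realVec q))
    {σ : Ranking r n} (hσ : RowIncreasing σ) {X : Fin n → Fin r → ℝ} (hX : X ∈ rankEvent σ)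
    {j k : Fin n} (hjk : j ≠ k) : PartiteRel ε (X j) (X k) ↔
      FormsPattern (rowEdge σ j) (rowEdge σ k) {univ.image p, univ.image q} := by
  rw [partiteRel_congr (x' := realVec (rowVec σ j)) (y' := realVec (rowVec σ k))
    (fun i l => by simpa [realVec] using lt_iff_of_mem_rankEvent hX j k i l)
    fun i l => by simpa [realVec] using lt_iff_of_mem_rankEvent hX k j i l]
  exact ⟨fun h => formsPattern_of_partiteRel (hσ j) (hσ k) hp hq (rowVec_ne σ hjk) h hpq,
    partiteRel_of_formsPattern (hσ j) (hσ k) hp hq hpq⟩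

theorem cliqueSize_rowMatching {r n : ℕ} (hr : 0 < r) {ε : Fin r → Bool} {p q : Fin r → ℕ}
    (hp : StrictMono p) (hq : StrictMono q) (hpq : PartiteRel ε (realVec p) (realVec q))
    {σ : Ranking r n} (hσ : RowIncreasing σ) {X : Fin n → Fin r → ℝ} (hX : X ∈ rankEvent σ) :
    cliqueSize {univ.image p, univ.image q} (rowMatching σ) =
      cliqueNum Set.univ (PartiteRel ε) X := by
  have hinj := rowEdge_injective hr σ
  refine IsGreatest.csSup_eq ⟨?_, ?_⟩
  · obtain ⟨S, hS, hc⟩ := exists_isIndexClique Set.univ (PartiteRel ε) X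
    refine ⟨S.image (rowEdge σ), image_subset_image (subset_univ S), ?_, ?_⟩
    · intro e he f hf hef
      obtain ⟨j, hj, rfl⟩ := mem_image.1 he
      obtain ⟨k, hk, rfl⟩ := mem_image.1 hf
      have hjk : j ≠ k := fun h => hef (by rw [h])
      exact (partiteRel_iff_formsPattern hp hq hpq hσ hX hjk).1 (hS.2 j hj k hk hjk)
    · rw [card_image_of_injective _ hinj, hc]
  · rintro _ ⟨S, hSM, hS, rfl⟩
    obtain ⟨T, -, rfl⟩ := subset_image_iff.1 hSM
    rw [card_image_of_injective _ hinj]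
    refine IsIndexClique.card_le ⟨fun _ _ => trivial, fun j hj k hk hjk => ?_⟩
    exact (partiteRel_iff_formsPattern hp hq hpq hσ hX hjk).2
      (hS _ (mem_image_of_mem _ hj) _ (mem_image_of_mem _ hk) (hinj.ne hjk))

theorem cliqueSizeConvergesTo_partiteConstant {r : ℕ} (hr : 0 < r) {P : Finset (Finset ℕ)}
    (hP : IsPattern r P) (hpart : IsPartite r 2 P) :
    CliqueSizeConvergesTo r P (partiteConstant r) := by
  obtain ⟨ε, p, q, hp, hq, hpq, rfl⟩ := exists_eq_pair_of_isPartite hP hpart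
  intro δ hδ
  refine (tendsto_pi_sorted_real hr ε hδ).congr fun n => ?_
  refine pi_sorted_real_eq hr (fun M => δ ≤ |(cliqueSize {univ.image p, univ.image q} M : ℝ) /
    (n : ℝ) ^ ((1 : ℝ) / (r : ℝ)) - partiteConstant r|) fun σ hσ X hX => ?_
  rw [cliqueSize_rowMatching hr hp hq hpq hσ hX]
  rfl

end PartiteClique

/-- **Proposition 1.8(2).** Fix `r ≥ 2` and an `r`-partite `r`-pattern `P`.
For a uniformly random ordered `r`-matching `M_n` of size `n`,
`L_P(M_n)/n^(1/r)` converges in probability to a constant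
`b > 1/Γ((r+1)/r)`. -/
theorem random_matching_partite_limit (r : ℕ) (hr : 2 ≤ r)
    (P : Finset (Finset ℕ)) (hP : IsPattern r P) (hpart : IsPartite r 2 P) :
    ∃ b : ℝ, 1 / Real.Gamma (((r : ℝ) + 1) / (r : ℝ)) < b ∧
      CliqueSizeConvergesTo r P b :=
  ⟨PartiteClique.partiteConstant r, PartiteClique.lt_partiteConstant hr,
    PartiteClique.cliqueSizeConvergesTo_partiteConstant (by omega) hP hpart⟩
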